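/- Let J_{32} = J_{14} = 0, J_{13} J_{42} ≠ 0, and Q_{12}, Q_{21} ∈ W^n_1[0,1] for some n ≥ 3. Assume P^{(n_0)}(0) ≠ 0 for some n_0 ∈ {0,1,…,n−3}, Q_{12}(1) ≠ 0, and P^{(k)}(1) = 0 for every k ∈ {0,1,…,n−1}. Then the system of root functions of the boundary value problem is complete in L²([0,1];ℂ²). -/

import Mathlib

open MeasureTheory Set Filter

noncomputable section

/-- The unit interval `[0,1]` as a subset of `ℝ`. -/
def I01 : Set ℝ := Set.Icc 0 1

/-- Lebesgue measure restricted to `[0,1]`. -/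
def mu01 : MeasureTheory.Measure ℝ := MeasureTheory.volume.restrict I01

/-- `f ∈ W^n_1[0,1]`: the derivatives of `f` up to order `n-1` exist and are continuous on
`[0,1]`, and the `(n-1)`-st derivative is absolutely continuous, i.e. an indefinite integral
of an integrable function (its a.e.-derivative `f⁽ⁿ⁾ ∈ L¹[0,1]`). -/
def MemW1 (n : ℕ) (f : ℝ → ℂ) : Prop :=
  ContDiffOn ℝ (n - 1 : ℕ) f I01 ∧
  ∃ g : ℝ → ℂ, MeasureTheory.IntegrableOn g I01 ∧
    ∀ x ∈ I01, iteratedDerivWithin (n - 1) f I01 x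
      = iteratedDerivWithin (n - 1) f I01 0 + ∫ t in (0:ℝ)..x, g t

/-- `Jdet a j k` is the minor `J_{(j+1)(k+1)} = a_{1,j} a_{2,k} - a_{1,k} a_{2,j}` of the
boundary coefficient matrix (`0`-based indices). -/
def Jdet (a : Fin 2 → Fin 4 → ℂ) (j k : Fin 4) : ℂ := a 0 j * a 1 k - a 0 k * a 1 j

/-- `y` satisfies the two-point boundary conditions `U_j(y) = 0`, `j = 1, 2`. -/
def SatisfiesBC (a : Fin 2 → Fin 4 → ℂ) (y : ℝ → ℂ × ℂ) : Prop :=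
  ∀ j : Fin 2, a j 0 * (y 0).1 + a j 1 * (y 0).2 + a j 2 * (y 1).1 + a j 3 * (y 1).2 = 0

/-- `y` is absolutely continuous on `[0,1]` (an indefinite integral of an integrable `g`,
which is then its a.e. derivative) and satisfies `-i B⁻¹ y' + Q y = rhs` a.e. on `[0,1]`. -/
def SolvesDirac (b₁ b₂ : ℝ) (Q12 Q21 : ℝ → ℂ) (y rhs : ℝ → ℂ × ℂ) : Prop :=
  ∃ g : ℝ → ℂ × ℂ, MeasureTheory.IntegrableOn g I01 ∧
    (∀ x ∈ I01, y x = y 0 + ∫ t in (0:ℝ)..x, g t) ∧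
    (∀ᵐ x ∂mu01,
      (-Complex.I) * (b₁ : ℂ)⁻¹ * (g x).1 + Q12 x * (y x).2 = (rhs x).1 ∧
      (-Complex.I) * (b₂ : ℂ)⁻¹ * (g x).2 + Q21 x * (y x).1 = (rhs x).2)

/-- `y` is a root function of the boundary value problem: a member of a chain
`ch 0, …, ch m` of absolutely continuous functions satisfying the boundary conditions,
with `ch 0 ≠ 0`, `L (ch 0) = λ • ch 0` a.e. and `L (ch j) = λ • ch j + ch (j-1)` a.e. -/
def IsRootFunction (b₁ b₂ : ℝ) (Q12 Q21 : ℝ → ℂ) (a : Fin 2 → Fin 4 → ℂ)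
    (y : ℝ → ℂ × ℂ) : Prop :=
  ∃ (lam : ℂ) (m : ℕ) (ch : ℕ → ℝ → ℂ × ℂ),
    (∀ j ≤ m, SatisfiesBC a (ch j)) ∧
    (∃ x ∈ I01, ch 0 x ≠ 0) ∧
    SolvesDirac b₁ b₂ Q12 Q21 (ch 0) (fun x => lam • ch 0 x) ∧
    (∀ j, 1 ≤ j → j ≤ m →
      SolvesDirac b₁ b₂ Q12 Q21 (ch j) (fun x => lam • ch j x + ch (j - 1) x)) ∧
    ∃ j ≤ m, y = ch j

/-- Completeness of the system of root functions in `L²([0,1]; ℂ²)`: the closed linear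
span of (the `L²`-classes of) all root functions is the whole space. -/
def RootSystemComplete (b₁ b₂ : ℝ) (Q12 Q21 : ℝ → ℂ) (a : Fin 2 → Fin 4 → ℂ) : Prop :=
  (Submodule.span ℂ {g : MeasureTheory.Lp (ℂ × ℂ) 2 mu01 |
    ∃ y : ℝ → ℂ × ℂ, IsRootFunction b₁ b₂ Q12 Q21 a y ∧
      (g : ℝ → ℂ × ℂ) =ᵐ[mu01] y}).topologicalClosure = ⊤

section
open Complex Metric InnerProductSpace

theorem harnack_of_ne_zero {D : ℂ → ℂ} (hD : Differentiable ℂ D) {R M : ℝ} (hR : 0 < R)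
    (h0 : ∀ z ∈ closedBall (0 : ℂ) (2 * R), D z ≠ 0)
    (hM : ∀ z ∈ sphere (0 : ℂ) (2 * R), ‖D z‖ ≤ M) {w : ℂ} (hw : ‖w‖ ≤ R) :
    ‖D 0‖ ^ 3 ≤ M ^ 2 * ‖D w‖ := by
  have h2R : (0:ℝ) < 2 * R := by positivity
  have hMpos : 0 < M := by
    have hz : (((2 * R : ℝ) : ℂ)) ∈ sphere (0 : ℂ) (2 * R) := by
      simp [abs_of_pos hR]
    exact (norm_pos_iff.2 (h0 _ (sphere_subset_closedBall hz))).trans_le (hM _ hz)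
  set v : ℂ → ℝ := fun z => Real.log M - Real.log ‖D z‖ with hv
  have hharm : HarmonicOnNhd v (closedBall 0 (2 * R)) := by
    intro z hz
    have h1 : HarmonicAt (fun z => Real.log ‖D z‖) z :=
      ((hD.analyticAt z).harmonicAt_log_norm (h0 z hz))
    have h2 : HarmonicAt (fun _ : ℂ => Real.log M) z := harmonicAt_const _
    exact h2.sub h1
  have hwb : w ∈ ball (0 : ℂ) (2 * R) := by simp; linarith
  have e1 := hharm.circleAverage_re_herglotzRieszKernel_smul hwb
  have e2 : Real.circleAverage v 0 (2 * R) = v 0 := by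
    apply InnerProductSpace.HarmonicOnNhd.circleAverage_eq
    rwa [abs_of_pos h2R]
  have hvc : ContinuousOn v (closedBall 0 (2 * R)) := by
    intro z hz
    have : ContinuousAt (fun z => Real.log ‖D z‖) z :=
      (hD.continuous.continuousAt.norm).log (norm_ne_zero_iff.2 (h0 z hz))
    exact (continuousAt_const.sub this).continuousWithinAt
  have hvs : ContinuousOn v (sphere 0 (2 * R)) := hvc.mono sphere_subset_closedBall
  have hle : Real.circleAverage ((re ∘ herglotzRieszKernel 0 w) • v) 0 (2 * R)
      ≤ Real.circleAverage (fun z => 3 * v z) 0 (2 * R) := by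
    apply Real.circleAverage_mono
    · apply ContinuousOn.circleIntegrable'
      rw [abs_of_pos h2R]
      apply ContinuousOn.smul _ hvs
      apply Complex.continuous_re.comp_continuousOn
      intro z hz
      simp only [herglotzRieszKernel_fun_def]
      apply ContinuousAt.continuousWithinAt
      have : z - 0 - (w - 0) ≠ 0 := by
        simp only [sub_zero]
        intro h
        rw [sub_eq_zero] at h
        subst h
        simp at hz; linarith
      fun_prop (disch := assumption)
    · apply ContinuousOn.circleIntegrable'
      rw [abs_of_pos h2R]
      exact hvs.const_smul (3:ℝ)
    · rw [abs_of_pos h2R]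
      intro z hz
      have hk := re_herglotzRieszKernel_le hz hwb
      have hvz : 0 ≤ v z := by
        have := h0 z (sphere_subset_closedBall hz)
        simp only [hv, sub_nonneg]
        exact Real.log_le_log (norm_pos_iff.2 this) (hM z hz)
      simp only [Pi.smul_apply', Function.comp, smul_eq_mul]
      apply mul_le_mul_of_nonneg_right _ hvz
      refine hk.trans ?_
      simp only [sub_zero]
      rw [div_le_iff₀ (by linarith)]
      linarith
  have e3 : Real.circleAverage (fun z => 3 * v z) 0 (2 * R) = 3 * v 0 := by
    rw [← e2]
    exact Real.circleAverage_fun_smul (a := (3:ℝ)) (f := v)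
  rw [e1, e3] at hle
  have hD0 : 0 < ‖D 0‖ := norm_pos_iff.2 (h0 0 (by simp; positivity))
  have hDw : 0 < ‖D w‖ := norm_pos_iff.2 (h0 w (ball_subset_closedBall hwb))
  rw [← Real.log_le_log_iff (by positivity) (by positivity), Real.log_mul (by positivity) hDw.ne',
    Real.log_pow, Real.log_pow]
  simp only [hv] at hle
  push_cast
  linarith

theorem differentiable_dslope {E : Type*} [NormedAddCommGroup E] [NormedSpace ℂ E]
    [CompleteSpace E] {f : ℂ → E} (hf : Differentiable ℂ f) (c : ℂ) :
    Differentiable ℂ (dslope f c) := by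
  rw [← differentiableOn_univ] at hf ⊢
  exact (Complex.differentiableOn_dslope Filter.univ_mem).2 hf

theorem norm_le_of_sphere {f : ℂ → ℂ} (hf : Differentiable ℂ f) {r C : ℝ} (hr : 0 < r)
    (h : ∀ z ∈ sphere (0 : ℂ) r, ‖f z‖ ≤ C) {w : ℂ} (hw : ‖w‖ ≤ r) : ‖f w‖ ≤ C := by
  refine Complex.norm_le_of_forall_mem_frontier_norm_le (U := ball (0 : ℂ) r) isBounded_ball
    hf.diffContOnCl ?_ ?_
  · rwa [frontier_ball _ hr.ne']
  · rw [closure_ball _ hr.ne']; simpa using hw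

theorem norm_quotient_le_aux {R MF MD : ℝ} (hR : 0 < R) {H : ℂ → ℂ} (hH : Differentiable ℂ H)
    {w : ℂ} (hw : ‖w‖ ≤ R) (N : ℕ) : ∀ D : ℂ → ℂ, Differentiable ℂ D → D 0 ≠ 0 →
    (∀ z ∈ sphere (0 : ℂ) (6 * R), ‖D z‖ ≤ MD) →
    (∀ z ∈ sphere (0 : ℂ) (6 * R), ‖H z * D z‖ ≤ MF) → MD < ‖D 0‖ * (3 / 2) ^ N →
    ‖H w‖ * ‖D 0‖ ^ 3 ≤ MF * MD ^ 2 := by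
  have h6 : 0 < 6 * R := by positivity
  induction N with
  | zero =>
    intro D hD hD0 hM _ hN
    exact absurd (norm_le_of_sphere hD h6 hM (w := 0) (by simpa using h6.le)) (by simpa using hN)
  | succ N ih =>
    intro D hD hD0 hMD hMF hN
    have hMDnn : 0 ≤ MD := (norm_nonneg _).trans
      (norm_le_of_sphere hD h6 hMD (w := 0) (by simpa using h6.le))
    by_cases hz : ∃ ρ ∈ closedBall (0 : ℂ) (2 * R), D ρ = 0
    · obtain ⟨ρ, hρ, hDρ⟩ := hz
      have hρ0 : ρ ≠ 0 := by rintro rfl; exact hD0 hDρ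
      have hρ2 : ‖ρ‖ ≤ 2 * R := by simpa using hρ
      set D' : ℂ → ℂ := fun z => dslope D ρ z * (3 * R : ℝ) with hD'
      have hval : ∀ z, z ≠ ρ → D' z = D z * ((3 * R : ℝ) / (z - ρ)) := by
        intro z hz
        have : z - ρ ≠ 0 := sub_ne_zero.2 hz
        simp only [hD', dslope_of_ne _ hz, slope_def_field, hDρ]
        field_simp
        simp
      have hfac : ∀ z ∈ sphere (0 : ℂ) (6 * R), z ≠ ρ ∧ ‖((3 * R : ℝ) : ℂ) / (z - ρ)‖ ≤ 1 := by
        intro z hz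
        have hz' : ‖z‖ = 6 * R := by simpa using hz
        have h4 : 4 * R ≤ ‖z - ρ‖ := by
          have := norm_sub_norm_le z ρ; linarith
        refine ⟨?_, ?_⟩
        · rintro rfl; simp at h4; linarith
        · rw [norm_div, div_le_one (by linarith), norm_real, Real.norm_of_nonneg (by positivity)]
          linarith
      have h00 : ‖D 0‖ * (3 / 2) ≤ ‖D' 0‖ := by
        rw [hval 0 hρ0.symm, norm_mul, norm_div, zero_sub, norm_neg, norm_real,
          Real.norm_of_nonneg (by positivity)]
        refine mul_le_mul_of_nonneg_left ?_ (norm_nonneg _)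
        rw [le_div_iff₀ (norm_pos_iff.2 hρ0)]
        linarith
      have hD0p : 0 < ‖D 0‖ := norm_pos_iff.2 hD0
      have key := ih D' ((differentiable_dslope hD ρ).mul_const _)
        (norm_pos_iff.1 (by linarith)) ?_ ?_ ?_
      · refine le_trans ?_ key
        gcongr
        linarith
      · intro z hz
        obtain ⟨h1, h2⟩ := hfac z hz
        rw [hval z h1, norm_mul]
        exact (mul_le_of_le_one_right (norm_nonneg _) h2).trans (hMD z hz)
      · intro z hz
        obtain ⟨h1, h2⟩ := hfac z hz
        rw [hval z h1, ← mul_assoc, norm_mul]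
        exact (mul_le_of_le_one_right (norm_nonneg _) h2).trans (hMF z hz)
      · refine hN.trans_le ?_
        rw [pow_succ', ← mul_assoc]
        gcongr
    · push Not at hz
      have h := harnack_of_ne_zero hD hR hz
        (fun z hz => norm_le_of_sphere hD h6 hMD
          (by have : ‖z‖ = 2 * R := by simpa using hz
              linarith)) hw
      have hFw := norm_le_of_sphere (hH.mul hD) h6 hMF (w := w) (by linarith)
      calc ‖H w‖ * ‖D 0‖ ^ 3 ≤ ‖H w‖ * (MD ^ 2 * ‖D w‖) := by gcongr
        _ = ‖H w * D w‖ * MD ^ 2 := by rw [norm_mul]; ring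
        _ ≤ MF * MD ^ 2 := by gcongr; exact hFw

theorem norm_quotient_le {R MF MD : ℝ} (hR : 0 < R) {H D : ℂ → ℂ} (hH : Differentiable ℂ H)
    (hD : Differentiable ℂ D) (hD0 : D 0 ≠ 0)
    (hMD : ∀ z ∈ sphere (0 : ℂ) (6 * R), ‖D z‖ ≤ MD)
    (hMF : ∀ z ∈ sphere (0 : ℂ) (6 * R), ‖H z * D z‖ ≤ MF) {w : ℂ} (hw : ‖w‖ ≤ R) :
    ‖H w‖ * ‖D 0‖ ^ 3 ≤ MF * MD ^ 2 := by
  obtain ⟨N, hN⟩ := pow_unbounded_of_one_lt (MD / ‖D 0‖) (by norm_num : (1:ℝ) < 3 / 2)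
  refine norm_quotient_le_aux hR hH hw N D hD hD0 hMD hMF ?_
  rwa [div_lt_iff₀' (norm_pos_iff.2 hD0)] at hN

/-- A quotient of entire functions of exponential type which is entire is of exponential type. -/
theorem exists_exp_bound_of_mul {H D F : ℂ → ℂ} (hH : Differentiable ℂ H)
    (hD : Differentiable ℂ D) (hF : ∀ z, H z * D z = F z) (hDne : ∃ z, D z ≠ 0)
    {CD CF a b : ℝ} (ha : 0 ≤ a) (hb : 0 ≤ b)
    (hDb : ∀ z, ‖D z‖ ≤ CD * Real.exp (a * ‖z‖)) (hFb : ∀ z, ‖F z‖ ≤ CF * Real.exp (b * ‖z‖)) :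
    ∃ C B : ℝ, 0 ≤ B ∧ ∀ z, ‖H z‖ ≤ C * Real.exp (B * ‖z‖) := by
  obtain ⟨c, hc⟩ := hDne
  have hCD : 0 ≤ CD := by
    have := (norm_nonneg _).trans (hDb 0); simpa using this
  have hCF : 0 ≤ CF := by
    have := (norm_nonneg _).trans (hFb 0); simpa using this
  have hDc : 0 < ‖D c‖ := norm_pos_iff.2 hc
  set K := 6 * (1 + ‖c‖) + ‖c‖ with hK
  refine ⟨CF * Real.exp (b * K) * (CD * Real.exp (a * K)) ^ 2 / ‖D c‖ ^ 3, 6 * b + 12 * a,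
    by positivity, fun z => ?_⟩
  set R := 1 + ‖c‖ + ‖z‖ with hR
  have hRpos : 0 < R := by positivity
  have hsph : ∀ u ∈ sphere (0 : ℂ) (6 * R), ‖u + c‖ ≤ 6 * ‖z‖ + K := by
    intro u hu
    have : ‖u‖ = 6 * R := by simpa using hu
    have := norm_add_le u c
    linarith
  have key := norm_quotient_le (H := fun u => H (u + c)) (D := fun u => D (u + c)) (R := R)
    (MD := CD * Real.exp (a * (6 * ‖z‖ + K))) (MF := CF * Real.exp (b * (6 * ‖z‖ + K)))
    hRpos (hH.comp (differentiable_id.add_const c)) (hD.comp (differentiable_id.add_const c))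
    (by simpa using hc)
    (fun u hu => (hDb _).trans (by gcongr; exact hsph u hu))
    (fun u hu => by
      rw [hF]
      exact (hFb _).trans (by gcongr; exact hsph u hu)) (w := z - c)
    (by have := norm_sub_le z c; linarith)
  simp only [sub_add_cancel, zero_add] at key
  rw [div_mul_eq_mul_div, le_div_iff₀ (by positivity)]
  refine key.trans (le_of_eq ?_)
  have e1 : Real.exp (b * (6 * ‖z‖ + K)) = Real.exp (b * K) * Real.exp (6 * b * ‖z‖) := by
    rw [← Real.exp_add]; ring_nf
  have e2 : Real.exp (a * (6 * ‖z‖ + K)) ^ 2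
      = Real.exp (a * K) ^ 2 * Real.exp (12 * a * ‖z‖) := by
    rw [← Real.exp_nat_mul, ← Real.exp_nat_mul, ← Real.exp_add]; push_cast; ring_nf
  have e3 : Real.exp ((6 * b + 12 * a) * ‖z‖)
      = Real.exp (6 * b * ‖z‖) * Real.exp (12 * a * ‖z‖) := by
    rw [← Real.exp_add]; ring_nf
  rw [mul_pow, mul_pow, e1, e2, e3]; ring

end

section
open Complex Metric Set Filter

theorem norm_le_quadrant {H : ℂ → ℂ} (hH : Differentiable ℂ H) {C B K : ℝ} (m : ℕ)
    (hB : ∀ z, ‖H z‖ ≤ C * Real.exp (B * ‖z‖))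
    (hre : ∀ x : ℝ, 0 ≤ x → ‖H x‖ ≤ K * (1 + x) ^ m)
    (him : ∀ x : ℝ, 0 ≤ x → ‖H (x * I)‖ ≤ K * (1 + x) ^ m) {z : ℂ}
    (hzr : 0 ≤ z.re) (hzi : 0 ≤ z.im) : ‖H z‖ ≤ 2 ^ m * K * (1 + ‖z‖) ^ m := by
  have hK : 0 ≤ K := by simpa using (norm_nonneg _).trans (hre 0 le_rfl)
  have hne : ∀ z : ℂ, 0 ≤ z.re → 1 ≤ ‖1 + z‖ := by
    intro z hz
    calc (1:ℝ) ≤ (1 + z).re := by simpa using hz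
      _ ≤ ‖1 + z‖ := Complex.re_le_norm _
  have hne0 : ∀ z : ℂ, 0 ≤ z.re → 1 + z ≠ 0 := fun z hz =>
    norm_pos_iff.1 (zero_lt_one.trans_le (hne z hz))
  have hcl : closure (Ioi (0:ℝ) ×ℂ Ioi (0:ℝ)) = Ici 0 ×ℂ Ici 0 := by
    rw [Complex.closure_reProdIm, closure_Ioi]
  set f : ℂ → ℂ := fun z => H z / (1 + z) ^ m with hf
  have hd : DiffContOnCl ℂ f (Ioi 0 ×ℂ Ioi 0) := by
    apply DifferentiableOn.diffContOnCl
    rw [hcl]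
    intro z hz
    apply DifferentiableAt.differentiableWithinAt
    exact (hH z).div (by fun_prop) (pow_ne_zero _ (hne0 z hz.1))
  have key : ‖f z‖ ≤ 2 ^ m * K := by
    refine PhragmenLindelof.quadrant_I hd ⟨1, by norm_num, B, ?_⟩ ?_ ?_ hzr hzi
    · refine Asymptotics.IsBigO.of_bound C ?_
      filter_upwards [mem_inf_of_right (mem_principal_self _)] with z hz
      have h1 : 1 ≤ ‖(1 + z) ^ m‖ := by
        rw [norm_pow]; exact one_le_pow₀ (hne z (le_of_lt hz.1))
      rw [hf, norm_div, Real.rpow_one, Real.norm_of_nonneg (Real.exp_pos _).le]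
      exact (div_le_self (norm_nonneg _) h1).trans (hB z)
    · intro x hx
      have h1 : ‖1 + (x:ℂ)‖ = 1 + x := by
        rw [← ofReal_one, ← ofReal_add, norm_real, Real.norm_of_nonneg (by positivity)]
      rw [hf, norm_div, norm_pow, h1, div_le_iff₀ (by positivity)]
      refine (hre x hx).trans ?_
      have : (1:ℝ) ≤ 2 ^ m := one_le_pow₀ (by norm_num)
      have h3 : 0 ≤ K * (1 + x) ^ m := by positivity
      nlinarith
    · intro x hx
      have h1 : 1 + x ≤ 2 * ‖1 + (x:ℂ) * I‖ := by
        have h2 := Complex.re_le_norm (1 + (x:ℂ) * I)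
        have h3 := Complex.im_le_norm (1 + (x:ℂ) * I)
        simp at h2 h3
        linarith
      have h2 : 0 < ‖1 + (x:ℂ) * I‖ := norm_pos_iff.2 (hne0 _ (by simp))
      rw [hf, norm_div, norm_pow, div_le_iff₀ (by positivity)]
      calc ‖H (x * I)‖ ≤ K * (1 + x) ^ m := him x hx
        _ ≤ K * (2 * ‖1 + (x:ℂ) * I‖) ^ m := by gcongr
        _ = _ := by rw [mul_pow]; ring
  have hz1 : 1 + ‖z‖ ≥ ‖1 + z‖ := by simpa using norm_add_le 1 z
  rw [hf, norm_div, norm_pow, div_le_iff₀ (pow_pos (norm_pos_iff.2 (hne0 z hzr)) _)] at key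
  exact key.trans (by gcongr)

theorem norm_le_of_four_rays {H : ℂ → ℂ} (hH : Differentiable ℂ H) {C B K : ℝ} (m : ℕ)
    (hB : ∀ z, ‖H z‖ ≤ C * Real.exp (B * ‖z‖)) {ω : ℂ} (hω : ‖ω‖ = 1)
    (hray : ∀ k : ℕ, ∀ x : ℝ, 0 ≤ x → ‖H (x * (ω * I ^ k))‖ ≤ K * (1 + x) ^ m) (z : ℂ) :
    ‖H z‖ ≤ 2 ^ m * K * (1 + ‖z‖) ^ m := by
  have hω0 : ω ≠ 0 := norm_pos_iff.1 (by rw [hω]; norm_num)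
  have main : ∀ k : ℕ, ∀ w : ℂ, 0 ≤ w.re → 0 ≤ w.im → z = ω * I ^ k * w →
      ‖H z‖ ≤ 2 ^ m * K * (1 + ‖z‖) ^ m := by
    intro k w h1 h2 h3
    have hn : ‖ω * I ^ k‖ = 1 := by simp [hω]
    have := norm_le_quadrant (H := fun u => H (ω * I ^ k * u)) (C := C) (B := B) (K := K)
      (hH.comp (differentiable_id.const_mul _)) m
      (fun u => by simpa [norm_mul, hn, hω] using hB (ω * I ^ k * u))
      (fun x hx => by simpa [mul_comm] using hray k x hx)
      (fun x hx => by
        have := hray (k + 1) x hx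
        rwa [pow_succ, show (x:ℂ) * (ω * (I ^ k * I)) = ω * I ^ k * (x * I) by ring] at this)
      h1 h2
    rw [← h3] at this
    rwa [h3, norm_mul, hn, one_mul, ← h3]
  set w := z / ω with hw
  have hz : z = ω * w := by rw [hw]; field_simp
  rcases le_total 0 w.re with h1 | h1 <;> rcases le_total 0 w.im with h2 | h2
  · exact main 0 w h1 h2 (by rw [hz]; ring)
  · refine main 3 (I * w) (by simpa using h2) (by simpa using h1) ?_
    rw [hz]; linear_combination -ω * w * (I ^ 2 - 1) * I_sq
  · refine main 1 (-I * w) (by simpa using h2) (by simpa using h1) ?_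
    rw [hz]; linear_combination ω * w * I_sq
  · refine main 2 (-w) (by simpa using h1) (by simpa using h2) ?_
    rw [hz]; linear_combination ω * w * I_sq

end

section
open Complex Metric Set Filter Topology

/-- Iterated divided differences of `f` at the point `c`. -/
noncomputable def iterDslope {E : Type*} [NormedAddCommGroup E] [NormedSpace ℂ E] (f : ℂ → E)
    (c : ℂ) : ℕ → ℂ → E
  | 0 => f
  | j + 1 => dslope (iterDslope f c j) c

section
variable {E : Type*} [NormedAddCommGroup E] [NormedSpace ℂ E]

theorem iterDslope_eq (f : ℂ → E) (c : ℂ) (j : ℕ) (z : ℂ) :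
    iterDslope f c j z = iterDslope f c j c + (z - c) • iterDslope f c (j + 1) z := by
  rw [iterDslope, sub_smul_dslope]; abel

theorem differentiable_iterDslope [CompleteSpace E] {f : ℂ → E} (hf : Differentiable ℂ f) (c : ℂ)
    (j : ℕ) : Differentiable ℂ (iterDslope f c j) := by
  induction j with
  | zero => exact hf
  | succ j ih => exact differentiable_dslope ih c

theorem map_eq_pow_mul_iterDslope (f : ℂ → E) (c : ℂ) (φ : E →L[ℂ] ℂ) (p : ℕ)
    (h : ∀ j < p, φ (iterDslope f c j c) = 0) (z : ℂ) :
    φ (f z) = (z - c) ^ p * φ (iterDslope f c p z) := by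
  induction p with
  | zero => simp [iterDslope]
  | succ p ih =>
    rw [ih fun j hj => h j (by omega), iterDslope_eq f c p z, map_add, h p (by omega), map_smul,
      pow_succ, smul_eq_mul, zero_add, mul_assoc]

theorem exists_iterDslope_ne_zero {D : ℂ → ℂ} (hD : Differentiable ℂ D) (hne : ∃ z, D z ≠ 0)
    (c : ℂ) : ∃ p, iterDslope D c p c ≠ 0 := by
  by_contra! hall
  have hnz : ¬ ∀ᶠ z in 𝓝 c, D z = 0 := by
    intro h
    obtain ⟨z, hz⟩ := hne
    have := AnalyticOnNhd.eq_of_eventuallyEq (f := D) (g := 0) (fun z _ => hD.analyticAt z)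
      (fun z _ => analyticAt_const) h
    exact hz (congrFun this z)
  obtain ⟨n, g, hg, hgc, hDg⟩ :=
    ((hD.analyticAt c).exists_eventuallyEq_pow_smul_nonzero_iff).2 hnz
  have e1 := map_eq_pow_mul_iterDslope D c (ContinuousLinearMap.id ℂ ℂ) (n + 1)
    (fun j _ => hall j)
  have h2 : ∀ᶠ z in 𝓝[≠] c, g z = (z - c) * iterDslope D c (n + 1) z := by
    filter_upwards [hDg.filter_mono nhdsWithin_le_nhds, self_mem_nhdsWithin] with z hz hzc
    have h3 : (z - c) ^ n ≠ 0 := pow_ne_zero _ (sub_ne_zero.2 hzc)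
    have := e1 z
    simp only [ContinuousLinearMap.id_apply] at this
    rw [hz, smul_eq_mul, pow_succ, mul_assoc] at this
    exact mul_left_cancel₀ h3 this
  have hc := (differentiable_iterDslope hD c (n + 1)).continuous
  have t1 : Tendsto g (𝓝[≠] c) (𝓝 (g c)) := hg.continuousAt.tendsto.mono_left nhdsWithin_le_nhds
  have t2 : Tendsto (fun z => (z - c) * iterDslope D c (n + 1) z) (𝓝[≠] c) (𝓝 0) := by
    have : Continuous fun z => (z - c) * iterDslope D c (n + 1) z := by fun_prop
    simpa using (this.tendsto c).mono_left nhdsWithin_le_nhds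
  exact hgc (tendsto_nhds_unique (t1.congr' h2) t2)

theorem exists_entire_of_local {F D : ℂ → ℂ} (hD : Differentiable ℂ D) (hne : ∃ z, D z ≠ 0)
    (h : ∀ c, ∃ g : ℂ → ℂ, AnalyticAt ℂ g c ∧ ∀ᶠ z in 𝓝 c, g z * D z = F z) :
    ∃ H : ℂ → ℂ, Differentiable ℂ H ∧ ∀ z, H z * D z = F z := by
  choose g hg hgF using h
  have hH : ∀ z, g z z * D z = F z := fun z => (hgF z).self_of_nhds
  refine ⟨fun z => g z z, fun c => ?_, hH⟩
  have hnz : ∀ᶠ z in 𝓝[≠] c, D z ≠ 0 := by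
    refine ((hD.analyticAt c).eventually_eq_zero_or_eventually_ne_zero).resolve_left fun h => ?_
    obtain ⟨z, hz⟩ := hne
    have := AnalyticOnNhd.eq_of_eventuallyEq (f := D) (g := 0) (fun z _ => hD.analyticAt z)
      (fun z _ => analyticAt_const) h
    exact hz (congrFun this z)
  have heq : (fun z => g z z) =ᶠ[𝓝 c] g c := by
    rw [eventually_nhdsWithin_iff] at hnz
    filter_upwards [hnz, hgF c] with z h1 h2
    rcases eq_or_ne z c with rfl | hz
    · rfl
    · exact mul_right_cancel₀ (h1 hz) ((hH z).trans h2.symm)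
  exact ((hg c).congr heq.symm).differentiableAt

theorem exists_entire_quotient [CompleteSpace E] {N : ℂ → E} (hN : Differentiable ℂ N)
    (φ : E →L[ℂ] ℂ) {D : ℂ → ℂ} (hD : Differentiable ℂ D) (hne : ∃ z, D z ≠ 0)
    (h : ∀ c j, (∀ i ≤ j, iterDslope D c i c = 0) → φ (iterDslope N c j c) = 0) :
    ∃ H : ℂ → ℂ, Differentiable ℂ H ∧ ∀ z, H z * D z = φ (N z) := by
  classical
  refine exists_entire_of_local hD hne fun c => ?_
  have hex := exists_iterDslope_ne_zero hD hne c
  set p := Nat.find hex with hp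
  have hpne : iterDslope D c p c ≠ 0 := Nat.find_spec hex
  have hlt : ∀ j < p, iterDslope D c j c = 0 := fun j hj => not_not.1 (Nat.find_min hex hj)
  have e1 := map_eq_pow_mul_iterDslope D c (ContinuousLinearMap.id ℂ ℂ) p hlt
  have e2 := map_eq_pow_mul_iterDslope N c φ p
    (fun j hj => h c j fun i hi => hlt i (hi.trans_lt hj))
  have hDp := differentiable_iterDslope hD c p
  have hNp := φ.differentiable.comp (differentiable_iterDslope hN c p)
  refine ⟨fun z => φ (iterDslope N c p z) / iterDslope D c p z,
    (hNp.analyticAt c).div (hDp.analyticAt c) hpne, ?_⟩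
  filter_upwards [hDp.continuous.continuousAt.eventually_ne hpne] with z hz
  have := e1 z
  simp only [ContinuousLinearMap.id_apply] at this
  rw [e2, this]
  field_simp
end

end

section
open Complex Set Filter Topology

theorem norm_le_of_hasDerivAt_decay {f r : ℝ → ℂ} {μ : ℂ} {a b ρ : ℝ}
    (h : ∀ x ∈ Icc a b, HasDerivAt f (μ * f x + r x) x) (hμ : μ.re < 0)
    (hr : ∀ x ∈ Icc a b, ‖r x‖ ≤ ρ) {x : ℝ} (hx : x ∈ Icc a b) :
    ‖f x‖ ≤ Real.exp (μ.re * (x - a)) * ‖f a‖ + ρ / (-μ.re) := by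
  have hρ : 0 ≤ ρ := (norm_nonneg _).trans (hr x hx)
  set F : ℝ → ℂ := fun x => exp (-μ * ((x - a : ℝ) : ℂ)) * f x with hF
  have hE : ∀ x : ℝ, ‖exp (-μ * ((x - a : ℝ) : ℂ))‖ = Real.exp (-μ.re * (x - a)) := by
    intro x; rw [norm_exp]; congr 1; simp only [mul_re, neg_re, ofReal_re, ofReal_im]; ring
  have hderE : ∀ x : ℝ, HasDerivAt (fun x : ℝ => exp (-μ * ((x - a : ℝ) : ℂ)))
      (exp (-μ * ((x - a : ℝ) : ℂ)) * (-μ)) x := by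
    intro x
    have h1 : HasDerivAt (fun x : ℝ => ((x - a : ℝ) : ℂ)) 1 x := by
      simpa using ((hasDerivAt_id x).sub_const a).ofReal_comp
    simpa using (h1.const_mul (-μ)).cexp
  have hderF : ∀ x ∈ Icc a b,
      HasDerivAt F (exp (-μ * ((x - a : ℝ) : ℂ)) * r x) x := by
    intro x hx
    refine ((hderE x).mul (h x hx)).congr_deriv ?_
    ring
  set B : ℝ → ℝ := fun x => ‖f a‖ + ρ / (-μ.re) * (Real.exp (-μ.re * (x - a)) - 1) with hB
  have hBd : ∀ x, HasDerivAt B (ρ * Real.exp (-μ.re * (x - a))) x := by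
    intro x
    have h1 : HasDerivAt (fun x : ℝ => -μ.re * (x - a)) (-μ.re) x := by
      simpa using ((hasDerivAt_id x).sub_const a).const_mul (-μ.re)
    have := ((h1.exp.sub_const 1).const_mul (ρ / (-μ.re))).const_add ‖f a‖
    refine this.congr_deriv ?_
    have : μ.re ≠ 0 := hμ.ne
    field_simp
  have key := image_norm_le_of_norm_deriv_right_le_deriv_boundary (f := F) (a := a) (b := b)
    (fun x hx => (hderF x hx).continuousAt.continuousWithinAt)
    (fun x hx => (hderF x (Ico_subset_Icc_self hx)).hasDerivWithinAt)
    (B := B) (by simp [hF, hB]) hBd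
    (fun x hx => by
      rw [norm_mul, hE, mul_comm]
      gcongr
      exact hr x (Ico_subset_Icc_self hx)) hx
  have e1 : ‖F x‖ = Real.exp (-μ.re * (x - a)) * ‖f x‖ := by rw [hF, norm_mul, hE]
  have e2 : Real.exp (μ.re * (x - a)) * Real.exp (-μ.re * (x - a)) = 1 := by
    rw [← Real.exp_add]; ring_nf; exact Real.exp_zero
  rw [e1] at key
  have key2 := mul_le_mul_of_nonneg_left key (Real.exp_pos (μ.re * (x - a))).le
  rw [← mul_assoc, e2, one_mul] at key2
  refine key2.trans ?_
  have h3 : 0 ≤ ρ / (-μ.re) := div_nonneg hρ (by linarith)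
  have : Real.exp (μ.re * (x - a)) * B x = Real.exp (μ.re * (x - a)) * ‖f a‖ + ρ / (-μ.re) *
      (Real.exp (μ.re * (x - a)) * Real.exp (-μ.re * (x - a)) - Real.exp (μ.re * (x - a))) := by
    simp only [hB]; ring
  rw [this, e2]
  have := Real.exp_pos (μ.re * (x - a))
  nlinarith

theorem norm_le_of_hasDerivAt_growth {f r : ℝ → ℂ} {μ : ℂ} {a b ρ : ℝ}
    (h : ∀ x ∈ Icc a b, HasDerivAt f (μ * f x + r x) x) (hμ : 0 < μ.re)
    (hr : ∀ x ∈ Icc a b, ‖r x‖ ≤ ρ) {x : ℝ} (hx : x ∈ Icc a b) :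
    ‖f x‖ ≤ Real.exp (-μ.re * (b - x)) * ‖f b‖ + ρ / μ.re := by
  have hm : ∀ y ∈ Icc (-b) (-a), -y ∈ Icc a b := fun y hy => ⟨by linarith [hy.2], by
    linarith [hy.1]⟩
  have := norm_le_of_hasDerivAt_decay (f := fun y => f (-y)) (r := fun y => - r (-y)) (μ := -μ)
    (a := -b) (b := -a) (ρ := ρ) (fun y hy => by
      have h1 := (h (-y) (hm y hy)).scomp y (hasDerivAt_neg y)
      refine h1.congr_deriv ?_
      simp) (by simpa using hμ) (fun y hy => by simpa using hr _ (hm y hy))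
    (x := -x) ⟨by linarith [hx.2], by linarith [hx.1]⟩
  simp only [neg_neg, neg_re] at this
  convert this using 4
  ring

theorem norm_sub_le_of_hasDerivAt {f f' : ℝ → ℂ} {C : ℝ}
    (h : ∀ x ∈ Icc (0:ℝ) 1, HasDerivAt f (f' x) x) (hC : ∀ x ∈ Icc (0:ℝ) 1, ‖f' x‖ ≤ C)
    {x y : ℝ} (hx : x ∈ Icc (0:ℝ) 1) (hy : y ∈ Icc (0:ℝ) 1) : ‖f y - f x‖ ≤ C := by
  have hC0 : 0 ≤ C := (norm_nonneg _).trans (hC x hx)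
  have := Convex.norm_image_sub_le_of_norm_hasDerivWithin_le
    (fun x hx => (h x hx).hasDerivWithinAt) hC (convex_Icc 0 1) hx hy
  refine this.trans (mul_le_of_le_one_right hC0 ?_)
  rw [Real.norm_eq_abs, abs_le]
  constructor <;> linarith [hx.1, hx.2, hy.1, hy.2]

/-- Solutions on `[0,1]` of the inhomogeneous `2 × 2` system. -/
structure IsSol (μ₁ μ₂ : ℂ) (q₁ q₂ G₁ G₂ y₁ y₂ : ℝ → ℂ) : Prop where
  d₁ : ∀ x ∈ Icc (0:ℝ) 1, HasDerivAt y₁ (μ₁ * y₁ x + (q₁ x * y₂ x + G₁ x)) x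
  d₂ : ∀ x ∈ Icc (0:ℝ) 1, HasDerivAt y₂ (μ₂ * y₂ x + (q₂ x * y₁ x + G₂ x)) x

theorem exists_sup {f : ℝ → ℂ} (hf : ContinuousOn f (Icc 0 1)) :
    ∃ S, (∃ x ∈ Icc (0:ℝ) 1, ‖f x‖ = S) ∧ ∀ x ∈ Icc (0:ℝ) 1, ‖f x‖ ≤ S := by
  obtain ⟨x, hx, h⟩ := isCompact_Icc.exists_isMaxOn (nonempty_Icc.2 zero_le_one) hf.norm
  exact ⟨‖f x‖, ⟨x, hx, rfl⟩, fun y hy => h hy⟩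

theorem IsSol.continuousOn₁ {μ₁ μ₂ : ℂ} {q₁ q₂ G₁ G₂ y₁ y₂ : ℝ → ℂ}
    (h : IsSol μ₁ μ₂ q₁ q₂ G₁ G₂ y₁ y₂) : ContinuousOn y₁ (Icc 0 1) :=
  fun x hx => (h.d₁ x hx).continuousAt.continuousWithinAt

theorem IsSol.continuousOn₂ {μ₁ μ₂ : ℂ} {q₁ q₂ G₁ G₂ y₁ y₂ : ℝ → ℂ}
    (h : IsSol μ₁ μ₂ q₁ q₂ G₁ G₂ y₁ y₂) : ContinuousOn y₂ (Icc 0 1) :=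
  fun x hx => (h.d₂ x hx).continuousAt.continuousWithinAt

/-- A priori estimate for dichotomous systems. -/
theorem IsSol.norm_le {μ₁ μ₂ : ℂ} {q₁ q₂ G₁ G₂ y₁ y₂ : ℝ → ℂ} {Q g κ : ℝ}
    (h : IsSol μ₁ μ₂ q₁ q₂ G₁ G₂ y₁ y₂) (hκ : 0 < κ) (hκQ : 2 * Q ≤ κ)
    (h₁ : κ ≤ μ₁.re) (h₂ : μ₂.re ≤ -κ)
    (hq₁ : ∀ x ∈ Icc (0:ℝ) 1, ‖q₁ x‖ ≤ Q) (hq₂ : ∀ x ∈ Icc (0:ℝ) 1, ‖q₂ x‖ ≤ Q)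
    (hG₁ : ∀ x ∈ Icc (0:ℝ) 1, ‖G₁ x‖ ≤ g) (hG₂ : ∀ x ∈ Icc (0:ℝ) 1, ‖G₂ x‖ ≤ g)
    {x : ℝ} (hx : x ∈ Icc (0:ℝ) 1) :
    ‖y₁ x‖ ≤ 2 * (‖y₁ 1‖ + ‖y₂ 0‖) + 2 * g / κ ∧ ‖y₂ x‖ ≤ 2 * (‖y₁ 1‖ + ‖y₂ 0‖) + 2 * g / κ := by
  have hQ : 0 ≤ Q := (norm_nonneg _).trans (hq₁ x hx)
  have hg : 0 ≤ g := (norm_nonneg _).trans (hG₁ x hx)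
  obtain ⟨S₁, ⟨x₁, hx₁, hS₁⟩, hb₁⟩ := exists_sup h.continuousOn₁
  obtain ⟨S₂, ⟨x₂, hx₂, hS₂⟩, hb₂⟩ := exists_sup h.continuousOn₂
  have hS₁0 : 0 ≤ S₁ := hS₁ ▸ norm_nonneg _
  have hS₂0 : 0 ≤ S₂ := hS₂ ▸ norm_nonneg _
  have e₁ : S₁ ≤ ‖y₁ 1‖ + (Q * S₂ + g) / κ := by
    rw [← hS₁]
    have := norm_le_of_hasDerivAt_growth h.d₁ (by linarith) (ρ := Q * S₂ + g) (fun x hx => by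
      refine (norm_add_le _ _).trans ?_
      rw [norm_mul]
      gcongr
      exacts [hq₁ x hx, hb₂ x hx, hG₁ x hx]) hx₁
    refine this.trans ?_
    gcongr
    refine mul_le_of_le_one_left (norm_nonneg _) (Real.exp_le_one_iff.2 ?_)
    nlinarith [hx₁.2]
  have e₂ : S₂ ≤ ‖y₂ 0‖ + (Q * S₁ + g) / κ := by
    rw [← hS₂]
    have := norm_le_of_hasDerivAt_decay h.d₂ (by linarith) (ρ := Q * S₁ + g) (fun x hx => by
      refine (norm_add_le _ _).trans ?_
      rw [norm_mul]
      gcongr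
      exacts [hq₂ x hx, hb₁ x hx, hG₂ x hx]) hx₂
    refine this.trans ?_
    have h3 : κ ≤ -μ₂.re := by linarith
    gcongr
    refine mul_le_of_le_one_left (norm_nonneg _) (Real.exp_le_one_iff.2 ?_)
    nlinarith [hx₂.1]
  have f₁ : (Q * S₂ + g) / κ ≤ S₂ / 2 + g / κ := by
    have : Q * S₂ / κ ≤ S₂ / 2 := by rw [div_le_iff₀ hκ]; nlinarith
    rw [add_div]; linarith
  have f₂ : (Q * S₁ + g) / κ ≤ S₁ / 2 + g / κ := by
    have : Q * S₁ / κ ≤ S₁ / 2 := by rw [div_le_iff₀ hκ]; nlinarith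
    rw [add_div]; linarith
  have e : 2 * g / κ = 2 * (g / κ) := by ring
  have n1 := norm_nonneg (y₁ 1)
  have n2 := norm_nonneg (y₂ 0)
  rw [e]
  exact ⟨(hb₁ x hx).trans (by linarith), (hb₂ x hx).trans (by linarith)⟩

theorem one_sub_mem_Icc {x : ℝ} (hx : x ∈ Icc (0:ℝ) 1) : 1 - x ∈ Icc (0:ℝ) 1 :=
  ⟨by linarith [hx.2], by linarith [hx.1]⟩

theorem IsSol.hat_bounds {ν : ℂ} {q₁ q₂ y₁ y₂ : ℝ → ℂ} {Q κ : ℝ}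
    (h : IsSol ν 0 q₁ q₂ 0 0 y₁ y₂) (hκ : 0 < κ) (hκQ : 2 * Q ^ 2 ≤ κ) (hν : κ ≤ ν.re)
    (hq₁ : ∀ x ∈ Icc (0:ℝ) 1, ‖q₁ x‖ ≤ Q) (hq₂ : ∀ x ∈ Icc (0:ℝ) 1, ‖q₂ x‖ ≤ Q)
    (h0 : y₁ 1 = 0) {x : ℝ} (hx : x ∈ Icc (0:ℝ) 1) :
    ‖y₂ x‖ ≤ 2 * ‖y₂ 0‖ ∧ ‖y₁ x‖ ≤ 2 * Q * ‖y₂ 0‖ / κ ∧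
      ‖y₂ x - y₂ 0‖ ≤ 2 * Q ^ 2 * ‖y₂ 0‖ / κ := by
  have hQ : 0 ≤ Q := (norm_nonneg _).trans (hq₁ x hx)
  have z0 : (0:ℝ) ∈ Icc (0:ℝ) 1 := by simp
  obtain ⟨S₁, ⟨x₁, hx₁, hS₁⟩, hb₁⟩ := exists_sup h.continuousOn₁
  obtain ⟨S₂, ⟨x₂, hx₂, hS₂⟩, hb₂⟩ := exists_sup h.continuousOn₂
  have hS₁0 : 0 ≤ S₁ := hS₁ ▸ norm_nonneg _
  have hS₂0 : 0 ≤ S₂ := hS₂ ▸ norm_nonneg _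
  have hd : ∀ x ∈ Icc (0:ℝ) 1, ‖y₂ x - y₂ 0‖ ≤ Q * S₁ := fun x hx =>
    norm_sub_le_of_hasDerivAt h.d₂ (fun x hx => by
      simp only [zero_mul, zero_add, Pi.zero_apply, add_zero, norm_mul]
      exact mul_le_mul (hq₂ x hx) (hb₁ x hx) (norm_nonneg _) hQ) z0 hx
  have e₁ : S₁ ≤ Q * S₂ / κ := by
    rw [← hS₁]
    have := norm_le_of_hasDerivAt_growth h.d₁ (by linarith) (ρ := Q * S₂) (fun x hx => by
      simp only [Pi.zero_apply, add_zero, norm_mul]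
      exact mul_le_mul (hq₁ x hx) (hb₂ x hx) (norm_nonneg _) hQ) hx₁
    refine this.trans ?_
    simp only [h0, norm_zero, mul_zero, zero_add]
    gcongr
  have e₂ : S₂ ≤ ‖y₂ 0‖ + Q * S₁ := by
    have h1 := hd x₂ hx₂
    have h2 := norm_sub_norm_le (y₂ x₂) (y₂ 0)
    linarith
  have e₃ : Q * S₁ ≤ S₂ / 2 := by
    have h3 : Q * (Q * S₂ / κ) ≤ S₂ / 2 := by
      rw [← mul_div_assoc, div_le_iff₀ hκ]; nlinarith
    have := mul_le_mul_of_nonneg_left e₁ hQ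
    linarith
  have e₄ : S₂ ≤ 2 * ‖y₂ 0‖ := by linarith
  have e₅ : S₁ ≤ 2 * Q * ‖y₂ 0‖ / κ := by
    refine e₁.trans ?_
    gcongr ?_ / _
    nlinarith
  refine ⟨(hb₂ x hx).trans e₄, (hb₁ x hx).trans e₅, (hd x hx).trans ?_⟩
  have := mul_le_mul_of_nonneg_left e₅ hQ
  refine this.trans (le_of_eq ?_)
  ring

theorem IsSol.lin_comb {μ₁ μ₂ : ℂ} {q₁ q₂ y₁ y₂ z₁ z₂ : ℝ → ℂ}
    (h : IsSol μ₁ μ₂ q₁ q₂ 0 0 y₁ y₂) (h' : IsSol μ₁ μ₂ q₁ q₂ 0 0 z₁ z₂) (s : ℂ) :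
    IsSol μ₁ μ₂ q₁ q₂ 0 0 (fun x => y₁ x + s * z₁ x) (fun x => y₂ x + s * z₂ x) where
  d₁ x hx := by
    refine ((h.d₁ x hx).add ((h'.d₁ x hx).const_mul s)).congr_deriv ?_
    simp only [Pi.zero_apply]; ring
  d₂ x hx := by
    refine ((h.d₂ x hx).add ((h'.d₂ x hx).const_mul s)).congr_deriv ?_
    simp only [Pi.zero_apply]; ring

/-- Solvability of all initial value problems. -/
def Solvable (μ₁ μ₂ : ℂ) (q₁ q₂ : ℝ → ℂ) : Prop :=
  ∀ c₁ c₂ : ℂ, ∃ y₁ y₂, IsSol μ₁ μ₂ q₁ q₂ 0 0 y₁ y₂ ∧ y₁ 0 = c₁ ∧ y₂ 0 = c₂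

theorem exists_hat {ν : ℂ} {q₁ q₂ : ℝ → ℂ} {Q κ : ℝ}
    (hs : Solvable ν 0 q₁ q₂) (hκ : 0 < κ) (hκQ : 2 * Q ^ 2 ≤ κ) (hν : κ ≤ ν.re)
    (hq₁ : ∀ x ∈ Icc (0:ℝ) 1, ‖q₁ x‖ ≤ Q) (hq₂ : ∀ x ∈ Icc (0:ℝ) 1, ‖q₂ x‖ ≤ Q) :
    ∃ y₁ y₂, IsSol ν 0 q₁ q₂ 0 0 y₁ y₂ ∧ y₁ 1 = 0 ∧ y₂ 0 = 1 := by
  obtain ⟨e₁, e₂, he, he1, he2⟩ := hs 1 0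
  obtain ⟨f₁, f₂, hf, hf1, hf2⟩ := hs 0 1
  have hne : e₁ 1 ≠ 0 := by
    intro h0
    have := (he.hat_bounds hκ hκQ hν hq₁ hq₂ h0 (x := 0) (by simp)).2.1
    simp [he1, he2] at this
    linarith
  exact ⟨_, _, hf.lin_comb he (-(f₁ 1 / e₁ 1)), by field_simp; simp, by simp [he2, hf2]⟩

section
variable {μ₁ μ₂ α β : ℂ} {q₁ q₂ r₁ r₂ V₁ V₂ W₁ W₂ : ℝ → ℂ}

theorem hasDerivAt_exp_mul_ofReal (c : ℂ) (x : ℝ) :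
    HasDerivAt (fun x : ℝ => exp (c * x)) (exp (c * x) * c) x := by
  simpa using ((hasDerivAt_id x).ofReal_comp.const_mul c).cexp

/-- The reduced characteristic function. -/
noncomputable def charD (μ₁ μ₂ α β : ℂ) (V₁ V₂ W₁ W₂ : ℝ → ℂ) : ℂ :=
  V₁ 0 - W₁ 0 + β * exp μ₂ * W₂ 1 - α * exp (-μ₁) * V₂ 1

theorem IsSol.norm_mul_charD_le {G₁ G₂ y₁ y₂ : ℝ → ℂ} {g : ℝ}
    (hα : α ≠ 0) (hβ : β ≠ 0) (h₁ : 0 < μ₁.re) (h₂ : μ₂.re < 0)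
    (hr₁ : ∀ x ∈ Icc (0:ℝ) 1, r₁ (1 - x) = -(α * β) * q₂ x)
    (hr₂ : ∀ x ∈ Icc (0:ℝ) 1, r₂ (1 - x) = -q₁ x / (α * β))
    (hV : IsSol (μ₁ - μ₂) 0 q₁ q₂ 0 0 V₁ V₂) (hV1 : V₁ 1 = 0) (hV2 : V₂ 0 = 1)
    (hW : IsSol (μ₁ - μ₂) 0 r₁ r₂ 0 0 W₁ W₂) (hW1 : W₁ 1 = 0) (hW2 : W₂ 0 = 1)
    (bV₁ : ∀ x ∈ Icc (0:ℝ) 1, ‖V₁ x‖ ≤ 2) (bV₂ : ∀ x ∈ Icc (0:ℝ) 1, ‖V₂ x‖ ≤ 2)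
    (bW₁ : ∀ x ∈ Icc (0:ℝ) 1, ‖W₁ x‖ ≤ 2) (bW₂ : ∀ x ∈ Icc (0:ℝ) 1, ‖W₂ x‖ ≤ 2)
    (h : IsSol μ₁ μ₂ q₁ q₂ G₁ G₂ y₁ y₂)
    (hG₁ : ∀ x ∈ Icc (0:ℝ) 1, ‖G₁ x‖ ≤ g) (hG₂ : ∀ x ∈ Icc (0:ℝ) 1, ‖G₂ x‖ ≤ g)
    (bc₁ : y₁ 0 + β * y₂ 1 = 0) (bc₂ : α * y₂ 0 + y₁ 1 = 0) :
    ‖y₂ 0 * charD μ₁ μ₂ α β V₁ V₂ W₁ W₂‖ ≤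
      4 * g + ‖β‖ * (2 * g * (‖(α * β)⁻¹‖ + 1)) := by
  have z0 : (0:ℝ) ∈ Icc (0:ℝ) 1 := by simp
  have z1 : (1:ℝ) ∈ Icc (0:ℝ) 1 := by simp
  have hg : 0 ≤ g := (norm_nonneg _).trans (hG₁ 0 z0)
  have hαβ : α * β ≠ 0 := mul_ne_zero hα hβ
  have key1 := norm_sub_le_of_hasDerivAt (C := 4 * g)
    (f := fun x => exp (-μ₁ * x) * (y₁ x * V₂ x - y₂ x * V₁ x))
    (f' := fun x => exp (-μ₁ * x) * (G₁ x * V₂ x - G₂ x * V₁ x)) (fun x hx => by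
      refine ((hasDerivAt_exp_mul_ofReal (-μ₁) x).mul (((h.d₁ x hx).mul (hV.d₂ x hx)).sub
        ((h.d₂ x hx).mul (hV.d₁ x hx)))).congr_deriv ?_
      simp only [Pi.zero_apply, Pi.mul_apply, Pi.sub_apply]
      ring) (fun x hx => by
      have he : ‖exp (-μ₁ * x)‖ ≤ 1 := by
        rw [norm_exp, Real.exp_le_one_iff]
        simp
        exact mul_nonneg h₁.le hx.1
      have : ‖G₁ x * V₂ x - G₂ x * V₁ x‖ ≤ 4 * g := by
        refine (norm_sub_le _ _).trans ?_
        rw [norm_mul, norm_mul]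
        have i1 := mul_le_mul (hG₁ x hx) (bV₂ x hx) (norm_nonneg _) hg
        have i2 := mul_le_mul (hG₂ x hx) (bV₁ x hx) (norm_nonneg _) hg
        linarith
      rw [norm_mul]
      exact (mul_le_of_le_one_left (norm_nonneg _) he).trans this) z0 z1
  have key2 := norm_sub_le_of_hasDerivAt (C := 2 * g * (‖(α * β)⁻¹‖ + 1))
    (f := fun x => exp (μ₂ * ((1 - x : ℝ) : ℂ)) *
      (y₁ x * W₁ (1 - x) * (α * β)⁻¹ - y₂ x * W₂ (1 - x)))
    (f' := fun x => exp (μ₂ * ((1 - x : ℝ) : ℂ)) *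
      (G₁ x * W₁ (1 - x) * (α * β)⁻¹ - G₂ x * W₂ (1 - x))) (fun x hx => by
      have hr : HasDerivAt (fun x : ℝ => 1 - x) (-1) x := by
        simpa using (hasDerivAt_id x).const_sub 1
      have dE := (hasDerivAt_exp_mul_ofReal μ₂ (1 - x)).scomp x hr
      have dW1 := (hW.d₁ (1 - x) (one_sub_mem_Icc hx)).scomp x hr
      have dW2 := (hW.d₂ (1 - x) (one_sub_mem_Icc hx)).scomp x hr
      refine (dE.mul ((((h.d₁ x hx).mul dW1).mul_const (α * β)⁻¹).sub
        ((h.d₂ x hx).mul dW2))).congr_deriv ?_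
      simp only [Pi.zero_apply, Pi.mul_apply, Pi.sub_apply, Function.comp_apply, hr₁ x hx,
        hr₂ x hx, real_smul, ofReal_neg, ofReal_one]
      field_simp
      ring) (fun x hx => by
      have he : ‖exp (μ₂ * ((1 - x : ℝ) : ℂ))‖ ≤ 1 := by
        rw [norm_exp, Real.exp_le_one_iff, re_mul_ofReal]
        nlinarith [hx.2]
      have hx' := one_sub_mem_Icc hx
      have : ‖G₁ x * W₁ (1 - x) * (α * β)⁻¹ - G₂ x * W₂ (1 - x)‖
          ≤ 2 * g * (‖(α * β)⁻¹‖ + 1) := by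
        refine (norm_sub_le _ _).trans ?_
        rw [norm_mul, norm_mul, norm_mul (G₂ x)]
        have i1 := mul_le_mul (hG₁ x hx) (bW₁ _ hx') (norm_nonneg _) hg
        have i2 := mul_le_mul (hG₂ x hx) (bW₂ _ hx') (norm_nonneg _) hg
        have i3 := mul_le_mul_of_nonneg_right i1 (norm_nonneg (α * β)⁻¹)
        linarith
      rw [norm_mul]
      exact (mul_le_of_le_one_left (norm_nonneg _) he).trans this) z0 z1
  simp only [hV1, hV2, hW1, hW2, sub_self, sub_zero, ofReal_zero, ofReal_one, mul_zero, exp_zero,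
    mul_one, one_mul, zero_mul, zero_sub, mul_neg] at key1 key2
  have e1 : y₁ 1 = -(α * y₂ 0) := by linear_combination bc₂
  have e2 : y₁ 0 = -(β * y₂ 1) := by linear_combination bc₁
  rw [e1, e2] at key1
  rw [e1] at key2
  set A := exp (-μ₁) * (-(α * y₂ 0) * V₂ 1) - (-(β * y₂ 1) - y₂ 0 * V₁ 0) with hA
  set B := -(α * y₂ 0) * W₁ 0 * (α * β)⁻¹ - y₂ 1 - -(exp μ₂ * (y₂ 0 * W₂ 1)) with hB
  have e : y₂ 0 * charD μ₁ μ₂ α β V₁ V₂ W₁ W₂ = A + β * B := by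
    simp only [charD, hA, hB]
    field_simp
    ring
  rw [e]
  refine (norm_add_le _ _).trans ?_
  rw [norm_mul]
  gcongr

end

end

section
open Complex Set Filter Topology MeasureTheory

theorem integrableOn_exp_mul_pow (k : ℕ) {ζ : ℂ} (hζ : 0 < ζ.re) :
    IntegrableOn (fun s : ℝ => exp (-ζ * s) * (s : ℂ) ^ k) (Ioi 0) := by
  have h := integrableOn_rpow_mul_exp_neg_mul_rpow (s := k) (p := 1) (b := ζ.re)
    (by linarith [Nat.cast_nonneg (α := ℝ) k]) zero_lt_one hζ
  refine Integrable.mono' h (by fun_prop) ?_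
  filter_upwards [ae_restrict_mem measurableSet_Ioi] with s hs
  have hs0 : 0 < s := hs
  rw [norm_mul, norm_pow, norm_real, Real.norm_of_nonneg hs0.le, norm_exp, Real.rpow_one,
    Real.rpow_natCast, mul_comm]
  simp

theorem tendsto_exp_mul_pow_atTop (k : ℕ) {ζ : ℂ} (hζ : 0 < ζ.re) :
    Tendsto (fun s : ℝ => exp (-ζ * s) * (s : ℂ) ^ k) atTop (𝓝 0) := by
  rw [tendsto_zero_iff_norm_tendsto_zero]
  refine (tendsto_rpow_mul_exp_neg_mul_atTop_nhds_zero k _ hζ).congr' ?_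
  filter_upwards [eventually_gt_atTop 0] with s hs0
  rw [norm_mul, norm_pow, norm_real, Real.norm_of_nonneg hs0.le, norm_exp,
    Real.rpow_natCast, mul_comm]
  simp

theorem integral_pow_mul_exp (k : ℕ) {ζ : ℂ} (hζ : 0 < ζ.re) :
    ∫ s in Ioi (0:ℝ), exp (-ζ * s) * (s : ℂ) ^ k = k.factorial / ζ ^ (k + 1) := by
  have hζ0 : ζ ≠ 0 := fun h => by simp [h] at hζ
  have hd : ∀ s : ℝ, HasDerivAt (fun s : ℝ => exp (-ζ * s)) (exp (-ζ * s) * -ζ) s := fun s => by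
    simpa using ((hasDerivAt_id (s:ℂ)).const_mul (-ζ)).cexp.comp_ofReal
  induction k with
  | zero =>
    have h := integral_Ioi_of_hasDerivAt_of_tendsto' (a := 0) (fun s _ => hd s)
      (by simpa [IntegrableOn] using (integrableOn_exp_mul_pow 0 hζ).mul_const (-ζ))
      (by simpa using tendsto_exp_mul_pow_atTop 0 hζ)
    rw [integral_mul_const] at h
    simp only [pow_zero, mul_one, zero_add, pow_one, Nat.factorial_zero, Nat.cast_one]
    field_simp
    simp at h
    linear_combination h
  | succ k ih =>
    have hp : ∀ s : ℝ, HasDerivAt (fun s : ℝ => (s:ℂ) ^ (k + 1)) ((k + 1 : ℕ) * (s:ℂ) ^ k) s :=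
      fun s => by simpa using (hasDerivAt_pow (k + 1) (s:ℂ)).comp_ofReal
    have i1 := (integrableOn_exp_mul_pow (k + 1) hζ).const_mul (-ζ)
    have i2 := (integrableOn_exp_mul_pow k hζ).const_mul ((k + 1 : ℕ) : ℂ)
    have h := integral_Ioi_of_hasDerivAt_of_tendsto' (a := 0)
      (f' := fun s : ℝ => -ζ * (exp (-ζ * s) * (s : ℂ) ^ (k + 1)) +
        ((k + 1 : ℕ) : ℂ) * (exp (-ζ * s) * (s : ℂ) ^ k))
      (fun s _ => ((hd s).mul (hp s)).congr_deriv (by ring)) (i1.add i2)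
      (tendsto_exp_mul_pow_atTop (k + 1) hζ)
    rw [integral_add i1 i2, integral_const_mul, integral_const_mul, ih] at h
    have h2 : ζ * ∫ s in Ioi (0:ℝ), exp (-ζ * s) * (s : ℂ) ^ (k + 1) =
        ((k + 1 : ℕ) : ℂ) * (k.factorial / ζ ^ (k + 1)) := by
      simp only [Pi.mul_apply, ofReal_zero, ne_eq, Nat.succ_ne_zero, not_false_eq_true, zero_pow,
        mul_zero, sub_zero] at h
      linear_combination -h
    rw [Nat.factorial_succ, Nat.cast_mul, pow_succ ζ (k + 1)]
    refine mul_left_cancel₀ hζ0 (h2.trans ?_)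
    field_simp

theorem tendsto_laplace {f : ℝ → ℂ} {G : ℝ → ℝ → ℂ} {k : ℕ} {a G₀ ζ : ℂ} {C C' T : ℝ}
    (hζ : 0 < ζ.re) (hf : ContinuousOn f (Icc 0 1))
    (hfb : ∀ x ∈ Icc (0:ℝ) 1, ‖f x‖ ≤ C * x ^ k)
    (hfa : Tendsto (fun x : ℝ => f x / (x:ℂ) ^ k) (𝓝[>] 0) (𝓝 a))
    (hGc : ∀ τ ≥ T, ContinuousOn (G τ) (Icc 0 1))
    (hGb : ∀ τ ≥ T, ∀ x ∈ Icc (0:ℝ) 1, ‖G τ x‖ ≤ C')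
    (hG : ∀ s > 0, Tendsto (fun τ => G τ (s / τ)) atTop (𝓝 G₀)) :
    Tendsto (fun τ : ℝ => (τ:ℂ) ^ (k + 1) *
      ∫ x in (0:ℝ)..1, exp (-(ζ * τ) * x) * (f x * G τ x)) atTop
      (𝓝 (a * G₀ * (k.factorial / ζ ^ (k + 1)))) := by
  have hC : 0 ≤ C := by
    have := (norm_nonneg _).trans (hfb 1 (by simp)); simpa using this
  have hC' : 0 ≤ C' := (norm_nonneg _).trans (hGb T le_rfl 1 (by simp))
  set Φ : ℝ → ℝ → ℂ := fun τ s => (Ioc 0 τ).indicator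
    (fun s => exp (-ζ * s) * ((τ:ℂ) ^ k * f (s / τ)) * G τ (s / τ)) s with hΦ
  have hmem : ∀ {τ s : ℝ}, s ∈ Ioc 0 τ → s / τ ∈ Icc (0:ℝ) 1 := fun {τ s} hs =>
    ⟨div_nonneg hs.1.le (hs.1.le.trans hs.2), div_le_one_of_le₀ hs.2 (hs.1.le.trans hs.2)⟩
  have hmain : Tendsto (fun τ => ∫ s in Ioi (0:ℝ), Φ τ s) atTop
      (𝓝 (∫ s in Ioi (0:ℝ), exp (-ζ * s) * (s : ℂ) ^ k * (a * G₀))) := by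
    apply tendsto_integral_filter_of_dominated_convergence
      (fun s => C * C' * (s ^ (k:ℝ) * Real.exp (-ζ.re * s ^ (1:ℝ))))
    · filter_upwards [eventually_ge_atTop T, eventually_gt_atTop 0] with τ hτ hτ0
      refine AEStronglyMeasurable.restrict
        ((aestronglyMeasurable_indicator_iff measurableSet_Ioc).2 ?_)
      refine ContinuousOn.aestronglyMeasurable ?_ measurableSet_Ioc
      have hm : MapsTo (fun s => s / τ) (Ioc 0 τ) (Icc 0 1) := fun s hs => hmem hs
      have hd : ContinuousOn (fun s : ℝ => s / τ) (Ioc 0 τ) := (continuous_id.div_const τ).continuousOn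
      refine ContinuousOn.mul (ContinuousOn.mul (by fun_prop)
        (continuousOn_const.mul (hf.comp hd hm))) ((hGc τ hτ).comp hd hm)
    · filter_upwards [eventually_ge_atTop T, eventually_gt_atTop 0] with τ hτ hτ0
      filter_upwards [ae_restrict_mem measurableSet_Ioi] with s hs
      have hs0 : 0 < s := hs
      by_cases h : s ∈ Ioc 0 τ
      · rw [hΦ]
        simp only [indicator_of_mem h]
        rw [norm_mul, norm_mul, norm_mul, norm_pow, norm_real, Real.norm_of_nonneg hτ0.le,
          norm_exp, Real.rpow_one, Real.rpow_natCast]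
        have e1 : (-ζ * (s:ℂ)).re = -ζ.re * s := by simp
        have e2 : τ ^ k * ‖f (s / τ)‖ ≤ C * s ^ k := by
          calc τ ^ k * ‖f (s / τ)‖ ≤ τ ^ k * (C * (s / τ) ^ k) := by
                gcongr; exact hfb _ (hmem h)
            _ = C * s ^ k := by rw [div_pow]; field_simp
        have e3 := hGb τ hτ _ (hmem h)
        rw [e1]
        calc Real.exp (-ζ.re * s) * (τ ^ k * ‖f (s / τ)‖) * ‖G τ (s / τ)‖
            ≤ Real.exp (-ζ.re * s) * (C * s ^ k) * C' := by gcongr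
          _ = _ := by ring
      · rw [hΦ]
        simp only [indicator_of_notMem h, norm_zero]
        positivity
    · apply Integrable.const_mul
      exact integrableOn_rpow_mul_exp_neg_mul_rpow (by linarith [Nat.cast_nonneg (α := ℝ) k])
        zero_lt_one hζ
    · filter_upwards [ae_restrict_mem measurableSet_Ioi] with s hs
      have hs0 : 0 < s := hs
      have h1 : Tendsto (fun τ : ℝ => s / τ) atTop (𝓝[>] 0) := by
        refine tendsto_nhdsWithin_iff.2 ⟨tendsto_const_nhds.div_atTop tendsto_id, ?_⟩
        filter_upwards [eventually_gt_atTop 0] with τ hτ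
        exact div_pos hs0 hτ
      have h2 := hfa.comp h1
      have h3 := (h2.const_mul (exp (-ζ * s) * (s:ℂ) ^ k)).mul (hG s hs0)
      rw [mul_assoc (exp (-ζ * s) * (s:ℂ) ^ k)] at h3
      refine h3.congr' ?_
      filter_upwards [eventually_ge_atTop s] with τ hτ
      have hτ0 : (τ:ℂ) ≠ 0 := ofReal_ne_zero.2 (hs0.trans_le hτ).ne'
      have hsc : (s:ℂ) ≠ 0 := ofReal_ne_zero.2 hs0.ne'
      simp only [hΦ, indicator_of_mem (show s ∈ Ioc 0 τ from ⟨hs0, hτ⟩), Function.comp,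
        ofReal_div, div_pow]
      field_simp
  rw [integral_mul_const, integral_pow_mul_exp k hζ, mul_comm] at hmain
  refine hmain.congr' ?_
  filter_upwards [eventually_gt_atTop 0] with τ hτ
  have hτc : (τ:ℂ) ≠ 0 := ofReal_ne_zero.2 hτ.ne'
  have e1 : ∫ s in Ioi (0:ℝ), Φ τ s = ∫ s in (0:ℝ)..τ,
      (fun x : ℝ => (τ:ℂ) ^ k * (exp (-(ζ * τ) * x) * (f x * G τ x))) (s / τ) := by
    rw [intervalIntegral.integral_of_le hτ.le, hΦ, setIntegral_indicator measurableSet_Ioc,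
      inter_eq_self_of_subset_right Ioc_subset_Ioi_self]
    refine setIntegral_congr_fun measurableSet_Ioc fun s hs => ?_
    have : -(ζ * τ) * ((s / τ : ℝ) : ℂ) = -ζ * s := by push_cast; field_simp
    simp only [this]
    ring
  rw [e1, intervalIntegral.integral_comp_div
    (fun x : ℝ => (τ:ℂ) ^ k * (exp (-(ζ * τ) * x) * (f x * G τ x))) hτ.ne', zero_div, div_self hτ.ne',
    intervalIntegral.integral_const_mul, real_smul]
  ring

/-- Hat solutions along a ray. -/
structure IsHatFamily (ζ : ℂ) (q₁ q₂ : ℝ → ℂ) (Q T : ℝ) (V₁ V₂ : ℝ → ℝ → ℂ) : Prop where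
  re_pos : 0 < ζ.re
  T_pos : 0 < T
  le : 2 * Q ^ 2 ≤ ζ.re * T
  Q_pos : 0 ≤ Q
  cont₁ : Continuous q₁
  cont₂ : Continuous q₂
  bd₁ : ∀ x ∈ Icc (0:ℝ) 1, ‖q₁ x‖ ≤ Q
  bd₂ : ∀ x ∈ Icc (0:ℝ) 1, ‖q₂ x‖ ≤ Q
  sol : ∀ τ ≥ T, IsSol (ζ * τ) 0 q₁ q₂ 0 0 (V₁ τ) (V₂ τ)
  one : ∀ τ ≥ T, V₁ τ 1 = 0
  zero : ∀ τ ≥ T, V₂ τ 0 = 1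

theorem exists_isHatFamily {ζ : ℂ} {q₁ q₂ : ℝ → ℂ} {Q T : ℝ} (hζ : 0 < ζ.re) (hT : 0 < T)
    (hle : 2 * Q ^ 2 ≤ ζ.re * T) (hc₁ : Continuous q₁) (hc₂ : Continuous q₂)
    (hq₁ : ∀ x ∈ Icc (0:ℝ) 1, ‖q₁ x‖ ≤ Q) (hq₂ : ∀ x ∈ Icc (0:ℝ) 1, ‖q₂ x‖ ≤ Q)
    (hs : ∀ ν, Solvable ν 0 q₁ q₂) : ∃ V₁ V₂, IsHatFamily ζ q₁ q₂ Q T V₁ V₂ := by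
  have h : ∀ τ : ℝ, ∃ V : (ℝ → ℂ) × (ℝ → ℂ), T ≤ τ →
      (IsSol (ζ * τ) 0 q₁ q₂ 0 0 V.1 V.2 ∧ V.1 1 = 0 ∧ V.2 0 = 1) := by
    intro τ
    by_cases hτ : T ≤ τ
    · obtain ⟨y₁, y₂, hy⟩ := exists_hat (hs (ζ * τ)) (κ := ζ.re * T) (mul_pos hζ hT) hle
        (by simpa using mul_le_mul_of_nonneg_left hτ hζ.le) hq₁ hq₂
      exact ⟨(y₁, y₂), fun _ => hy⟩
    · exact ⟨0, fun h => absurd h hτ⟩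
  choose V hV using h
  exact ⟨fun τ => (V τ).1, fun τ => (V τ).2, hζ, hT, hle,
    (norm_nonneg _).trans (hq₁ 0 (by simp)), hc₁, hc₂, hq₁, hq₂,
    fun τ hτ => (hV τ hτ).1, fun τ hτ => (hV τ hτ).2.1, fun τ hτ => (hV τ hτ).2.2⟩

namespace IsHatFamily
variable {ζ : ℂ} {q₁ q₂ r₁ r₂ : ℝ → ℂ} {Q T : ℝ} {V₁ V₂ W₁ W₂ : ℝ → ℝ → ℂ}

theorem bounds (h : IsHatFamily ζ q₁ q₂ Q T V₁ V₂) {τ : ℝ} (hτ : T ≤ τ) {x : ℝ}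
    (hx : x ∈ Icc (0:ℝ) 1) : ‖V₂ τ x‖ ≤ 2 ∧ ‖V₁ τ x‖ ≤ 2 * Q / (ζ.re * τ) ∧
      ‖V₂ τ x - 1‖ ≤ 2 * Q ^ 2 / (ζ.re * τ) := by
  have hτ0 : 0 < τ := h.T_pos.trans_le hτ
  have := (h.sol τ hτ).hat_bounds (κ := ζ.re * τ) (mul_pos h.re_pos hτ0)
    (h.le.trans (mul_le_mul_of_nonneg_left hτ h.re_pos.le)) (by simp) h.bd₁ h.bd₂ (h.one τ hτ) hx
  simpa [h.zero τ hτ] using this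

theorem mem_Icc (_h : IsHatFamily ζ q₁ q₂ Q T V₁ V₂) {s τ : ℝ} (hs : 0 < s) (hτ : s ≤ τ) :
    s / τ ∈ Icc (0:ℝ) 1 :=
  ⟨div_nonneg hs.le (hs.le.trans hτ), div_le_one_of_le₀ hτ (hs.le.trans hτ)⟩

theorem tendsto₂ (h : IsHatFamily ζ q₁ q₂ Q T V₁ V₂) {s : ℝ} (hs : 0 < s) :
    Tendsto (fun τ => V₂ τ (s / τ)) atTop (𝓝 1) := by
  rw [tendsto_iff_norm_sub_tendsto_zero]
  have h0 : Tendsto (fun τ : ℝ => 2 * Q ^ 2 / (ζ.re * τ)) atTop (𝓝 0) :=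
    tendsto_const_nhds.div_atTop (tendsto_id.const_mul_atTop h.re_pos)
  refine squeeze_zero' (Eventually.of_forall fun _ => norm_nonneg _) ?_ h0
  filter_upwards [eventually_ge_atTop T, eventually_ge_atTop s] with τ hτ hsτ
  exact (h.bounds hτ (h.mem_Icc hs hsτ)).2.2

theorem tendsto₁ (h : IsHatFamily ζ q₁ q₂ Q T V₁ V₂) {s : ℝ} (hs : 0 < s) :
    Tendsto (fun τ => τ * V₁ τ (s / τ)) atTop (𝓝 (-(q₁ 0 / ζ))) := by
  have hζ := h.re_pos
  have hζ0 : ζ ≠ 0 := fun h0 => by simp [h0] at hζ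
  have hQ := h.Q_pos
  rw [Metric.tendsto_nhds]
  intro ε hε
  have hε' : 0 < ε * ζ.re / 2 := by positivity
  obtain ⟨δ₀, hδ₀, hδ⟩ := Metric.continuousAt_iff.1 h.cont₁.continuousAt (ε * ζ.re / 2) hε'
  set δ := min (δ₀ / 2) 1 with hδdef
  have hδpos : 0 < δ := by positivity
  have hδ1 : δ ≤ 1 := min_le_right _ _
  have hδ2 : δ < δ₀ := (min_le_left _ _).trans_lt (by linarith)
  have hδm : δ ∈ Icc (0:ℝ) 1 := ⟨hδpos.le, hδ1⟩
  have hlim : Tendsto (fun τ : ℝ => 3 * Q / ζ.re * Real.exp (-(ζ.re * δ / 2 * τ)) +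
      (ε * ζ.re / 2 + 2 * Q ^ 3 / (ζ.re * τ)) / ζ.re) atTop
      (𝓝 (3 * Q / ζ.re * 0 + (ε * ζ.re / 2 + 0) / ζ.re)) := by
    refine Tendsto.add (Tendsto.const_mul _ ?_) (Tendsto.div_const (Tendsto.const_add _ ?_) _)
    · exact Real.tendsto_exp_neg_atTop_nhds_zero.comp
        (tendsto_id.const_mul_atTop (by positivity))
    · exact tendsto_const_nhds.div_atTop (tendsto_id.const_mul_atTop hζ)
  have hlt : 3 * Q / ζ.re * 0 + (ε * ζ.re / 2 + 0) / ζ.re < ε := by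
    have : (ε * ζ.re / 2 + 0) / ζ.re = ε / 2 := by field_simp; ring
    rw [this]; linarith
  filter_upwards [hlim.eventually_lt_const hlt, eventually_ge_atTop T, eventually_ge_atTop s,
    eventually_ge_atTop (2 * s / δ)] with τ h1 hτ hsτ hτδ
  have hτ0 : 0 < τ := h.T_pos.trans_le hτ
  have hτc : (τ:ℂ) ≠ 0 := ofReal_ne_zero.2 hτ0.ne'
  refine lt_of_le_of_lt ?_ h1
  have hsδ : s / τ ≤ δ / 2 := by
    rw [div_le_iff₀ hδpos] at hτδ
    rw [div_le_iff₀ hτ0]; linarith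
  have hm := h.mem_Icc hs hsτ
  have hκ : 0 < ζ.re * τ := mul_pos hζ hτ0
  have hν : (ζ * τ).re = ζ.re * τ := by simp
  have hsub : ∀ x ∈ Icc (s / τ) δ, x ∈ Icc (0:ℝ) 1 := fun x hx =>
    ⟨hm.1.trans hx.1, hx.2.trans hδ1⟩
  have hR := norm_le_of_hasDerivAt_growth (f := fun x => V₁ τ x + q₁ 0 / (ζ * τ)) (μ := ζ * τ)
    (r := fun x => q₁ x * V₂ τ x - q₁ 0) (a := s / τ) (b := δ)
    (ρ := ε * ζ.re / 2 + 2 * Q ^ 3 / (ζ.re * τ)) (x := s / τ)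
    (fun x hx => by
      refine (((h.sol τ hτ).d₁ x (hsub x hx)).add_const _).congr_deriv ?_
      simp
      field_simp
      ring) (by rw [hν]; exact hκ) (fun x hx => by
      have hx' := hsub x hx
      have e : q₁ x * V₂ τ x - q₁ 0 = (q₁ x - q₁ 0) + q₁ x * (V₂ τ x - 1) := by ring
      simp only [e]
      refine (norm_add_le _ _).trans (add_le_add ?_ ?_)
      · have := hδ (x := x) (by rw [Real.dist_eq, sub_zero, abs_of_nonneg hx'.1]; linarith [hx.2])
        rw [dist_eq_norm] at this
        exact this.le
      · rw [norm_mul]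
        refine (mul_le_mul (h.bd₁ x hx') (h.bounds hτ hx').2.2 (norm_nonneg _) hQ).trans
          (le_of_eq ?_)
        ring) ⟨le_rfl, by linarith⟩
  have hb : ‖V₁ τ δ + q₁ 0 / (ζ * τ)‖ ≤ 3 * Q / (ζ.re * τ) := by
    have e1 := (h.bounds hτ hδm).2.1
    have e2 : ‖q₁ 0 / (ζ * τ)‖ ≤ Q / (ζ.re * τ) := by
      rw [norm_div]
      have h3 : ζ.re * τ ≤ ‖ζ * τ‖ := hν ▸ re_le_norm _
      exact div_le_div₀ hQ (h.bd₁ 0 (by simp)) hκ h3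
    refine (norm_add_le _ _).trans ((add_le_add e1 e2).trans (le_of_eq ?_))
    ring
  have he : Real.exp (-(ζ * τ).re * (δ - s / τ)) ≤ Real.exp (-(ζ.re * δ / 2 * τ)) := by
    rw [hν, Real.exp_le_exp]
    nlinarith
  have e : τ * V₁ τ (s / τ) - -(q₁ 0 / ζ) = τ * (V₁ τ (s / τ) + q₁ 0 / (ζ * τ)) := by
    field_simp
    ring
  rw [dist_eq_norm, e, norm_mul, norm_real, Real.norm_of_nonneg hτ0.le]
  have h4 := hR.trans (add_le_add_left (mul_le_mul he hb (norm_nonneg _) (Real.exp_pos _).le) _)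
  refine (mul_le_mul_of_nonneg_left h4 hτ0.le).trans (le_of_eq ?_)
  rw [hν]
  field_simp

theorem continuousOn₁ (h : IsHatFamily ζ q₁ q₂ Q T V₁ V₂) {τ : ℝ} (hτ : T ≤ τ) :
    ContinuousOn (V₁ τ) (Icc 0 1) := (h.sol τ hτ).continuousOn₁

theorem continuousOn₂ (h : IsHatFamily ζ q₁ q₂ Q T V₁ V₂) {τ : ℝ} (hτ : T ≤ τ) :
    ContinuousOn (V₂ τ) (Icc 0 1) := (h.sol τ hτ).continuousOn₂

theorem sub_eq_integral (hV : IsHatFamily ζ q₁ q₂ Q T V₁ V₂) (hW : IsHatFamily ζ r₁ r₂ Q T W₁ W₂)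
    {τ : ℝ} (hτ : T ≤ τ) : V₁ τ 0 - W₁ τ 0 =
      (∫ x in (0:ℝ)..1, exp (-(ζ * τ) * x) * ((r₁ x - q₁ x) * (V₂ τ x * W₂ τ x))) -
      ∫ x in (0:ℝ)..1, exp (-(ζ * τ) * x) * ((r₂ x - q₂ x) * (V₁ τ x * W₁ τ x)) := by
  have c1 := hV.continuousOn₁ hτ
  have c2 := hV.continuousOn₂ hτ
  have c3 := hW.continuousOn₁ hτ
  have c4 := hW.continuousOn₂ hτ
  have := hV.cont₁
  have := hV.cont₂
  have := hW.cont₁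
  have := hW.cont₂
  have i1 : IntervalIntegrable (fun x : ℝ => exp (-(ζ * τ) * x) *
      ((r₁ x - q₁ x) * (V₂ τ x * W₂ τ x))) volume 0 1 := by
    refine ContinuousOn.intervalIntegrable ?_
    rw [uIcc_of_le zero_le_one]
    fun_prop
  have i2 : IntervalIntegrable (fun x : ℝ => exp (-(ζ * τ) * x) *
      ((r₂ x - q₂ x) * (V₁ τ x * W₁ τ x))) volume 0 1 := by
    refine ContinuousOn.intervalIntegrable ?_
    rw [uIcc_of_le zero_le_one]
    fun_prop
  rw [← intervalIntegral.integral_sub i1 i2]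
  have := intervalIntegral.integral_eq_sub_of_hasDerivAt (a := 0) (b := 1)
    (f := fun x : ℝ => -(exp (-(ζ * τ) * x) * (V₁ τ x * W₂ τ x - V₂ τ x * W₁ τ x)))
    (f' := fun x : ℝ => exp (-(ζ * τ) * x) * ((r₁ x - q₁ x) * (V₂ τ x * W₂ τ x)) -
      exp (-(ζ * τ) * x) * ((r₂ x - q₂ x) * (V₁ τ x * W₁ τ x))) (fun x hx => by
      rw [uIcc_of_le zero_le_one] at hx
      refine ((hasDerivAt_exp_mul_ofReal (-(ζ * τ)) x).mul
        ((((hV.sol τ hτ).d₁ x hx).mul ((hW.sol τ hτ).d₂ x hx)).sub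
        (((hV.sol τ hτ).d₂ x hx).mul ((hW.sol τ hτ).d₁ x hx)))).neg.congr_deriv ?_
      simp
      ring) (i1.sub i2)
  rw [this]
  simp [hV.one τ hτ, hW.one τ hτ, hV.zero τ hτ, hW.zero τ hτ]

end IsHatFamily

namespace IsHatFamily
variable {ζ : ℂ} {q₁ q₂ r₁ r₂ : ℝ → ℂ} {Q T : ℝ} {V₁ V₂ W₁ W₂ : ℝ → ℝ → ℂ}

theorem norm_mul₁_le (h : IsHatFamily ζ q₁ q₂ Q T V₁ V₂) {τ : ℝ} (hτ : T ≤ τ) {x : ℝ}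
    (hx : x ∈ Icc (0:ℝ) 1) : ‖τ * V₁ τ x‖ ≤ 2 * Q / ζ.re := by
  have hτ0 : 0 < τ := h.T_pos.trans_le hτ
  have hζ := h.re_pos
  rw [norm_mul, norm_real, Real.norm_of_nonneg hτ0.le]
  refine (mul_le_mul_of_nonneg_left (h.bounds hτ hx).2.1 hτ0.le).trans (le_of_eq ?_)
  field_simp

theorem tendsto_exp_tail (h : IsHatFamily ζ q₁ q₂ Q T V₁ V₂) {ω : ℂ} (hω : ω.re < 0) (m : ℕ)
    (c : ℂ) : Tendsto (fun τ : ℝ => (τ:ℂ) ^ m * (c * exp (ω * τ) * V₂ τ 1)) atTop (𝓝 0) := by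
  have h0 := (tendsto_exp_mul_pow_atTop m (ζ := -ω) (by simpa using hω)).norm.const_mul (‖c‖ * 2)
  rw [norm_zero, mul_zero] at h0
  rw [tendsto_zero_iff_norm_tendsto_zero]
  refine squeeze_zero' (Eventually.of_forall fun _ => norm_nonneg _) ?_ h0
  filter_upwards [eventually_ge_atTop T] with τ hτ
  have := (h.bounds hτ (x := 1) (by simp)).1
  rw [norm_mul, norm_mul, norm_mul, norm_mul, neg_neg]
  have h1 := mul_le_mul_of_nonneg_left this
    (show 0 ≤ ‖(τ:ℂ) ^ m‖ * (‖c‖ * ‖exp (ω * τ)‖) by positivity)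
  linarith

variable {ω₁ ω₂ α β a : ℂ} {k : ℕ} {C C₂ : ℝ}

theorem tendsto_mul_charD {m : ℕ} {l : ℂ} (h₁ : 0 < ω₁.re) (h₂ : ω₂.re < 0)
    (hV : IsHatFamily ζ q₁ q₂ Q T V₁ V₂) (hW : IsHatFamily ζ r₁ r₂ Q T W₁ W₂)
    (hl : Tendsto (fun τ : ℝ => (τ:ℂ) ^ m * (V₁ τ 0 - W₁ τ 0)) atTop (𝓝 l)) :
    Tendsto (fun τ : ℝ => (τ:ℂ) ^ m *
      charD (ω₁ * τ) (ω₂ * τ) α β (V₁ τ) (V₂ τ) (W₁ τ) (W₂ τ)) atTop (𝓝 l) := by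
  have t1 := hW.tendsto_exp_tail h₂ m β
  have t2 := hV.tendsto_exp_tail (ω := -ω₁) (by simpa using h₁) m α
  have := (hl.add t1).sub t2
  rw [add_zero, sub_zero] at this
  refine this.congr fun τ => ?_
  unfold charD
  rw [neg_mul ω₁]
  ring

theorem tendsto_of_first (hV : IsHatFamily ζ q₁ q₂ Q T V₁ V₂)
    (hW : IsHatFamily ζ r₁ r₂ Q T W₁ W₂)
    (hpb : ∀ x ∈ Icc (0:ℝ) 1, ‖r₁ x - q₁ x‖ ≤ C * x ^ k)
    (hpa : Tendsto (fun x : ℝ => (r₁ x - q₁ x) / (x:ℂ) ^ k) (𝓝[>] 0) (𝓝 a))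
    (hpb₂ : ∀ x ∈ Icc (0:ℝ) 1, ‖r₂ x - q₂ x‖ ≤ C₂ * x ^ k)
    (hpa₂ : Tendsto (fun x : ℝ => (r₂ x - q₂ x) / (x:ℂ) ^ k) (𝓝[>] 0) (𝓝 0)) :
    Tendsto (fun τ : ℝ => (τ:ℂ) ^ (k + 1) * (V₁ τ 0 - W₁ τ 0)) atTop
      (𝓝 (a * (k.factorial / ζ ^ (k + 1)))) := by
  have hζ := hV.re_pos
  have t1 := tendsto_laplace (G := fun τ x => V₂ τ x * W₂ τ x) (G₀ := 1) (C' := 4) (T := T) hζ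
    (hW.cont₁.sub hV.cont₁).continuousOn hpb hpa
    (fun τ hτ => (hV.continuousOn₂ hτ).mul (hW.continuousOn₂ hτ))
    (fun τ hτ x hx => by
      rw [norm_mul]
      have := mul_le_mul (hV.bounds hτ hx).1 (hW.bounds hτ hx).1 (norm_nonneg _) zero_le_two
      linarith)
    (fun s hs => by simpa using (hV.tendsto₂ hs).mul (hW.tendsto₂ hs))
  have t2 := tendsto_laplace (G := fun τ x => V₁ τ x * W₁ τ x) (G₀ := 0)
    (C' := (2 * Q / (ζ.re * T)) * (2 * Q / (ζ.re * T))) (T := T) hζ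
    (hW.cont₂.sub hV.cont₂).continuousOn hpb₂ hpa₂
    (fun τ hτ => (hV.continuousOn₁ hτ).mul (hW.continuousOn₁ hτ))
    (fun τ hτ x hx => by
      have hQ := hV.Q_pos
      have hT := hV.T_pos
      have hle : 2 * Q / (ζ.re * τ) ≤ 2 * Q / (ζ.re * T) := by gcongr
      rw [norm_mul]
      exact mul_le_mul ((hV.bounds hτ hx).2.1.trans hle) ((hW.bounds hτ hx).2.1.trans hle)
        (norm_nonneg _) (by positivity))
    (fun s hs => by
      have h0 : Tendsto (fun τ : ℝ => ((τ:ℂ)⁻¹) ^ 2) atTop (𝓝 0) := by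
        have : Tendsto (fun τ : ℝ => ((τ⁻¹ : ℝ) : ℂ)) atTop (𝓝 ((0:ℝ):ℂ)) :=
          (continuous_ofReal.tendsto 0).comp tendsto_inv_atTop_zero
        simpa using this.pow 2
      have := ((hV.tendsto₁ hs).mul (hW.tendsto₁ hs)).mul h0
      rw [mul_zero] at this
      refine this.congr' ?_
      filter_upwards [eventually_gt_atTop 0] with τ hτ
      have hτc : (τ:ℂ) ≠ 0 := ofReal_ne_zero.2 hτ.ne'
      field_simp)
  have := t1.sub t2
  simp only [mul_one, mul_zero, zero_mul, sub_zero, Pi.sub_apply] at this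
  refine this.congr' ?_
  filter_upwards [eventually_ge_atTop T] with τ hτ
  rw [hV.sub_eq_integral hW hτ]
  ring

theorem tendsto_of_second (hV : IsHatFamily ζ q₁ q₂ Q T V₁ V₂)
    (hW : IsHatFamily ζ r₁ r₂ Q T W₁ W₂)
    (hpb : ∀ x ∈ Icc (0:ℝ) 1, ‖r₁ x - q₁ x‖ ≤ C * x ^ (k + 2))
    (hpa : Tendsto (fun x : ℝ => (r₁ x - q₁ x) / (x:ℂ) ^ (k + 2)) (𝓝[>] 0) (𝓝 0))
    (hpb₂ : ∀ x ∈ Icc (0:ℝ) 1, ‖r₂ x - q₂ x‖ ≤ C₂ * x ^ k)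
    (hpa₂ : Tendsto (fun x : ℝ => (r₂ x - q₂ x) / (x:ℂ) ^ k) (𝓝[>] 0) (𝓝 a)) :
    Tendsto (fun τ : ℝ => (τ:ℂ) ^ (k + 3) * (V₁ τ 0 - W₁ τ 0)) atTop
      (𝓝 (-(a * (q₁ 0 / ζ * (r₁ 0 / ζ)) * (k.factorial / ζ ^ (k + 1))))) := by
  have hζ := hV.re_pos
  have t1 := tendsto_laplace (G := fun τ x => V₂ τ x * W₂ τ x) (G₀ := 1) (C' := 4) (T := T) hζ
    (hW.cont₁.sub hV.cont₁).continuousOn hpb hpa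
    (fun τ hτ => (hV.continuousOn₂ hτ).mul (hW.continuousOn₂ hτ))
    (fun τ hτ x hx => by
      rw [norm_mul]
      have := mul_le_mul (hV.bounds hτ hx).1 (hW.bounds hτ hx).1 (norm_nonneg _) zero_le_two
      linarith)
    (fun s hs => by simpa using (hV.tendsto₂ hs).mul (hW.tendsto₂ hs))
  have t2 := tendsto_laplace (G := fun τ x => (τ * V₁ τ x) * (τ * W₁ τ x))
    (C' := (2 * Q / ζ.re) * (2 * Q / ζ.re)) (T := T) hζ
    (hW.cont₂.sub hV.cont₂).continuousOn hpb₂ hpa₂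
    (fun τ hτ => ((continuousOn_const.mul (hV.continuousOn₁ hτ))).mul
      (continuousOn_const.mul (hW.continuousOn₁ hτ)))
    (fun τ hτ x hx => by
      have hQ := hV.Q_pos
      rw [norm_mul]
      exact mul_le_mul (hV.norm_mul₁_le hτ hx) (hW.norm_mul₁_le hτ hx)
        (norm_nonneg _) (by positivity))
    (fun s hs => (hV.tendsto₁ hs).mul (hW.tendsto₁ hs))
  have := t1.sub t2
  simp only [zero_mul, zero_sub, neg_mul_neg, Pi.sub_apply] at this
  refine this.congr' ?_
  filter_upwards [eventually_ge_atTop T] with τ hτ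
  rw [hV.sub_eq_integral hW hτ]
  have e : (∫ x in (0:ℝ)..1, exp (-(ζ * τ) * x) *
        ((r₂ x - q₂ x) * ((τ * V₁ τ x) * (τ * W₁ τ x)))) = (τ:ℂ) ^ 2 *
      ∫ x in (0:ℝ)..1, exp (-(ζ * τ) * x) * ((r₂ x - q₂ x) * (V₁ τ x * W₁ τ x)) := by
    rw [← intervalIntegral.integral_const_mul]
    congr 1
    ext x
    ring
  rw [e]
  ring

end IsHatFamily

/-- Polynomial solution bound along a ray. -/
def RayBound (ω₁ ω₂ α β : ℂ) (q₁ q₂ : ℝ → ℂ) : Prop :=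
  ∃ (C : ℝ) (m : ℕ) (T : ℝ), 0 < T ∧ 0 ≤ C ∧ ∀ τ ≥ T, ∀ (G₁ G₂ y₁ y₂ : ℝ → ℂ) (g : ℝ),
    IsSol (ω₁ * τ) (ω₂ * τ) q₁ q₂ G₁ G₂ y₁ y₂ →
    (∀ x ∈ Icc (0:ℝ) 1, ‖G₁ x‖ ≤ g) → (∀ x ∈ Icc (0:ℝ) 1, ‖G₂ x‖ ≤ g) →
    y₁ 0 + β * y₂ 1 = 0 → α * y₂ 0 + y₁ 1 = 0 →
    ∀ x ∈ Icc (0:ℝ) 1, ‖y₁ x‖ ≤ C * τ ^ m * g ∧ ‖y₂ x‖ ≤ C * τ ^ m * g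

section
variable {ω₁ ω₂ α β : ℂ} {q₁ q₂ r₁ r₂ : ℝ → ℂ}

theorem rayBound_of_tendsto (hα : α ≠ 0) (hβ : β ≠ 0) (h₁ : 0 < ω₁.re) (h₂ : ω₂.re < 0)
    (hq₁ : Continuous q₁) (hq₂ : Continuous q₂) (hr₁c : Continuous r₁) (hr₂c : Continuous r₂)
    (hsq : ∀ ν, Solvable ν 0 q₁ q₂) (hsr : ∀ ν, Solvable ν 0 r₁ r₂)
    (hr₁ : ∀ x ∈ Icc (0:ℝ) 1, r₁ (1 - x) = -(α * β) * q₂ x)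
    (hr₂ : ∀ x ∈ Icc (0:ℝ) 1, r₂ (1 - x) = -q₁ x / (α * β)) {m : ℕ} {l : ℂ} (hl : l ≠ 0)
    (hlim : ∀ (Q T : ℝ) (V₁ V₂ W₁ W₂ : ℝ → ℝ → ℂ), IsHatFamily (ω₁ - ω₂) q₁ q₂ Q T V₁ V₂ →
      IsHatFamily (ω₁ - ω₂) r₁ r₂ Q T W₁ W₂ →
      Tendsto (fun τ : ℝ => (τ:ℂ) ^ m * (V₁ τ 0 - W₁ τ 0)) atTop (𝓝 l)) :
    RayBound ω₁ ω₂ α β q₁ q₂ := by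
  obtain ⟨Q, hQ⟩ : ∃ Q : ℝ, 0 ≤ Q ∧ ∀ x ∈ Icc (0:ℝ) 1,
      ‖q₁ x‖ ≤ Q ∧ ‖q₂ x‖ ≤ Q ∧ ‖r₁ x‖ ≤ Q ∧ ‖r₂ x‖ ≤ Q := by
    obtain ⟨Q, hQ⟩ := (isCompact_Icc (a := (0:ℝ)) (b := 1)).exists_bound_of_continuousOn
      (f := fun x => (‖q₁ x‖ + ‖q₂ x‖) + (‖r₁ x‖ + ‖r₂ x‖)) (by fun_prop)
    have h : ∀ x ∈ Icc (0:ℝ) 1, (‖q₁ x‖ + ‖q₂ x‖) + (‖r₁ x‖ + ‖r₂ x‖) ≤ Q := fun x hx =>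
      (le_abs_self _).trans (hQ x hx)
    refine ⟨Q, ?_, fun x hx => ?_⟩
    · have := h 0 (by simp)
      linarith [norm_nonneg (q₁ 0), norm_nonneg (q₂ 0), norm_nonneg (r₁ 0), norm_nonneg (r₂ 0)]
    · have := h x hx
      refine ⟨?_, ?_, ?_, ?_⟩ <;>
      linarith [norm_nonneg (q₁ x), norm_nonneg (q₂ x), norm_nonneg (r₁ x), norm_nonneg (r₂ x)]
  obtain ⟨hQ0, hQ⟩ := hQ
  have hζ : 0 < (ω₁ - ω₂).re := by simp; linarith
  set T₀ : ℝ := 2 * Q ^ 2 / (ω₁ - ω₂).re + 2 * Q / (ω₁ - ω₂).re + 1 with hT₀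
  have hT₀pos : 0 < T₀ := by positivity
  have hle1 : 2 * Q ^ 2 ≤ (ω₁ - ω₂).re * T₀ := by
    have : (ω₁ - ω₂).re * T₀ = 2 * Q ^ 2 + 2 * Q + (ω₁ - ω₂).re := by
      rw [hT₀]; field_simp
    rw [this]; linarith
  have hle2 : 2 * Q ≤ (ω₁ - ω₂).re * T₀ := by
    have : (ω₁ - ω₂).re * T₀ = 2 * Q ^ 2 + 2 * Q + (ω₁ - ω₂).re := by
      rw [hT₀]; field_simp
    rw [this]; nlinarith [sq_nonneg Q]
  obtain ⟨V₁, V₂, hV⟩ := exists_isHatFamily hζ hT₀pos hle1 hq₁ hq₂ (fun x hx => (hQ x hx).1)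
    (fun x hx => (hQ x hx).2.1) hsq
  obtain ⟨W₁, W₂, hW⟩ := exists_isHatFamily hζ hT₀pos hle1 hr₁c hr₂c
    (fun x hx => (hQ x hx).2.2.1) (fun x hx => (hQ x hx).2.2.2) hsr
  have hD := (IsHatFamily.tendsto_mul_charD (α := α) (β := β) h₁ h₂ hV hW
    (hlim Q T₀ V₁ V₂ W₁ W₂ hV hW)).norm
  have hl0 : ‖l‖ / 2 < ‖l‖ := half_lt_self (norm_pos_iff.2 hl)
  obtain ⟨T₁, hT₁⟩ := eventually_atTop.1 (hD.eventually_const_lt hl0)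
  set κ := min ω₁.re (-ω₂.re) with hκ
  have hκ0 : 0 < κ := lt_min h₁ (by linarith)
  set E : ℝ := 4 + ‖β‖ * (2 * (‖(α * β)⁻¹‖ + 1)) with hE
  have hE0 : 0 ≤ E := by positivity
  have hlp : 0 < ‖l‖ := norm_pos_iff.2 hl
  refine ⟨2 * (‖α‖ + 1) * (E * (2 / ‖l‖)) + 2 / κ, m, max (max T₀ T₁) (2 * Q / κ + 1),
    by positivity, by positivity, ?_⟩
  intro τ hτ G₁ G₂ y₁ y₂ g hy hG₁ hG₂ bc₁ bc₂ x hx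
  have hτ0 : T₀ ≤ τ := (le_max_left _ _).trans ((le_max_left _ _).trans hτ)
  have hτ1 : T₁ ≤ τ := (le_max_right _ _).trans ((le_max_left _ _).trans hτ)
  have hτ2 : 2 * Q / κ + 1 ≤ τ := (le_max_right _ _).trans hτ
  have hτone : 1 ≤ τ := by
    have : 0 ≤ 2 * Q / κ := by positivity
    linarith
  have hτpos : 0 < τ := by linarith
  have hg : 0 ≤ g := (norm_nonneg _).trans (hG₁ 0 (by simp))
  have hκτ : 2 * Q ≤ κ * τ := by
    have h3 : 2 * Q / κ ≤ τ := by linarith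
    rw [div_le_iff₀ hκ0] at h3; linarith
  have re1 : (ω₁ * τ).re = ω₁.re * τ := by simp
  have re2 : (ω₂ * τ).re = ω₂.re * τ := by simp
  have hb1 : ∀ x ∈ Icc (0:ℝ) 1, ∀ {q₁ q₂ : ℝ → ℂ} {V₁ V₂ : ℝ → ℝ → ℂ},
      IsHatFamily (ω₁ - ω₂) q₁ q₂ Q T₀ V₁ V₂ → ‖V₁ τ x‖ ≤ 2 := by
    intro x hx q₁ q₂ V₁ V₂ hV
    refine (hV.bounds hτ0 hx).2.1.trans ?_
    have h4 : 2 * Q ≤ (ω₁ - ω₂).re * τ :=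
      hle2.trans (mul_le_mul_of_nonneg_left hτ0 hζ.le)
    exact (div_le_one_of_le₀ h4 (by positivity)).trans one_le_two
  have hsub : ω₁ * τ - ω₂ * τ = (ω₁ - ω₂) * τ := by ring
  have hc := IsSol.norm_mul_charD_le (μ₁ := ω₁ * τ) (μ₂ := ω₂ * τ) hα hβ
    (by rw [re1]; positivity) (by rw [re2]; nlinarith) hr₁ hr₂
    (hsub ▸ hV.sol τ hτ0) (hV.one τ hτ0) (hV.zero τ hτ0)
    (hsub ▸ hW.sol τ hτ0) (hW.one τ hτ0) (hW.zero τ hτ0)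
    (fun x hx => hb1 x hx hV) (fun x hx => (hV.bounds hτ0 hx).1)
    (fun x hx => hb1 x hx hW) (fun x hx => (hW.bounds hτ0 hx).1) hy hG₁ hG₂ bc₁ bc₂
  set D := charD (ω₁ * τ) (ω₂ * τ) α β (V₁ τ) (V₂ τ) (W₁ τ) (W₂ τ) with hDdef
  have hDlow : ‖l‖ / 2 < τ ^ m * ‖D‖ := by
    have := hT₁ τ hτ1
    rwa [norm_mul, norm_pow, norm_real, Real.norm_of_nonneg hτpos.le] at this
  have hy20 : ‖y₂ 0‖ ≤ E * (2 / ‖l‖) * τ ^ m * g := by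
    have h5 : ‖y₂ 0‖ * ‖D‖ ≤ E * g := by
      rw [← norm_mul]; refine hc.trans (le_of_eq ?_); rw [hE]; ring
    have h6 : ‖y₂ 0‖ * (‖l‖ / 2) ≤ τ ^ m * (E * g) := by
      calc ‖y₂ 0‖ * (‖l‖ / 2) ≤ ‖y₂ 0‖ * (τ ^ m * ‖D‖) :=
            mul_le_mul_of_nonneg_left hDlow.le (norm_nonneg _)
        _ = τ ^ m * (‖y₂ 0‖ * ‖D‖) := by ring
        _ ≤ _ := mul_le_mul_of_nonneg_left h5 (by positivity)
    have h7 : ‖y₂ 0‖ ≤ τ ^ m * (E * g) / (‖l‖ / 2) := by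
      rw [le_div_iff₀ (by positivity)]; exact h6
    refine h7.trans (le_of_eq ?_)
    field_simp
  have hy11 : ‖y₁ 1‖ = ‖α‖ * ‖y₂ 0‖ := by
    rw [show y₁ 1 = -(α * y₂ 0) by linear_combination bc₂, norm_neg, norm_mul]
  have hfin := hy.norm_le (κ := κ * τ) (by positivity) hκτ
    (by rw [re1]; exact mul_le_mul_of_nonneg_right (min_le_left _ _) hτpos.le)
    (by
      rw [re2]
      have := mul_le_mul_of_nonneg_right (min_le_right ω₁.re (-ω₂.re)) hτpos.le
      rw [← hκ] at this
      linarith)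
    (fun x hx => (hQ x hx).1) (fun x hx => (hQ x hx).2.1) hG₁ hG₂ hx
  have hle : 2 * (‖y₁ 1‖ + ‖y₂ 0‖) + 2 * g / (κ * τ) ≤
      (2 * (‖α‖ + 1) * (E * (2 / ‖l‖)) + 2 / κ) * τ ^ m * g := by
    have h8 : 2 * g / (κ * τ) ≤ 2 / κ * τ ^ m * g := by
      have h9 : 2 * g / (κ * τ) ≤ 2 * g / κ := by
        apply div_le_div_of_nonneg_left (by positivity) hκ0
        nlinarith
      have h10 : 2 * g / κ ≤ 2 * g / κ * τ ^ m :=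
        le_mul_of_one_le_right (by positivity) (one_le_pow₀ hτone)
      refine h9.trans (h10.trans (le_of_eq ?_))
      ring
    have h11 := mul_le_mul_of_nonneg_left hy20 (show 0 ≤ 2 * (‖α‖ + 1) by positivity)
    rw [hy11]
    linarith
  exact ⟨hfin.1.trans hle, hfin.2.trans hle⟩

end

/-- Continuous `ℂ²`-valued functions on the unit interval. -/
abbrev XC := C(unitInterval, ℂ × ℂ)

/-- Projection of the real line to the unit interval. -/
noncomputable abbrev pr (t : ℝ) : unitInterval := projIcc (0:ℝ) 1 zero_le_one t

theorem continuous_pr : Continuous pr := continuous_projIcc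

theorem pr_of_mem {t : ℝ} (h : t ∈ Icc (0:ℝ) 1) : pr t = ⟨t, h⟩ := projIcc_of_mem _ h

/-- Primitive vanishing at `0`, as a function on the real line. -/
noncomputable def primit (y : XC) (x : ℝ) : ℂ × ℂ := ∫ t in (0:ℝ)..x, y (pr t)

theorem continuous_comp_pr (y : XC) : Continuous fun t => y (pr t) :=
  y.continuous.comp continuous_pr

theorem hasDerivAt_primit (y : XC) (x : ℝ) : HasDerivAt (primit y) (y (pr x)) x :=
  ((continuous_comp_pr y).integral_hasStrictDerivAt 0 x).hasDerivAt

theorem continuous_primit (y : XC) : Continuous (primit y) :=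
  continuous_iff_continuousAt.2 fun x => (hasDerivAt_primit y x).continuousAt

theorem norm_primit_le (y : XC) (x : unitInterval) : ‖primit y x‖ ≤ ‖y‖ := by
  have := intervalIntegral.norm_integral_le_of_norm_le_const (a := 0) (b := (x:ℝ)) (C := ‖y‖)
    (f := fun t => y (pr t)) (fun t _ => y.norm_coe_le_norm _)
  refine this.trans ?_
  rw [sub_zero, abs_of_nonneg x.2.1]
  exact mul_le_of_le_one_right (norm_nonneg _) x.2.2

/-- Primitive vanishing at `0`, as an operator. -/
noncomputable def Jop : XC →L[ℂ] XC :=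
  LinearMap.mkContinuous
    { toFun := fun y => ⟨fun x => primit y x, (continuous_primit y).comp continuous_subtype_val⟩
      map_add' := fun y z => by
        ext1 x
        exact intervalIntegral.integral_add ((continuous_comp_pr y).intervalIntegrable _ _)
          ((continuous_comp_pr z).intervalIntegrable _ _)
      map_smul' := fun c y => by
        ext1 x
        exact intervalIntegral.integral_smul c _ } 1 (fun y => by
      rw [one_mul]
      exact (ContinuousMap.norm_le _ (norm_nonneg _)).2 fun x => norm_primit_le y x)

theorem Jop_apply (y : XC) (x : unitInterval) : Jop y x = primit y x := rfl

/-- Constant functions. -/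
noncomputable def constop : ℂ × ℂ →L[ℂ] XC :=
  LinearMap.mkContinuous
    { toFun := fun c => ContinuousMap.const _ c
      map_add' := fun _ _ => rfl
      map_smul' := fun _ _ => rfl } 1 (fun c => by
      rw [one_mul]
      exact (ContinuousMap.norm_le _ (norm_nonneg _)).2 fun x => le_rfl)

theorem constop_apply (c : ℂ × ℂ) (x : unitInterval) : constop c x = c := rfl

/-- The diagonal multiplication operator. -/
noncomputable def Bop (A₁ A₂ : ℂ) : XC →L[ℂ] XC :=
  LinearMap.mkContinuous
    { toFun := fun y => ⟨fun x => (A₁ * (y x).1, A₂ * (y x).2), by fun_prop⟩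
      map_add' := fun y z => by
        ext x <;> simp <;> ring
      map_smul' := fun c y => by
        ext x <;> simp <;> ring } (max ‖A₁‖ ‖A₂‖) (fun y => by
      refine (ContinuousMap.norm_le _ (by positivity)).2 fun x => ?_
      have h := y.norm_coe_le_norm x
      have h1 := (norm_fst_le (y x)).trans h
      have h2 := (norm_snd_le (y x)).trans h
      change ‖(A₁ * (y x).1, A₂ * (y x).2)‖ ≤ _
      rw [Prod.norm_mk, norm_mul, norm_mul]
      exact max_le (mul_le_mul (le_max_left _ _) h1 (norm_nonneg _) (by positivity))
        (mul_le_mul (le_max_right _ _) h2 (norm_nonneg _) (by positivity)))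

theorem Bop_apply (A₁ A₂ : ℂ) (y : XC) (x : unitInterval) :
    Bop A₁ A₂ y x = (A₁ * (y x).1, A₂ * (y x).2) := rfl

/-- The off-diagonal multiplication operator. -/
noncomputable def Qop (q₁ q₂ : C(unitInterval, ℂ)) : XC →L[ℂ] XC :=
  LinearMap.mkContinuous
    { toFun := fun y => ⟨fun x => (q₁ x * (y x).2, q₂ x * (y x).1), by fun_prop⟩
      map_add' := fun y z => by
        ext x <;> simp <;> ring
      map_smul' := fun c y => by
        ext x <;> simp <;> ring } (max ‖q₁‖ ‖q₂‖) (fun y => by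
      refine (ContinuousMap.norm_le _ (by positivity)).2 fun x => ?_
      have h := y.norm_coe_le_norm x
      have h1 := (norm_fst_le (y x)).trans h
      have h2 := (norm_snd_le (y x)).trans h
      change ‖(q₁ x * (y x).2, q₂ x * (y x).1)‖ ≤ _
      rw [Prod.norm_mk, norm_mul, norm_mul]
      exact max_le
        (mul_le_mul ((q₁.norm_coe_le_norm x).trans (le_max_left _ _)) h2 (norm_nonneg _)
          (by positivity))
        (mul_le_mul ((q₂.norm_coe_le_norm x).trans (le_max_right _ _)) h1 (norm_nonneg _)
          (by positivity)))

section
variable {R : Type*} [NormedRing R] {a : R} {c : ℝ}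

theorem summable_norm_pow_of_le (h : ∀ n, ‖a ^ n‖ ≤ c ^ n / n.factorial) :
    Summable fun n => ‖a ^ n‖ :=
  Summable.of_nonneg_of_le (fun _ => norm_nonneg _) h (Real.summable_pow_div_factorial c)

variable [CompleteSpace R]

theorem isUnit_one_sub_of_norm_pow_le (h : ∀ n, ‖a ^ n‖ ≤ c ^ n / n.factorial) :
    IsUnit (1 - a) := by
  have hs : Summable (a ^ · : ℕ → R) := (summable_norm_pow_of_le h).of_norm
  exact ⟨⟨1 - a, ∑' n, a ^ n, hs.one_sub_mul_tsum_pow, hs.tsum_pow_mul_one_sub⟩, rfl⟩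

theorem norm_inverse_one_sub_le (h : ∀ n, ‖a ^ n‖ ≤ c ^ n / n.factorial) :
    ‖Ring.inverse (1 - a)‖ ≤ Real.exp c := by
  have hs := summable_norm_pow_of_le h
  have hu := isUnit_one_sub_of_norm_pow_le h
  have hs' : Summable (a ^ · : ℕ → R) := hs.of_norm
  have e : Ring.inverse (1 - a) = ∑' n, a ^ n := by
    have h1 := hs'.one_sub_mul_tsum_pow
    calc _ = Ring.inverse (1 - a) * ((1 - a) * ∑' n, a ^ n) := by
          rw [h1, mul_one]
      _ = _ := by rw [← mul_assoc, Ring.inverse_mul_cancel _ hu, one_mul]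
  rw [e]
  refine (norm_tsum_le_tsum_norm hs).trans ?_
  rw [Real.exp_eq_exp_ℝ, NormedSpace.exp_eq_tsum_div]
  exact hs.tsum_le_tsum h (Real.summable_pow_div_factorial c)

end

section volterra
variable {M : XC →L[ℂ] XC} {c : ℝ}

theorem norm_volterra_pow_apply_le (hc : 0 ≤ c) (hM : ∀ y x, ‖M y x‖ ≤ c * ‖y x‖) (n : ℕ) (y : XC)
    (x : unitInterval) :
    ‖((Jop * M) ^ n) y x‖ ≤ c ^ n * ‖y‖ / n.factorial * (x:ℝ) ^ n := by
  induction n generalizing x with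
  | zero => simpa using y.norm_coe_le_norm x
  | succ n ih =>
    rw [pow_succ']
    change ‖primit (M (((Jop * M) ^ n) y)) x‖ ≤ _
    have hx0 : (0:ℝ) ≤ x := x.2.1
    have h1 : ∀ t ∈ Ioc (0:ℝ) x, ‖M (((Jop * M) ^ n) y) (pr t)‖ ≤
        c * (c ^ n * ‖y‖ / n.factorial) * t ^ n := by
      intro t ht
      have htm : t ∈ Icc (0:ℝ) 1 := ⟨ht.1.le, ht.2.trans x.2.2⟩
      refine (hM _ _).trans ?_
      have := ih (pr t)
      rw [pr_of_mem htm] at this ⊢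
      calc _ ≤ c * (c ^ n * ‖y‖ / n.factorial * t ^ n) := mul_le_mul_of_nonneg_left this hc
        _ = _ := by ring
    have h2 := intervalIntegral.norm_integral_le_of_norm_le (a := 0) (b := (x:ℝ)) hx0
      (f := fun t => M (((Jop * M) ^ n) y) (pr t))
      (g := fun t => c * (c ^ n * ‖y‖ / n.factorial) * t ^ n) (μ := volume)
      (Eventually.of_forall h1) (Continuous.intervalIntegrable (by fun_prop) _ _)
    refine h2.trans (le_of_eq ?_)
    rw [intervalIntegral.integral_const_mul, integral_pow, Nat.factorial_succ]
    push_cast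
    field_simp
    ring

theorem norm_volterra_pow_le (hc : 0 ≤ c) (hM : ∀ y x, ‖M y x‖ ≤ c * ‖y x‖) (n : ℕ) :
    ‖(Jop * M) ^ n‖ ≤ c ^ n / n.factorial := by
  refine ContinuousLinearMap.opNorm_le_bound _ (by positivity) fun y => ?_
  refine (ContinuousMap.norm_le _ (by positivity)).2 fun x => ?_
  refine (norm_volterra_pow_apply_le hc hM n y x).trans ?_
  have : (x:ℝ) ^ n ≤ 1 := pow_le_one₀ x.2.1 x.2.2
  calc _ ≤ c ^ n * ‖y‖ / n.factorial * 1 := by gcongr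
    _ = _ := by ring

theorem isUnit_one_sub_volterra (hc : 0 ≤ c) (hM : ∀ y x, ‖M y x‖ ≤ c * ‖y x‖) :
    IsUnit (1 - Jop * M) :=
  isUnit_one_sub_of_norm_pow_le (R := XC →L[ℂ] XC) (norm_volterra_pow_le hc hM)

theorem norm_inverse_volterra_le (hc : 0 ≤ c) (hM : ∀ y x, ‖M y x‖ ≤ c * ‖y x‖) :
    ‖Ring.inverse (1 - Jop * M)‖ ≤ Real.exp c :=
  norm_inverse_one_sub_le (R := XC →L[ℂ] XC) (norm_volterra_pow_le hc hM)

end volterra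

section
variable {R : Type*} [NormedRing R] [CompleteSpace R] [NormedAlgebra ℂ R]

theorem differentiable_inverse_pencil {a b : R} (h : ∀ z : ℂ, IsUnit (a - z • b)) :
    Differentiable ℂ fun z : ℂ => Ring.inverse (a - z • b) := fun z =>
  (differentiableAt_inverse (𝕜 := ℂ) (h z)).comp (f := fun z : ℂ => a - z • b) z (by fun_prop)

end

section
variable {E F : Type*} [NormedAddCommGroup E] [NormedSpace ℂ E] [CompleteSpace E]
  [NormedAddCommGroup F] [NormedSpace ℂ F]

theorem map_iterDslope_eq_zero {f : ℂ → E} (hf : Differentiable ℂ f) (U : E →L[ℂ] F)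
    (h : ∀ z, U (f z) = 0) (c : ℂ) (j : ℕ) (z : ℂ) : U (iterDslope f c j z) = 0 := by
  induction j generalizing z with
  | zero => exact h z
  | succ j ih =>
    have hc : Continuous fun z => U (iterDslope f c (j + 1) z) :=
      U.continuous.comp (differentiable_iterDslope hf c (j + 1)).continuous
    have heq : ∀ z ≠ c, U (iterDslope f c (j + 1) z) = 0 := by
      intro z hz
      have := congrArg U (iterDslope_eq f c j z)
      rw [ih, map_add, ih, zero_add, map_smul] at this
      exact (smul_eq_zero.1 this.symm).resolve_left (sub_ne_zero.2 hz)
    have : (fun z => U (iterDslope f c (j + 1) z)) = fun _ => 0 :=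
      hc.ext_on (dense_compl_singleton c) continuous_const fun z hz => heq z hz
    exact congrFun this z

/-- Remainder term in the chain relations of the divided differences. -/
noncomputable def chainRem (T₁ : E →L[ℂ] F) (f : ℂ → E) (c : ℂ) : ℕ → F
  | 0 => 0
  | j + 1 => T₁ (iterDslope f c j c)

theorem pencil_iterDslope {f : ℂ → E} {D : ℂ → ℂ} (hf : Differentiable ℂ f)
    (hD : Differentiable ℂ D) (T₀ T₁ : E →L[ℂ] F) (w : F)
    (h : ∀ z, T₀ (f z) + z • T₁ (f z) = D z • w) (c : ℂ) (j : ℕ) (z : ℂ) :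
    T₀ (iterDslope f c j z) + z • T₁ (iterDslope f c j z) =
      iterDslope D c j z • w - chainRem T₁ f c j := by
  induction j generalizing z with
  | zero => simpa [chainRem, iterDslope] using h z
  | succ j ih =>
    have c1 := (differentiable_iterDslope hf c (j + 1)).continuous
    have c2 := (differentiable_iterDslope hD c (j + 1)).continuous
    have heq : ∀ z ≠ c, T₀ (iterDslope f c (j + 1) z) + z • T₁ (iterDslope f c (j + 1) z) =
        iterDslope D c (j + 1) z • w - chainRem T₁ f c (j + 1) := by
      intro z hz
      have hz' := sub_ne_zero.2 hz
      have e1 := iterDslope_eq f c j z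
      have e2 := iterDslope_eq D c j z
      have i1 := ih z
      have i2 := ih c
      refine smul_right_injective F hz' ?_
      dsimp only [chainRem]
      rw [e1, e2] at i1
      simp only [map_add, map_smul, smul_add, add_smul, smul_eq_mul] at i1
      have i3 : (z - c) • T₀ (iterDslope f c (j + 1) z) +
          z • (z - c) • T₁ (iterDslope f c (j + 1) z) + (z - c) • T₁ (iterDslope f c j c) -
          ((z - c) * iterDslope D c (j + 1) z) • w =
          (T₀ (iterDslope f c j c) + (z - c) • T₀ (iterDslope f c (j + 1) z) +
          (z • T₁ (iterDslope f c j c) + z • (z - c) • T₁ (iterDslope f c (j + 1) z))) -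
          (iterDslope D c j c • w + ((z - c) * iterDslope D c (j + 1) z) • w -
            chainRem T₁ f c j) -
          (T₀ (iterDslope f c j c) + c • T₁ (iterDslope f c j c) -
          (iterDslope D c j c • w - chainRem T₁ f c j)) := by
        module
      rw [i1, i2, sub_self, sub_self, zero_sub, neg_zero] at i3
      rw [← sub_eq_zero]
      refine Eq.trans ?_ i3
      module
    have : (fun z => T₀ (iterDslope f c (j + 1) z) + z • T₁ (iterDslope f c (j + 1) z)) =
        fun z => iterDslope D c (j + 1) z • w - chainRem T₁ f c (j + 1) :=
      Continuous.ext_on (dense_compl_singleton c) (by fun_prop) (by fun_prop)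
        fun z hz => heq z hz
    exact congrFun this z

end

/-- Data of a normalized two-point boundary value problem. -/
structure BVP where
  (A₁ A₂ α β : ℂ)
  (q₁ q₂ : C(unitInterval, ℂ))

namespace BVP
variable (p : BVP)

/-- The coefficient operator. -/
noncomputable def M (z : ℂ) : XC →L[ℂ] XC := Qop p.q₁ p.q₂ + z • Bop p.A₁ p.A₂

theorem M_apply (z : ℂ) (y : XC) (x : unitInterval) :
    p.M z y x = (p.q₁ x * (y x).2 + z * (p.A₁ * (y x).1), p.q₂ x * (y x).1 + z * (p.A₂ * (y x).2)) :=
  rfl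

/-- Bound for the off-diagonal part. -/
noncomputable def cQ : ℝ := max ‖p.q₁‖ ‖p.q₂‖

/-- Bound for the diagonal part. -/
noncomputable def cB : ℝ := max ‖p.A₁‖ ‖p.A₂‖

theorem cQ_nonneg : 0 ≤ p.cQ := le_max_of_le_left (norm_nonneg _)
theorem cB_nonneg : 0 ≤ p.cB := le_max_of_le_left (norm_nonneg _)

theorem norm_M_le (z : ℂ) (y : XC) (x : unitInterval) :
    ‖p.M z y x‖ ≤ (p.cQ + p.cB * ‖z‖) * ‖y x‖ := by
  have hQ := p.cQ_nonneg
  have hB := p.cB_nonneg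
  have h1 := norm_fst_le (y x)
  have h2 := norm_snd_le (y x)
  have a1 : ‖p.q₁ x‖ ≤ p.cQ := (p.q₁.norm_coe_le_norm x).trans (le_max_left _ _)
  have a2 : ‖p.q₂ x‖ ≤ p.cQ := (p.q₂.norm_coe_le_norm x).trans (le_max_right _ _)
  have b1 : ‖p.A₁‖ ≤ p.cB := le_max_left _ _
  have b2 : ‖p.A₂‖ ≤ p.cB := le_max_right _ _
  rw [M_apply, Prod.norm_mk]
  refine max_le ?_ ?_ <;> refine (norm_add_le _ _).trans ?_ <;> simp only [norm_mul] <;>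
    rw [add_mul, mul_comm p.cB, mul_assoc] <;> gcongr

theorem cM_nonneg (z : ℂ) : 0 ≤ p.cQ + p.cB * ‖z‖ := by
  have hQ := p.cQ_nonneg
  have hB := p.cB_nonneg
  positivity

/-- The solution operator of the integral equation. -/
noncomputable def S (z : ℂ) : XC →L[ℂ] XC := Ring.inverse (1 - Jop * p.M z)

theorem isUnit (z : ℂ) : IsUnit (1 - Jop * p.M z) :=
  isUnit_one_sub_volterra (p.cM_nonneg z) (p.norm_M_le z)

theorem norm_S_le (z : ℂ) : ‖p.S z‖ ≤ Real.exp (p.cQ + p.cB * ‖z‖) :=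
  norm_inverse_volterra_le (p.cM_nonneg z) (p.norm_M_le z)

theorem differentiable_S : Differentiable ℂ p.S := by
  have e : ∀ z, 1 - Jop * p.M z = (1 - Jop * Qop p.q₁ p.q₂) - z • (Jop * Bop p.A₁ p.A₂) := by
    intro z
    refine ContinuousLinearMap.ext fun y => ?_
    change y - Jop (Qop p.q₁ p.q₂ y + z • Bop p.A₁ p.A₂ y) =
      (y - Jop (Qop p.q₁ p.q₂ y)) - z • Jop (Bop p.A₁ p.A₂ y)
    rw [map_add, map_smul, sub_sub]
  have := differentiable_inverse_pencil (R := XC →L[ℂ] XC) (a := 1 - Jop * Qop p.q₁ p.q₂)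
    (b := Jop * Bop p.A₁ p.A₂) (fun z => e z ▸ p.isUnit z)
  unfold S
  simp only [e]
  exact this

theorem S_eq (z : ℂ) (f : XC) : p.S z f = Jop (p.M z (p.S z f)) + f := by
  have h := Ring.mul_inverse_cancel _ (p.isUnit z)
  have h2 := congrArg (fun T : XC →L[ℂ] XC => T f) h
  have h3 : p.S z f - Jop (p.M z (p.S z f)) = f := h2
  exact sub_eq_iff_eq_add'.1 h3

theorem eq_S (z : ℂ) {y f : XC} (h : y = Jop (p.M z y) + f) : y = p.S z f := by
  have h1 := Ring.inverse_mul_cancel _ (p.isUnit z)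
  have h2 := congrArg (fun T : XC →L[ℂ] XC => T y) h1
  have h3 : p.S z (y - Jop (p.M z y)) = y := h2
  rw [← h3]
  congr 1
  exact sub_eq_iff_eq_add'.2 h

/-- The boundary operator. -/
noncomputable def U : XC →L[ℂ] ℂ × ℂ :=
  ((ContinuousLinearMap.fst ℂ ℂ ℂ).comp (ContinuousMap.evalCLM ℂ (0 : unitInterval)) +
    p.β • (ContinuousLinearMap.snd ℂ ℂ ℂ).comp (ContinuousMap.evalCLM ℂ (1 : unitInterval))).prod
  (p.α • (ContinuousLinearMap.snd ℂ ℂ ℂ).comp (ContinuousMap.evalCLM ℂ (0 : unitInterval)) +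
    (ContinuousLinearMap.fst ℂ ℂ ℂ).comp (ContinuousMap.evalCLM ℂ (1 : unitInterval)))

theorem U_apply (y : XC) :
    p.U y = ((y 0).1 + p.β * (y 1).2, p.α * (y 0).2 + (y 1).1) := rfl

/-- Boundary values of the fundamental solutions. -/
noncomputable def bv (z : ℂ) (c : ℂ × ℂ) : ℂ × ℂ := p.U (p.S z (constop c))

theorem differentiable_bv (c : ℂ × ℂ) : Differentiable ℂ fun z => p.bv z c := by
  have := p.differentiable_S
  unfold bv
  fun_prop

/-- The characteristic determinant. -/
noncomputable def D (z : ℂ) : ℂ :=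
  (p.bv z (1, 0)).1 * (p.bv z (0, 1)).2 - (p.bv z (0, 1)).1 * (p.bv z (1, 0)).2

theorem differentiable_D : Differentiable ℂ p.D := by
  have h1 := p.differentiable_bv (1, 0)
  have h2 := p.differentiable_bv (0, 1)
  unfold D
  fun_prop

/-- The adjugate of the matrix of boundary values. -/
noncomputable def adj (z : ℂ) : ℂ × ℂ →L[ℂ] ℂ × ℂ :=
  (p.bv z (0, 1)).2 • (ContinuousLinearMap.inl ℂ ℂ ℂ).comp (ContinuousLinearMap.fst ℂ ℂ ℂ) -
  (p.bv z (0, 1)).1 • (ContinuousLinearMap.inl ℂ ℂ ℂ).comp (ContinuousLinearMap.snd ℂ ℂ ℂ) -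
  (p.bv z (1, 0)).2 • (ContinuousLinearMap.inr ℂ ℂ ℂ).comp (ContinuousLinearMap.fst ℂ ℂ ℂ) +
  (p.bv z (1, 0)).1 • (ContinuousLinearMap.inr ℂ ℂ ℂ).comp (ContinuousLinearMap.snd ℂ ℂ ℂ)

theorem adj_apply (z : ℂ) (u : ℂ × ℂ) : p.adj z u =
    ((p.bv z (0, 1)).2 * u.1 - (p.bv z (0, 1)).1 * u.2,
      -(p.bv z (1, 0)).2 * u.1 + (p.bv z (1, 0)).1 * u.2) := by
  ext <;> simp [adj]

theorem differentiable_adj : Differentiable ℂ p.adj := by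
  have h1 := p.differentiable_bv (1, 0)
  have h2 := p.differentiable_bv (0, 1)
  unfold adj
  fun_prop

theorem bv_eq (z : ℂ) (c : ℂ × ℂ) :
    p.bv z c = c.1 • p.bv z (1, 0) + c.2 • p.bv z (0, 1) := by
  have : c = c.1 • ((1, 0) : ℂ × ℂ) + c.2 • ((0, 1) : ℂ × ℂ) := by ext <;> simp
  conv_lhs => rw [this]
  simp only [bv, map_add, map_smul]

theorem bv_adj (z : ℂ) (u : ℂ × ℂ) : p.bv z (p.adj z u) = p.D z • u := by
  rw [bv_eq, adj_apply]
  ext <;> simp [D] <;> ring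

/-- The numerator of the resolvent. -/
noncomputable def N (z : ℂ) : XC →L[ℂ] XC :=
  p.D z • p.S z - (p.S z).comp ((constop.comp ((p.adj z).comp p.U)).comp (p.S z))

theorem N_apply (z : ℂ) (f : XC) :
    p.N z f = p.D z • p.S z f - p.S z (constop (p.adj z (p.U (p.S z f)))) := rfl

theorem differentiable_N : Differentiable ℂ p.N := by
  have h1 := p.differentiable_S
  have h2 := p.differentiable_D
  have h3 := p.differentiable_adj
  exact (h2.smul h1).sub (h1.clm_comp (((differentiable_const constop).clm_comp
    (h3.clm_comp (differentiable_const p.U))).clm_comp h1))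

theorem U_N (z : ℂ) (f : XC) : p.U (p.N z f) = 0 := by
  rw [N_apply, map_sub, map_smul]
  change _ - p.bv z _ = 0
  rw [bv_adj, sub_self]

theorem N_eq (z : ℂ) (f : XC) : ∃ c, p.N z f = constop c + Jop (p.M z (p.N z f)) + p.D z • f := by
  refine ⟨-p.adj z (p.U (p.S z f)), ?_⟩
  have e1 := p.S_eq z f
  have e2 := p.S_eq z (constop (p.adj z (p.U (p.S z f))))
  rw [N_apply]
  set a := p.S z f
  set b := p.S z (constop (p.adj z (p.U a)))
  simp only [map_sub, map_smul, map_neg]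
  conv_lhs => rw [e1, e2]
  module

/-- Uniqueness of the numerator away from the zeros of the determinant. -/
theorem eq_zero_of_D_ne_zero {z : ℂ} (hD : p.D z ≠ 0) {y : XC} (hU : p.U y = 0) {c : ℂ × ℂ}
    (h : y = constop c + Jop (p.M z y)) : y = 0 := by
  have hy := p.eq_S z (f := constop c) (by rw [add_comm]; exact h)
  have hb : p.bv z c = 0 := by rw [bv, ← hy, hU]
  rw [bv_eq] at hb
  have e1 := congrArg Prod.fst hb
  have e2 := congrArg Prod.snd hb
  simp at e1 e2
  have c1 : c.1 = 0 := by
    refine (mul_eq_zero.1 (?_ : c.1 * p.D z = 0)).resolve_right hD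
    unfold D
    linear_combination (p.bv z (0, 1)).2 * e1 - (p.bv z (0, 1)).1 * e2
  have c2 : c.2 = 0 := by
    refine (mul_eq_zero.1 (?_ : c.2 * p.D z = 0)).resolve_right hD
    unfold D
    linear_combination -(p.bv z (1, 0)).2 * e1 + (p.bv z (1, 0)).1 * e2
  have : c = 0 := Prod.ext c1 c2
  rw [hy, this, map_zero, map_zero]

theorem exists_of_D_eq_zero {z : ℂ} (hD : p.D z = 0) : ∃ c : ℂ × ℂ, c ≠ 0 ∧ p.bv z c = 0 := by
  by_cases h1 : p.bv z (1, 0) = 0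
  · exact ⟨(1, 0), by simp, h1⟩
  · by_cases h2 : (p.bv z (1, 0)).1 = 0
    · refine ⟨((p.bv z (0, 1)).2, -(p.bv z (1, 0)).2), ?_, ?_⟩
      · intro h
        have : (p.bv z (1, 0)).2 = 0 := by simpa using congrArg Prod.snd h
        exact h1 (Prod.ext h2 this)
      · rw [bv_eq]
        unfold D at hD
        ext
        · simp
          linear_combination hD
        · simp; ring
    · refine ⟨(-(p.bv z (0, 1)).1, (p.bv z (1, 0)).1), ?_, ?_⟩
      · intro h
        exact h2 (by simpa using congrArg Prod.snd h)
      · rw [bv_eq]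
        unfold D at hD
        ext
        · simp; ring
        · simp
          linear_combination hD

end BVP

namespace BVP
variable (p : BVP)

/-- Solutions of the integral equation are solutions of the differential system. -/
theorem isSol_of_eq {z μ₁ μ₂ : ℂ} (h₁ : p.A₁ * z = μ₁) (h₂ : p.A₂ * z = μ₂) {q₁ q₂ : ℝ → ℂ}
    (hq₁ : ∀ x : unitInterval, p.q₁ x = q₁ x) (hq₂ : ∀ x : unitInterval, p.q₂ x = q₂ x)
    {y G : XC} {c : ℂ × ℂ} (h : y = constop c + Jop (p.M z y + G)) :
    ∃ y₁ y₂ : ℝ → ℂ, IsSol μ₁ μ₂ q₁ q₂ (fun x => (G (pr x)).1) (fun x => (G (pr x)).2) y₁ y₂ ∧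
      (∀ x : unitInterval, y x = (y₁ x, y₂ x)) ∧ y₁ 0 = c.1 ∧ y₂ 0 = c.2 := by
  set F := p.M z y + G with hF
  have hy : ∀ x : unitInterval, y x = c + primit F x := fun x => DFunLike.congr_fun h x
  have hd : ∀ x, HasDerivAt (fun x => c + primit F x) (F (pr x)) x := fun x =>
    (hasDerivAt_primit F x).const_add c
  have hFx : ∀ x ∈ Icc (0:ℝ) 1, F (pr x) =
      (q₁ x * (c + primit F x).2 + z * (p.A₁ * (c + primit F x).1) + (G (pr x)).1,
        q₂ x * (c + primit F x).1 + z * (p.A₂ * (c + primit F x).2) + (G (pr x)).2) := by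
    intro x hx
    have e := hy ⟨x, hx⟩
    rw [hF]
    rw [ContinuousMap.add_apply, M_apply, pr_of_mem hx, hq₁, hq₂, ← hF, ← e]
    rfl
  have h0 : primit F 0 = 0 := intervalIntegral.integral_same
  refine ⟨fun x => (c + primit F x).1, fun x => (c + primit F x).2, ⟨fun x hx => ?_, fun x hx => ?_⟩,
    hy, by simp [h0], by simp [h0]⟩
  · have := (hasDerivAt_iff_hasFDerivAt.1 (hd x)).fst.hasDerivAt
    simp only [ContinuousLinearMap.comp_apply] at this
    refine this.congr_deriv ?_
    simp [hFx x hx, ← h₁]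
    ring
  · have := (hasDerivAt_iff_hasFDerivAt.1 (hd x)).snd.hasDerivAt
    simp only [ContinuousLinearMap.comp_apply] at this
    refine this.congr_deriv ?_
    simp [hFx x hx, ← h₂]
    ring

end BVP

theorem solvable_of_continuous {q₁ q₂ : ℝ → ℂ} (h₁ : Continuous q₁) (h₂ : Continuous q₂) (ν : ℂ) :
    Solvable ν 0 q₁ q₂ := by
  intro c₁ c₂
  let p : BVP := ⟨1, 0, 0, 0, ⟨fun x => q₁ x, by fun_prop⟩, ⟨fun x => q₂ x, by fun_prop⟩⟩
  obtain ⟨y₁, y₂, h, -, e₁, e₂⟩ := p.isSol_of_eq (z := ν) (μ₁ := ν) (μ₂ := 0) (one_mul _)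
    (zero_mul _) (q₁ := q₁) (q₂ := q₂) (fun _ => rfl) (fun _ => rfl)
    (y := p.S ν (constop (c₁, c₂))) (G := 0) (c := (c₁, c₂)) (by
      rw [add_zero, add_comm]; exact p.S_eq ν _)
  exact ⟨y₁, y₂, h, e₁, e₂⟩

/-- Leading power behaviour at `0` with a global bound on the unit interval. -/
structure LeadAt (p : ℝ → ℂ) (k : ℕ) (a : ℂ) : Prop where
  bound : ∃ C : ℝ, ∀ x ∈ Icc (0:ℝ) 1, ‖p x‖ ≤ C * x ^ k
  lim : Tendsto (fun x : ℝ => p x / (x:ℂ) ^ k) (𝓝[>] 0) (𝓝 a)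

theorem LeadAt.congr {p p' : ℝ → ℂ} {k : ℕ} {a : ℂ} (h : LeadAt p k a)
    (hp : ∀ x ∈ Icc (0:ℝ) 1, p' x = p x) : LeadAt p' k a := by
  refine ⟨h.bound.imp fun C hC x hx => by rw [hp x hx]; exact hC x hx, h.lim.congr' ?_⟩
  filter_upwards [Ioo_mem_nhdsGT (zero_lt_one (α := ℝ))] with x hx
  rw [hp x (Ioo_subset_Icc_self hx)]

theorem LeadAt.const_mul {p : ℝ → ℂ} {k : ℕ} {a : ℂ} (h : LeadAt p k a) (c : ℂ) :
    LeadAt (fun x => c * p x) k (c * a) := by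
  refine ⟨?_, ?_⟩
  · obtain ⟨C, hC⟩ := h.bound
    refine ⟨‖c‖ * C, fun x hx => ?_⟩
    rw [norm_mul, mul_assoc]
    exact mul_le_mul_of_nonneg_left (hC x hx) (norm_nonneg _)
  · simpa only [mul_div_assoc] using h.lim.const_mul c

section
variable {ω₁ ω₂ α β a : ℂ} {q₁ q₂ : ℝ → ℂ} {k : ℕ}

theorem rayBound_first (hα : α ≠ 0) (hβ : β ≠ 0) (h₁ : 0 < ω₁.re) (h₂ : ω₂.re < 0)
    (hq₁ : Continuous q₁) (hq₂ : Continuous q₂) (ha : a ≠ 0)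
    (hp : LeadAt (fun x => -(α * β) * q₂ (1 - x) - q₁ x) k a)
    (hp' : LeadAt (fun x => -(α * β) * q₂ x - q₁ (1 - x)) k 0) :
    RayBound ω₁ ω₂ α β q₁ q₂ := by
  have hc₁ : Continuous fun x : ℝ => -(α * β) * q₂ (1 - x) := by fun_prop
  have hc₂ : Continuous fun x : ℝ => -q₁ (1 - x) / (α * β) := by fun_prop
  have hαβ : α * β ≠ 0 := mul_ne_zero hα hβ
  have hp₂ : LeadAt (fun x => -q₁ (1 - x) / (α * β) - q₂ x) k 0 := by
    have := hp'.const_mul (α * β)⁻¹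
    rw [mul_zero] at this
    exact this.congr fun x _ => by field_simp; ring
  obtain ⟨C, hC⟩ := hp.bound
  obtain ⟨C₂, hC₂⟩ := hp₂.bound
  have hζ : ω₁ - ω₂ ≠ 0 := fun h => by
    have := congrArg Complex.re h
    simp at this
    linarith
  refine rayBound_of_tendsto (r₁ := fun x => -(α * β) * q₂ (1 - x))
    (r₂ := fun x => -q₁ (1 - x) / (α * β)) hα hβ h₁ h₂ hq₁ hq₂ hc₁ hc₂
    (solvable_of_continuous hq₁ hq₂) (solvable_of_continuous hc₁ hc₂)
    (fun x _ => by simp) (fun x _ => by simp)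
    (l := a * (k.factorial / (ω₁ - ω₂) ^ (k + 1))) (m := k + 1) ?_
    fun Q T V₁ V₂ W₁ W₂ hV hW => hV.tendsto_of_first hW hC hp.lim hC₂ hp₂.lim
  exact mul_ne_zero ha (div_ne_zero (Nat.cast_ne_zero.2 k.factorial_ne_zero) (pow_ne_zero _ hζ))

theorem rayBound_second (hα : α ≠ 0) (hβ : β ≠ 0) (h₁ : 0 < ω₁.re) (h₂ : ω₂.re < 0)
    (hq₁ : Continuous q₁) (hq₂ : Continuous q₂) (ha : a ≠ 0)
    (hp : LeadAt (fun x => -(α * β) * q₂ (1 - x) - q₁ x) (k + 2) 0)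
    (hp' : LeadAt (fun x => -(α * β) * q₂ x - q₁ (1 - x)) k a) (h0 : q₁ 0 ≠ 0) (h1 : q₂ 1 ≠ 0) :
    RayBound ω₁ ω₂ α β q₁ q₂ := by
  have hc₁ : Continuous fun x : ℝ => -(α * β) * q₂ (1 - x) := by fun_prop
  have hc₂ : Continuous fun x : ℝ => -q₁ (1 - x) / (α * β) := by fun_prop
  have hαβ : α * β ≠ 0 := mul_ne_zero hα hβ
  have hp₂ : LeadAt (fun x => -q₁ (1 - x) / (α * β) - q₂ x) k ((α * β)⁻¹ * a) :=
    (hp'.const_mul (α * β)⁻¹).congr fun x _ => by field_simp; ring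
  obtain ⟨C, hC⟩ := hp.bound
  obtain ⟨C₂, hC₂⟩ := hp₂.bound
  have hζ : ω₁ - ω₂ ≠ 0 := fun h => by
    have := congrArg Complex.re h
    simp at this
    linarith
  refine rayBound_of_tendsto (r₁ := fun x => -(α * β) * q₂ (1 - x))
    (r₂ := fun x => -q₁ (1 - x) / (α * β)) hα hβ h₁ h₂ hq₁ hq₂ hc₁ hc₂
    (solvable_of_continuous hq₁ hq₂) (solvable_of_continuous hc₁ hc₂)
    (fun x _ => by simp) (fun x _ => by simp) (m := k + 3) ?_
    fun Q T V₁ V₂ W₁ W₂ hV hW => hV.tendsto_of_second hW hC hp.lim hC₂ hp₂.lim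
  refine neg_ne_zero.2 (mul_ne_zero (mul_ne_zero (mul_ne_zero (inv_ne_zero hαβ) ha)
    (mul_ne_zero (div_ne_zero h0 hζ) (div_ne_zero ?_ hζ)))
    (div_ne_zero (Nat.cast_ne_zero.2 k.factorial_ne_zero) (pow_ne_zero _ hζ)))
  rw [sub_zero]
  exact mul_ne_zero (neg_ne_zero.2 hαβ) h1

end

namespace BVP
variable (p : BVP)

/-- Polynomial bound of the resolvent along the ray through `ω`. -/
def PolyBound (ω : ℂ) : Prop :=
  ∃ (C : ℝ) (m : ℕ) (T : ℝ), 0 < T ∧ 0 ≤ C ∧ ∀ τ ≥ T, ∀ (y G : XC) (c : ℂ × ℂ),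
    y = constop c + Jop (p.M (τ * ω) y + G) → p.U y = 0 → ‖y‖ ≤ C * τ ^ m * ‖G‖

theorem norm_le_of_forall {y : XC} {y₁ y₂ : ℝ → ℂ} (hy : ∀ x : unitInterval, y x = (y₁ x, y₂ x))
    {K : ℝ} (hK : ∀ x ∈ Icc (0:ℝ) 1, ‖y₁ x‖ ≤ K ∧ ‖y₂ x‖ ≤ K) : ‖y‖ ≤ K := by
  refine (ContinuousMap.norm_le _ ((norm_nonneg _).trans (hK 0 (by simp)).1)).2 fun x => ?_
  rw [hy x, Prod.norm_mk]
  exact max_le (hK x x.2).1 (hK x x.2).2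

/-- The combination of the coefficients that controls the characteristic determinant. -/
noncomputable def P (x : ℝ) : ℂ := -(p.α * p.β) * p.q₂ (pr (1 - x)) - p.q₁ (pr x)

variable {p} {ω : ℂ}

theorem polyBound_of_rayBound
    (h : RayBound (p.A₁ * ω) (p.A₂ * ω) p.α p.β (fun x => p.q₁ (pr x)) (fun x => p.q₂ (pr x))) :
    p.PolyBound ω := by
  obtain ⟨C, m, T, hT, hC, h⟩ := h
  refine ⟨C, m, T, hT, hC, fun τ hτ y G c hy hU => ?_⟩
  obtain ⟨y₁, y₂, hs, he, -, -⟩ := p.isSol_of_eq (μ₁ := p.A₁ * ω * τ) (μ₂ := p.A₂ * ω * τ)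
    (by ring) (by ring) (q₁ := fun x => p.q₁ (pr x)) (q₂ := fun x => p.q₂ (pr x))
    (fun x => by rw [pr_of_mem x.2]) (fun x => by rw [pr_of_mem x.2]) hy
  have h0 : y 0 = (y₁ 0, y₂ 0) := he 0
  have h1 : y 1 = (y₁ 1, y₂ 1) := he 1
  rw [U_apply, h0, h1] at hU
  exact norm_le_of_forall he (h τ hτ _ _ y₁ y₂ ‖G‖ hs
    (fun x _ => (norm_fst_le _).trans (G.norm_coe_le_norm _))
    (fun x _ => (norm_snd_le _).trans (G.norm_coe_le_norm _))
    (congrArg Prod.fst hU) (congrArg Prod.snd hU))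

theorem polyBound_of_rayBound_swap (hα : p.α ≠ 0) (hβ : p.β ≠ 0)
    (h : RayBound (p.A₂ * ω) (p.A₁ * ω) p.β⁻¹ p.α⁻¹
      (fun x => p.q₂ (pr x)) (fun x => p.q₁ (pr x))) :
    p.PolyBound ω := by
  obtain ⟨C, m, T, hT, hC, h⟩ := h
  refine ⟨C, m, T, hT, hC, fun τ hτ y G c hy hU => ?_⟩
  obtain ⟨y₁, y₂, hs, he, -, -⟩ := p.isSol_of_eq (μ₁ := p.A₁ * ω * τ) (μ₂ := p.A₂ * ω * τ)
    (by ring) (by ring) (q₁ := fun x => p.q₁ (pr x)) (q₂ := fun x => p.q₂ (pr x))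
    (fun x => by rw [pr_of_mem x.2]) (fun x => by rw [pr_of_mem x.2]) hy
  have h0 : y 0 = (y₁ 0, y₂ 0) := he 0
  have h1 : y 1 = (y₁ 1, y₂ 1) := he 1
  rw [U_apply, h0, h1] at hU
  have u1 : y₁ 0 + p.β * y₂ 1 = 0 := congrArg Prod.fst hU
  have u2 : p.α * y₂ 0 + y₁ 1 = 0 := congrArg Prod.snd hU
  refine norm_le_of_forall he fun x hx => (h τ hτ _ _ y₂ y₁ ‖G‖ ⟨hs.d₂, hs.d₁⟩
    (fun x _ => (norm_snd_le _).trans (G.norm_coe_le_norm _))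
    (fun x _ => (norm_fst_le _).trans (G.norm_coe_le_norm _)) ?_ ?_ x hx).symm
  · field_simp
    linear_combination u2
  · field_simp
    linear_combination u1

theorem polyBound_first (hα : p.α ≠ 0) (hβ : p.β ≠ 0) (h₁ : 0 < (p.A₁ * ω).re)
    (h₂ : (p.A₂ * ω).re < 0) {a : ℂ} (ha : a ≠ 0) {k : ℕ} (hp : LeadAt p.P k a)
    (hp' : LeadAt (fun x => p.P (1 - x)) k 0) : p.PolyBound ω := by
  have c₁ : Continuous fun x => p.q₁ (pr x) := p.q₁.continuous.comp continuous_pr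
  have c₂ : Continuous fun x => p.q₂ (pr x) := p.q₂.continuous.comp continuous_pr
  refine polyBound_of_rayBound (rayBound_first hα hβ h₁ h₂ c₁ c₂ ha hp
    (hp'.congr fun x _ => by simp [P]))

theorem polyBound_second (hα : p.α ≠ 0) (hβ : p.β ≠ 0) (h₁ : (p.A₁ * ω).re < 0)
    (h₂ : 0 < (p.A₂ * ω).re) {a : ℂ} (ha : a ≠ 0) {k : ℕ} (hp : LeadAt p.P k a)
    (hp' : LeadAt (fun x => p.P (1 - x)) (k + 2) 0) (h0 : p.q₂ 0 ≠ 0) (h1 : p.q₁ 1 ≠ 0) :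
    p.PolyBound ω := by
  have c₁ : Continuous fun x => p.q₁ (pr x) := p.q₁.continuous.comp continuous_pr
  have c₂ : Continuous fun x => p.q₂ (pr x) := p.q₂.continuous.comp continuous_pr
  have e0 : pr 0 = 0 := pr_of_mem (by simp)
  have e1 : pr 1 = 1 := pr_of_mem (by simp)
  have hαβ := mul_ne_zero hα hβ
  refine polyBound_of_rayBound_swap hα hβ (rayBound_second (inv_ne_zero hβ) (inv_ne_zero hα)
    h₂ h₁ c₂ c₁ (a := (p.α * p.β)⁻¹ * a) (mul_ne_zero (inv_ne_zero hαβ) ha) (k := k) ?_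
    ((hp.const_mul (p.α * p.β)⁻¹).congr fun x _ => ?_) ?_ ?_)
  · have := hp'.const_mul (p.α * p.β)⁻¹
    rw [mul_zero] at this
    refine this.congr fun x _ => ?_
    simp only [P, sub_sub_cancel]
    field_simp
    ring
  · simp only [P]
    field_simp
    ring
  · simpa only [e0] using h0
  · simpa only [e1] using h1

end BVP

namespace BVP
variable (p : BVP)

/-- Chains of root functions in integrated form. -/
structure IsRootChain (z : ℂ) (m : ℕ) (v : ℕ → XC) : Prop where
  bc : ∀ j ≤ m, p.U (v j) = 0
  ne : v 0 ≠ 0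
  zero : ∃ c, v 0 = constop c + Jop (p.M z (v 0))
  succ : ∀ j < m, ∃ c, v (j + 1) = constop c + Jop (p.M z (v (j + 1)) + Bop p.A₁ p.A₂ (v j))

theorem N_Jop_eq (z : ℂ) (G : XC) : p.N z (Jop G) =
    constop (p.N z (Jop G) 0) + Jop (p.M z (p.N z (Jop G))) + p.D z • Jop G := by
  obtain ⟨c, hc⟩ := p.N_eq z (Jop G)
  have h0 : ∀ y : XC, Jop y 0 = 0 := fun y => intervalIntegral.integral_same
  have : p.N z (Jop G) 0 = c := by
    conv_lhs => rw [hc]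
    simp [h0, constop_apply]
  rw [this]
  exact hc

/-- Taylor coefficients of the numerator of the resolvent. -/
noncomputable def coeffN (G : XC) (c : ℂ) (j : ℕ) : XC :=
  iterDslope (fun z => p.N z (Jop G)) c j c

theorem differentiable_N_apply (f : XC) : Differentiable ℂ fun z => p.N z f := by
  have := p.differentiable_N
  fun_prop

theorem U_coeffN (G : XC) (c : ℂ) (j : ℕ) : p.U (p.coeffN G c j) = 0 :=
  map_iterDslope_eq_zero (p.differentiable_N_apply _) p.U (fun z => p.U_N z _) c j c

theorem coeffN_eq (G : XC) (c : ℂ) (j : ℕ) (hj : iterDslope p.D c j c = 0) :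
    p.coeffN G c j - constop (p.coeffN G c j 0) - Jop (p.M c (p.coeffN G c j)) =
      -chainRem (-(Jop.comp (Bop p.A₁ p.A₂))) (fun z => p.N z (Jop G)) c j := by
  have key : ∀ z (f : XC), f - constop (f 0) - Jop (p.M z f) =
      (ContinuousLinearMap.id ℂ XC - constop.comp (ContinuousMap.evalCLM ℂ (0 : unitInterval)) -
        Jop.comp (Qop p.q₁ p.q₂)) f + z • (-(Jop.comp (Bop p.A₁ p.A₂))) f := by
    intro z f
    change _ = (f - constop (f 0) - Jop (Qop p.q₁ p.q₂ f)) + z • (-(Jop (Bop p.A₁ p.A₂ f)))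
    change f - constop (f 0) - Jop (Qop p.q₁ p.q₂ f + z • Bop p.A₁ p.A₂ f) = _
    rw [map_add, map_smul]
    module
  have := pencil_iterDslope (f := fun z => p.N z (Jop G)) (p.differentiable_N_apply _)
    p.differentiable_D (ContinuousLinearMap.id ℂ XC -
      constop.comp (ContinuousMap.evalCLM ℂ (0 : unitInterval)) - Jop.comp (Qop p.q₁ p.q₂))
    (-(Jop.comp (Bop p.A₁ p.A₂))) (Jop G) (fun z => by
      rw [← key, sub_sub, sub_eq_iff_eq_add']
      exact p.N_Jop_eq z G) c j c
  have e0 : (0 : ℂ) • Jop G = 0 := by ext x <;> simp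
  rw [← key, hj, e0, zero_sub] at this
  exact this

theorem coeffN_zero_eq (G : XC) (c : ℂ) (hj : p.D c = 0) :
    p.coeffN G c 0 = constop (p.coeffN G c 0 0) + Jop (p.M c (p.coeffN G c 0)) := by
  have := p.coeffN_eq G c 0 hj
  rw [chainRem, neg_zero, sub_sub, sub_eq_zero] at this
  exact this

theorem coeffN_succ_eq (G : XC) (c : ℂ) (j : ℕ) (hj : iterDslope p.D c (j + 1) c = 0) :
    p.coeffN G c (j + 1) = constop (p.coeffN G c (j + 1) 0) +
      Jop (p.M c (p.coeffN G c (j + 1)) + Bop p.A₁ p.A₂ (p.coeffN G c j)) := by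
  have := p.coeffN_eq G c (j + 1) hj
  have e : chainRem (-(Jop.comp (Bop p.A₁ p.A₂))) (fun z => p.N z (Jop G)) c (j + 1) =
    -(Jop (Bop p.A₁ p.A₂ (p.coeffN G c j))) := rfl
  rw [e, neg_neg, sub_sub, sub_eq_iff_eq_add'] at this
  rwa [map_add, ← add_assoc]

theorem map_coeffN_eq_zero {φ : XC →L[ℂ] ℂ}
    (hφ : ∀ z m v, p.IsRootChain z m v → φ (v m) = 0) (G : XC) (c : ℂ) (j : ℕ)
    (hj : ∀ i ≤ j, iterDslope p.D c i c = 0) : φ (p.coeffN G c j) = 0 := by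
  classical
  by_cases h : p.coeffN G c j = 0
  · rw [h, map_zero]
  have hex : ∃ i, p.coeffN G c i ≠ 0 := ⟨j, h⟩
  set l := Nat.find hex with hl
  have hlj : l ≤ j := Nat.find_min' hex h
  have := hφ c (j - l) (fun i => p.coeffN G c (l + i)) ⟨fun i _ => p.U_coeffN G c _,
    Nat.find_spec hex, ?_, fun i hi => ⟨_, p.coeffN_succ_eq G c (l + i) (hj _ (by omega))⟩⟩
  · simpa only [Nat.add_sub_cancel' hlj] using this
  · rcases Nat.eq_zero_or_pos l with h0 | h0
    · rw [h0]
      exact ⟨_, p.coeffN_zero_eq G c (hj 0 (Nat.zero_le _))⟩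
    · obtain ⟨k, hk⟩ := Nat.exists_eq_succ_of_ne_zero h0.ne'
      have hz : p.coeffN G c k = 0 := by
        by_contra hne
        exact Nat.find_min hex (m := k) (by omega) hne
      have := p.coeffN_succ_eq G c k (hj _ (by omega))
      have e1 : Bop p.A₁ p.A₂ (p.coeffN G c k) = 0 := by
        rw [hz]
        exact (Bop p.A₁ p.A₂).map_zero
      rw [e1, add_zero] at this
      exact ⟨p.coeffN G c (k + 1) 0, by rw [add_zero, hk]; exact this⟩

theorem exists_resolvent_functional {φ : XC →L[ℂ] ℂ}
    (hφ : ∀ z m v, p.IsRootChain z m v → φ (v m) = 0) (hne : ∃ z, p.D z ≠ 0) (G : XC) :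
    ∃ H : ℂ → ℂ, Differentiable ℂ H ∧ ∀ z, H z * p.D z = φ (p.N z (Jop G)) :=
  exists_entire_quotient (p.differentiable_N_apply _) φ p.differentiable_D hne
    fun c j h => p.map_coeffN_eq_zero hφ G c j h

end BVP

/-- Bounds of exponential type. -/
def ExpBdd {F : Type*} [NormedAddCommGroup F] (f : ℂ → F) : Prop :=
  ∃ C a : ℝ, 0 ≤ C ∧ 0 ≤ a ∧ ∀ z, ‖f z‖ ≤ C * Real.exp (a * ‖z‖)

section
variable {F : Type*} [NormedAddCommGroup F]

theorem ExpBdd.sub {f g : ℂ → F} (hf : ExpBdd f) (hg : ExpBdd g) : ExpBdd fun z => f z - g z := by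
  obtain ⟨C, a, hC, ha, h⟩ := hf
  obtain ⟨C', a', hC', ha', h'⟩ := hg
  refine ⟨C + C', a + a', by positivity, by positivity, fun z => (norm_sub_le _ _).trans ?_⟩
  have h1 : C * Real.exp (a * ‖z‖) ≤ C * Real.exp ((a + a') * ‖z‖) := by
    gcongr; linarith
  have h2 : C' * Real.exp (a' * ‖z‖) ≤ C' * Real.exp ((a + a') * ‖z‖) := by
    gcongr; linarith
  rw [add_mul]
  linarith [h z, h' z]

theorem ExpBdd.of_norm_le_mul {G H : Type*} [NormedAddCommGroup G] [NormedAddCommGroup H]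
    {f : ℂ → F} {g : ℂ → G} {h : ℂ → H} (hf : ExpBdd f) (hg : ExpBdd g)
    {K : ℝ} (hK : 0 ≤ K) (hh : ∀ z, ‖h z‖ ≤ K * (‖f z‖ * ‖g z‖)) : ExpBdd h := by
  obtain ⟨C, a, hC, ha, h1⟩ := hf
  obtain ⟨C', a', hC', ha', h2⟩ := hg
  refine ⟨K * (C * C'), a + a', by positivity, by positivity, fun z => (hh z).trans ?_⟩
  rw [add_mul, Real.exp_add, mul_assoc]
  refine mul_le_mul_of_nonneg_left ?_ hK
  calc _ ≤ (C * Real.exp (a * ‖z‖)) * (C' * Real.exp (a' * ‖z‖)) :=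
        mul_le_mul (h1 z) (h2 z) (norm_nonneg _) (by positivity)
    _ = _ := by ring

theorem ExpBdd.of_norm_le {G : Type*} [NormedAddCommGroup G] {f : ℂ → F} {g : ℂ → G}
    (hf : ExpBdd f) {K : ℝ} (hK : 0 ≤ K) (h : ∀ z, ‖g z‖ ≤ K * ‖f z‖) : ExpBdd g := by
  obtain ⟨C, a, hC, ha, h1⟩ := hf
  refine ⟨K * C, a, by positivity, ha, fun z => (h z).trans ?_⟩
  rw [mul_assoc]
  exact mul_le_mul_of_nonneg_left (h1 z) hK

end

theorem inv_smul_eq_of_eq {V : Type*} [AddCommGroup V] [Module ℂ V] {d : ℂ} (hd : d ≠ 0)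
    {y a b w : V} (h : y = a + b + d • w) : d⁻¹ • y = d⁻¹ • a + (d⁻¹ • b + w) := by
  rw [h, smul_add, smul_add, inv_smul_smul₀ hd, add_assoc]

namespace BVP
variable (p : BVP)

theorem expBdd_S : ExpBdd p.S := by
  refine ⟨Real.exp p.cQ, p.cB, (Real.exp_pos _).le, p.cB_nonneg, fun z => ?_⟩
  rw [← Real.exp_add]
  exact p.norm_S_le z

theorem expBdd_S_apply {f : ℂ → XC} (hf : ExpBdd f) : ExpBdd fun z => p.S z (f z) :=
  p.expBdd_S.of_norm_le_mul hf zero_le_one fun z => by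
    rw [one_mul]; exact (p.S z).le_opNorm _

theorem _root_.ExpBdd.clm {E F : Type*} [NormedAddCommGroup E] [NormedSpace ℂ E]
    [NormedAddCommGroup F] [NormedSpace ℂ F] {f : ℂ → E} (hf : ExpBdd f) (T : E →L[ℂ] F) :
    ExpBdd fun z => T (f z) :=
  hf.of_norm_le (norm_nonneg T) fun _ => T.le_opNorm _

theorem _root_.ExpBdd.const {F : Type*} [NormedAddCommGroup F] (c : F) :
    ExpBdd fun _ => c :=
  ⟨‖c‖, 0, norm_nonneg _, le_rfl, fun z => by simp⟩

theorem _root_.ExpBdd.mul {f g : ℂ → ℂ} (hf : ExpBdd f) (hg : ExpBdd g) :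
    ExpBdd fun z => f z * g z :=
  hf.of_norm_le_mul hg zero_le_one fun z => by simp

theorem expBdd_bv (c : ℂ × ℂ) : ExpBdd fun z => p.bv z c :=
  (p.expBdd_S_apply (ExpBdd.const _)).clm p.U

theorem _root_.ExpBdd.fst {f : ℂ → ℂ × ℂ} (hf : ExpBdd f) : ExpBdd fun z => (f z).1 :=
  hf.of_norm_le zero_le_one fun z => by rw [one_mul]; exact norm_fst_le _

theorem _root_.ExpBdd.snd {f : ℂ → ℂ × ℂ} (hf : ExpBdd f) : ExpBdd fun z => (f z).2 :=
  hf.of_norm_le zero_le_one fun z => by rw [one_mul]; exact norm_snd_le _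

theorem expBdd_D : ExpBdd p.D :=
  ((p.expBdd_bv _).fst.mul (p.expBdd_bv _).snd).sub ((p.expBdd_bv _).fst.mul (p.expBdd_bv _).snd)

theorem expBdd_N (f : XC) : ExpBdd fun z => p.N z f := by
  have hS : ExpBdd fun z => p.S z f := p.expBdd_S_apply (ExpBdd.const f)
  have hU := hS.clm p.U
  have h1 := p.expBdd_bv (1, 0)
  have h2 := p.expBdd_bv (0, 1)
  have hadj1 := (h2.snd.mul hU.fst).sub (h2.fst.mul hU.snd)
  have hadj2 := (h1.fst.mul hU.snd).sub (h1.snd.mul hU.fst)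
  have hc := (hadj1.clm (constop.comp (ContinuousLinearMap.inl ℂ ℂ ℂ))).sub
    (hadj2.clm (-(constop.comp (ContinuousLinearMap.inr ℂ ℂ ℂ))))
  have hDS : ExpBdd fun z => p.D z • p.S z f :=
    p.expBdd_D.of_norm_le_mul hS zero_le_one fun _ => by rw [norm_smul, one_mul]
  have hN := hDS.sub (p.expBdd_S_apply hc)
  convert hN using 2 with z
  rw [N_apply, adj_apply]
  congr 2
  ext x <;> simp [constop_apply, neg_add_eq_sub]

variable {p} {ω : ℂ}

theorem PolyBound.D_ne_zero (h : p.PolyBound ω) : ∃ T : ℝ, ∀ τ ≥ T, p.D (τ * ω) ≠ 0 := by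
  obtain ⟨C, m, T, hT, hC, h⟩ := h
  refine ⟨T, fun τ hτ hD => ?_⟩
  obtain ⟨c, hc, hb⟩ := p.exists_of_D_eq_zero hD
  have e := p.S_eq (τ * ω) (constop c)
  have := h τ hτ (p.S (τ * ω) (constop c)) 0 c (by rw [add_zero, add_comm]; exact e) hb
  rw [norm_zero, mul_zero] at this
  have hz := norm_le_zero_iff.1 this
  rw [hz] at e
  have e1 : p.M (τ * ω) 0 = 0 := (p.M (τ * ω)).map_zero
  have e2 : Jop 0 = 0 := Jop.map_zero
  rw [e1, e2, zero_add] at e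
  exact hc (DFunLike.congr_fun e (0 : unitInterval)).symm

theorem PolyBound.norm_le (h : p.PolyBound ω) (φ : XC →L[ℂ] ℂ) :
    ∃ (C : ℝ) (m : ℕ) (T : ℝ), 0 < T ∧ 0 ≤ C ∧ ∀ τ ≥ T, ∀ (G : XC) (H : ℂ → ℂ),
      (∀ z, H z * p.D z = φ (p.N z (Jop G))) → ‖H (τ * ω)‖ ≤ C * τ ^ m * ‖G‖ := by
  obtain ⟨T', hD⟩ := h.D_ne_zero
  obtain ⟨C, m, T, hT, hC, h⟩ := h
  refine ⟨‖φ‖ * C, m, max T T', hT.trans_le (le_max_left _ _), by positivity,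
    fun τ hτ G H hH => ?_⟩
  have hDτ := hD τ ((le_max_right _ _).trans hτ)
  set z : ℂ := τ * ω with hz
  have e := p.N_Jop_eq z G
  have hy : (p.D z)⁻¹ • p.N z (Jop G) = constop ((p.D z)⁻¹ • p.N z (Jop G) 0) +
      Jop (p.M z ((p.D z)⁻¹ • p.N z (Jop G)) + G) := by
    rw [map_add, map_smul, map_smul, map_smul]
    exact inv_smul_eq_of_eq hDτ e
  have := h τ ((le_max_left _ _).trans hτ) _ G _ hy (by rw [map_smul, p.U_N, smul_zero])
  have e3 : H z = φ ((p.D z)⁻¹ • p.N z (Jop G)) := by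
    rw [map_smul, ← hH z, smul_eq_mul]
    field_simp
  rw [e3]
  calc _ ≤ ‖φ‖ * ‖(p.D z)⁻¹ • p.N z (Jop G)‖ := φ.le_opNorm _
    _ ≤ ‖φ‖ * (C * τ ^ m * ‖G‖) := by gcongr
    _ = _ := by ring

end BVP

end

section
open Complex Set Filter Topology MeasureTheory Metric

section laurent

/-- Cauchy integrals computing Taylor coefficients, up to a constant factor. -/
noncomputable def cauchyCoeff (c : ℂ) (r : ℝ) (j : ℕ) (f : ℂ → ℂ) : ℂ :=
  ∮ z in C(c, r), ((z - c) ^ (j + 1))⁻¹ * f z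

variable {c : ℂ} {r : ℝ} {f g : ℂ → ℂ}

theorem continuousOn_inv_pow (hr : 0 < r) (j : ℕ) :
    ContinuousOn (fun z => ((z - c) ^ j)⁻¹) (sphere c r) := by
  refine ContinuousOn.inv₀ (by fun_prop) fun z hz => pow_ne_zero _ (sub_ne_zero.2 ?_)
  exact ne_of_mem_sphere hz hr.ne'

theorem cauchyCoeff_congr (hr : 0 < r) (j : ℕ) (h : ∀ z ∈ sphere c r, f z = g z) :
    cauchyCoeff c r j f = cauchyCoeff c r j g :=
  circleIntegral.integral_congr hr.le fun z hz => by simp only [h z hz]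

theorem cauchyCoeff_sub (hr : 0 < r) (hf : ContinuousOn f (sphere c r))
    (hg : ContinuousOn g (sphere c r)) (j : ℕ) :
    cauchyCoeff c r j (fun z => f z - g z) = cauchyCoeff c r j f - cauchyCoeff c r j g := by
  have h := continuousOn_inv_pow (c := c) hr (j + 1)
  have h1 : ContinuousOn (fun z => ((z - c) ^ (j + 1))⁻¹ * f z) (sphere c r) := h.mul hf
  have h2 : ContinuousOn (fun z => ((z - c) ^ (j + 1))⁻¹ * g z) (sphere c r) := h.mul hg
  unfold cauchyCoeff
  rw [← circleIntegral.integral_sub (h1.circleIntegrable hr.le) (h2.circleIntegrable hr.le)]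
  simp only [mul_sub]

theorem cauchyCoeff_succ (hr : 0 < r) (hf : ContinuousOn f (sphere c r)) (a : ℂ)
    (hg : ∀ z ∈ sphere c r, g z = (z - c) * f z + a) (j : ℕ) :
    cauchyCoeff c r (j + 1) g = cauchyCoeff c r j f := by
  have h1 := continuousOn_inv_pow (c := c) hr (j + 1)
  have h2 := continuousOn_inv_pow (c := c) hr (j + 2)
  have e : cauchyCoeff c r (j + 1) g =
      ∮ z in C(c, r), (((z - c) ^ (j + 1))⁻¹ * f z + a * ((z - c) ^ (j + 2))⁻¹) := by
    refine circleIntegral.integral_congr hr.le fun z hz => ?_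
    have hz0 : z - c ≠ 0 := sub_ne_zero.2 (ne_of_mem_sphere hz hr.ne')
    rw [hg z hz]
    field_simp
    ring
  have e2 : (∮ z in C(c, r), ((z - c) ^ (j + 2))⁻¹) = 0 := by
    rw [← circleIntegral.integral_sub_zpow_of_ne (n := -((j + 2 : ℕ) : ℤ)) (by omega) c c r]
    refine circleIntegral.integral_congr hr.le fun z _ => ?_
    simp only [zpow_neg, zpow_natCast]
  have h3 : ContinuousOn (fun z => ((z - c) ^ (j + 1))⁻¹ * f z) (sphere c r) := h1.mul hf
  have h4 : ContinuousOn (fun z => a * ((z - c) ^ (j + 2))⁻¹) (sphere c r) :=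
    continuousOn_const.mul h2
  rw [e, circleIntegral.integral_add (h3.circleIntegrable hr.le) (h4.circleIntegrable hr.le), circleIntegral.integral_const_mul, e2,
    mul_zero, add_zero, cauchyCoeff]

theorem cauchyCoeff_zero (hr : 0 < r) (hf : DiffContOnCl ℂ f (ball c r)) (a : ℂ)
    (hg : ∀ z ∈ sphere c r, g z = (z - c) * f z + a) :
    cauchyCoeff c r 0 g = 2 * Real.pi * I * a := by
  have hfs : ContinuousOn f (sphere c r) := hf.continuousOn_ball.mono sphere_subset_closedBall
  have h1 := continuousOn_inv_pow (c := c) hr 1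
  simp only [pow_one] at h1
  have e : cauchyCoeff c r 0 g = ∮ z in C(c, r), (f z + a * (z - c)⁻¹) := by
    refine circleIntegral.integral_congr hr.le fun z hz => ?_
    have hz0 : z - c ≠ 0 := sub_ne_zero.2 (ne_of_mem_sphere hz hr.ne')
    rw [hg z hz]
    field_simp
    ring
  have h4 : ContinuousOn (fun z => a * (z - c)⁻¹) (sphere c r) := continuousOn_const.mul h1
  rw [e, circleIntegral.integral_add (hfs.circleIntegrable hr.le) (h4.circleIntegrable hr.le), circleIntegral.integral_const_mul,
    circleIntegral.integral_sub_center_inv _ hr.ne', hf.circleIntegral_eq_zero hr.le]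
  ring

theorem norm_cauchyCoeff_le (hr : 0 < r) (j : ℕ) {K : ℝ} (h : ∀ z ∈ sphere c r, ‖f z‖ ≤ K) :
    ‖cauchyCoeff c r j f‖ ≤ 2 * Real.pi * r * ((r ^ (j + 1))⁻¹ * K) := by
  refine circleIntegral.norm_integral_le_of_norm_le_const hr.le fun z hz => ?_
  rw [norm_mul, norm_inv, norm_pow, mem_sphere_iff_norm.1 hz]
  exact mul_le_mul_of_nonneg_left (h z hz) (by positivity)

theorem cauchyCoeff_eq_zero (hr : 0 < r) (hf : Differentiable ℂ f) {K : ℝ} {d : ℕ}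
    (h : ∀ z, ‖f z‖ ≤ K * (1 + ‖z‖) ^ d) {j : ℕ} (hj : d < j) : cauchyCoeff c r j f = 0 := by
  have hK : 0 ≤ K := by
    have := (norm_nonneg _).trans (h 0)
    simpa using this
  have hR : ∀ R, r ≤ R → cauchyCoeff c r j f = cauchyCoeff c R j f := by
    intro R hrR
    have key := circleIntegral_sub_center_inv_smul_eq_of_differentiable_on_annulus_off_countable
      (c := c) hr hrR (f := fun z => ((z - c) ^ j)⁻¹ * f z) countable_empty ?_ ?_
    · have e : ∀ ρ, (∮ z in C(c, ρ), (z - c)⁻¹ • (((z - c) ^ j)⁻¹ * f z)) = cauchyCoeff c ρ j f := by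
        intro ρ
        unfold cauchyCoeff
        congr 1
        ext z
        rw [smul_eq_mul, ← mul_assoc, ← mul_inv, pow_succ' (z - c) j]
      rw [← e, ← e, key]
    · refine ContinuousOn.mul (ContinuousOn.inv₀ (by fun_prop) fun z hz => pow_ne_zero _ ?_)
        hf.continuous.continuousOn
      intro h0
      exact hz.2 (by simpa [sub_eq_zero.1 h0] using hr)
    · intro z hz
      have : z - c ≠ 0 := by
        intro h0
        exact hz.1.2 (by simpa [sub_eq_zero.1 h0] using hr.le)
      have h1 : DifferentiableAt ℂ (fun z => (z - c) ^ j) z := by fun_prop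
      exact (h1.inv (pow_ne_zero _ this)).mul (hf z)
  have hb : ∀ R, r ≤ R → 1 + ‖c‖ ≤ R → ‖cauchyCoeff c r j f‖ ≤ 2 * Real.pi * (K * 2 ^ d) / R := by
    intro R h1 h2
    have hR0 : 0 < R := hr.trans_le h1
    have hR1 : 1 ≤ R := by linarith [norm_nonneg c]
    rw [hR R h1]
    refine (norm_cauchyCoeff_le hR0 j (K := K * (2 * R) ^ d) fun z hz => (h z).trans ?_).trans ?_
    · have : ‖z‖ ≤ ‖c‖ + R := by
        calc ‖z‖ = ‖c + (z - c)‖ := by ring_nf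
          _ ≤ _ := (norm_add_le _ _).trans (by rw [mem_sphere_iff_norm.1 hz])
      gcongr
      linarith
    · obtain ⟨k, rfl⟩ : ∃ k, j = d + 1 + k := ⟨j - (d + 1), by omega⟩
      have : 2 * Real.pi * R * ((R ^ (d + 1 + k + 1))⁻¹ * (K * (2 * R) ^ d)) =
          2 * Real.pi * (K * 2 ^ d) / R * (R ^ k)⁻¹ := by
        rw [mul_pow]
        field_simp
        ring
      rw [this]
      refine mul_le_of_le_one_right (by positivity) (inv_le_one_of_one_le₀ (one_le_pow₀ hR1))
  have hlim : Tendsto (fun R : ℝ => 2 * Real.pi * (K * 2 ^ d) / R) atTop (𝓝 0) :=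
    tendsto_const_nhds.div_atTop tendsto_id
  have : ‖cauchyCoeff c r j f‖ ≤ 0 := by
    refine ge_of_tendsto hlim ?_
    filter_upwards [eventually_ge_atTop r, eventually_ge_atTop (1 + ‖c‖)] with R h1 h2 using hb R h1 h2
  exact norm_le_zero_iff.1 this

end laurent

namespace BVP
variable {p : BVP} {ω : ℂ}

theorem exists_degree (hω : ‖ω‖ = 1) (hray : ∀ k : ℕ, p.PolyBound (ω * I ^ k))
    (φ : XC →L[ℂ] ℂ) : ∃ d : ℕ, ∀ (G : XC) (H : ℂ → ℂ), Differentiable ℂ H →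
      (∀ z, H z * p.D z = φ (p.N z (Jop G))) → ∃ K, ∀ z, ‖H z‖ ≤ K * (1 + ‖z‖) ^ d := by
  choose C m T hT hC h using fun k => (hray k).norm_le φ
  refine ⟨∑ k ∈ Finset.range 4, m k, fun G H hH hHD => ?_⟩
  set d := ∑ k ∈ Finset.range 4, m k with hd
  obtain ⟨CD, a, -, ha, hDb⟩ := p.expBdd_D
  obtain ⟨CF, b, -, hb, hFb⟩ := (p.expBdd_N (Jop G)).clm φ
  obtain ⟨τ, hτ⟩ := (hray 0).D_ne_zero
  obtain ⟨C', B, -, hB⟩ := exists_exp_bound_of_mul hH p.differentiable_D hHD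
    ⟨_, hτ τ le_rfl⟩ ha hb hDb hFb
  set T' := 1 + ∑ k ∈ Finset.range 4, T k with hT'
  obtain ⟨K₀, hK₀⟩ := (isCompact_closedBall (0:ℂ) T').exists_bound_of_continuousOn
    hH.continuous.continuousOn
  set C'' := ∑ k ∈ Finset.range 4, C k with hC''
  have hC0 : 0 ≤ C'' := Finset.sum_nonneg fun k _ => hC k
  have hT0 : 1 ≤ T' := le_add_of_nonneg_right (Finset.sum_nonneg fun k _ => (hT k).le)
  have hK₀0 : 0 ≤ K₀ := (norm_nonneg _).trans (hK₀ 0 (by simp; linarith))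
  refine ⟨_, norm_le_of_four_rays hH d hB hω (K := C'' * ‖G‖ + K₀) fun k x hx => ?_⟩
  rcases le_total T' x with hx' | hx'
  · have hl : k % 4 ∈ Finset.range 4 := Finset.mem_range.2 (Nat.mod_lt _ (by norm_num))
    have h1 : T (k % 4) ≤ x := by
      have := Finset.single_le_sum (f := T) (fun i _ => (hT i).le) hl
      linarith
    have h2 : C (k % 4) ≤ C'' := Finset.single_le_sum (f := C) (fun i _ => hC i) hl
    have h3 : m (k % 4) ≤ d := Finset.single_le_sum (f := m) (fun i _ => Nat.zero_le _) hl
    rw [I_pow_eq_pow_mod k]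
    refine (h (k % 4) x h1 G H hHD).trans ?_
    have h4 : x ^ m (k % 4) ≤ (1 + x) ^ d :=
      (pow_le_pow_left₀ hx (by linarith) _).trans (pow_le_pow_right₀ (by linarith) h3)
    calc _ ≤ C'' * (1 + x) ^ d * ‖G‖ := by gcongr
      _ ≤ (C'' * ‖G‖ + K₀) * (1 + x) ^ d := by
        have : 0 ≤ K₀ * (1 + x) ^ d := by positivity
        linarith
  · have hn : ‖(x:ℂ) * (ω * I ^ k)‖ ≤ T' := by
      simpa [hω, abs_of_nonneg hx] using hx'
    have h1 := hK₀ ((x:ℂ) * (ω * I ^ k)) (mem_closedBall_zero_iff.2 hn)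
    have h2 : 1 ≤ (1 + x) ^ d := one_le_pow₀ (by linarith)
    have h3 : 0 ≤ C'' * ‖G‖ := by positivity
    calc _ ≤ K₀ := h1
      _ ≤ (C'' * ‖G‖ + K₀) * 1 := by linarith
      _ ≤ _ := mul_le_mul_of_nonneg_left h2 (by positivity)

end BVP

namespace BVP
variable (p : BVP)

theorem N_Jop_of_boundary {z : ℂ} (hD : p.D z ≠ 0) {k : XC} (hk : Jop k 1 = 0) :
    p.N z (Jop (k - p.M z (Jop k))) = p.D z • Jop k := by
  have h0 : Jop k 0 = 0 := intervalIntegral.integral_same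
  have hU : p.U (Jop k) = 0 := by
    rw [U_apply, h0, hk]
    simp
  have e := p.N_Jop_eq z (k - p.M z (Jop k))
  set y := p.N z (Jop (k - p.M z (Jop k))) with hy
  rw [← sub_eq_zero]
  refine p.eq_zero_of_D_ne_zero hD (c := y 0) ?_ ?_
  · rw [map_sub, map_smul, hU, p.U_N, smul_zero, sub_zero]
  · rw [map_sub, map_sub, map_smul, map_smul]
    rw [map_sub, smul_sub] at e
    conv_lhs => rw [e]
    abel

/-- The resolvent, tested against a functional. -/
noncomputable def resFun (φ : XC →L[ℂ] ℂ) (G : XC) (z : ℂ) : ℂ := φ (p.N z (Jop G)) / p.D z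

variable {p} (φ : XC →L[ℂ] ℂ)

theorem resFun_sub (G G' : XC) (z : ℂ) :
    p.resFun φ (G - G') z = p.resFun φ G z - p.resFun φ G' z := by
  simp only [resFun, map_sub, sub_div]

theorem resFun_boundary (c : ℂ) {z : ℂ} (hD : p.D z ≠ 0) {k : XC} (hk : Jop k 1 = 0) :
    p.resFun φ (k - p.M c (Jop k)) z =
      (z - c) * p.resFun φ (Bop p.A₁ p.A₂ (Jop k)) z + φ (Jop k) := by
  have e : k - p.M z (Jop k) = (k - p.M c (Jop k)) - (z - c) • Bop p.A₁ p.A₂ (Jop k) := by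
    change k - (Qop p.q₁ p.q₂ (Jop k) + z • Bop p.A₁ p.A₂ (Jop k)) =
      (k - (Qop p.q₁ p.q₂ (Jop k) + c • Bop p.A₁ p.A₂ (Jop k))) - (z - c) • Bop p.A₁ p.A₂ (Jop k)
    module
  have h := congrArg φ (p.N_Jop_of_boundary hD hk)
  rw [e] at h
  simp only [map_sub, map_smul, smul_eq_mul] at h
  rw [resFun, resFun]
  simp only [map_sub]
  field_simp
  linear_combination h

theorem map_Jop_eq_zero {ω : ℂ} (hω : ‖ω‖ = 1) (hray : ∀ k : ℕ, p.PolyBound (ω * I ^ k))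
    (hφ : ∀ z m v, p.IsRootChain z m v → φ (v m) = 0) {s : XC → ℝ} (hs : ∀ G, ‖Jop G‖ ≤ s G)
    (hd : ∀ G, ∀ ε > 0, ∃ k, Jop k 1 = 0 ∧ s (G - Bop p.A₁ p.A₂ (Jop k)) < ε)
    {k : XC} (hk : Jop k 1 = 0) : φ (Jop k) = 0 := by
  obtain ⟨d, hdeg⟩ := p.exists_degree hω hray φ
  obtain ⟨τ, hτ⟩ := (hray 0).D_ne_zero
  set c : ℂ := τ * (ω * I ^ 0)
  have hc : p.D c ≠ 0 := hτ τ le_rfl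
  have hopen : IsOpen {z | p.D z ≠ 0} :=
    isOpen_ne_fun p.differentiable_D.continuous continuous_const
  obtain ⟨r, hr, hball⟩ := nhds_basis_closedBall.mem_iff.1 (hopen.mem_nhds hc)
  have hsph : ∀ z ∈ sphere c r, p.D z ≠ 0 := fun z hz => hball (sphere_subset_closedBall hz)
  have hE : ∀ G, DiffContOnCl ℂ (p.resFun φ G) (ball c r) := fun G => by
    have : DifferentiableOn ℂ (p.resFun φ G) {z | p.D z ≠ 0} := fun z hz =>
      ((φ.differentiable.comp (p.differentiable_N_apply (Jop G)) z).div (p.differentiable_D z)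
        hz).differentiableWithinAt
    exact this.diffContOnCl_ball hball
  have hEs : ∀ G, ContinuousOn (p.resFun φ G) (sphere c r) := fun G =>
    (hE G).continuousOn_ball.mono sphere_subset_closedBall
  obtain ⟨K, hK⟩ := (isCompact_sphere c r).exists_bound_of_continuousOn
    (f := fun z => (p.D z)⁻¹ • p.N z)
    (ContinuousOn.smul (p.differentiable_D.continuous.continuousOn.inv₀ hsph)
      p.differentiable_N.continuous.continuousOn)
  have hbd : ∀ G, ∀ z ∈ sphere c r, ‖p.resFun φ G z‖ ≤ ‖φ‖ * (K * s G) := by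
    intro G z hz
    have e : p.resFun φ G z = φ (((p.D z)⁻¹ • p.N z) (Jop G)) := by
      rw [resFun, div_eq_inv_mul, ← smul_eq_mul, ← map_smul]
      rfl
    rw [e]
    refine (φ.le_opNorm _).trans (mul_le_mul_of_nonneg_left ?_ (norm_nonneg _))
    refine (ContinuousLinearMap.le_opNorm _ _).trans ?_
    exact mul_le_mul (hK z hz) (hs G) (norm_nonneg _) ((norm_nonneg _).trans (hK z hz))
  have key : ∀ i j, d < j + i → ∀ G, cauchyCoeff c r j (p.resFun φ G) = 0 := by
    intro i
    induction i with
    | zero =>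
      intro j hj G
      obtain ⟨H, hH, hHD⟩ := p.exists_resolvent_functional hφ ⟨c, hc⟩ G
      obtain ⟨K', hK'⟩ := hdeg G H hH hHD
      rw [← cauchyCoeff_eq_zero (c := c) hr hH hK' (j := j) (by simpa using hj)]
      refine cauchyCoeff_congr hr j fun z hz => ?_
      rw [resFun, ← hHD z, mul_div_cancel_right₀ _ (hsph z hz)]
    | succ i ih =>
      intro j hj G
      have hb : ∀ k, Jop k 1 = 0 → cauchyCoeff c r j (p.resFun φ (Bop p.A₁ p.A₂ (Jop k))) = 0 :=
        fun k hk => by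
          rw [← cauchyCoeff_succ hr (hEs _) (φ (Jop k)) (fun z hz =>
            resFun_boundary φ c (hsph z hz) hk)]
          exact ih (j + 1) (by omega) _
      set A := 2 * Real.pi * r * ((r ^ (j + 1))⁻¹ * (‖φ‖ * |K|))
      have hA : 0 ≤ A := by positivity
      have hsm : ∀ ε > 0, ‖cauchyCoeff c r j (p.resFun φ G)‖ ≤ A * ε := by
        intro ε hε
        obtain ⟨k, hk, hkε⟩ := hd G ε hε
        have e : cauchyCoeff c r j (p.resFun φ G) =
            cauchyCoeff c r j (p.resFun φ (G - Bop p.A₁ p.A₂ (Jop k))) := by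
          rw [cauchyCoeff_congr hr j fun z _ => resFun_sub φ G _ z,
            cauchyCoeff_sub hr (hEs _) (hEs _), hb k hk, sub_zero]
        rw [e]
        refine (norm_cauchyCoeff_le hr j (hbd _)).trans ?_
        have h1 : 0 ≤ s (G - Bop p.A₁ p.A₂ (Jop k)) := (norm_nonneg _).trans (hs _)
        have h2 : K * s (G - Bop p.A₁ p.A₂ (Jop k)) ≤ |K| * ε :=
          mul_le_mul (le_abs_self K) hkε.le h1 (abs_nonneg _)
        calc _ ≤ 2 * Real.pi * r * ((r ^ (j + 1))⁻¹ * (‖φ‖ * (|K| * ε))) := by gcongr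
          _ = A * ε := by ring
      have : ‖cauchyCoeff c r j (p.resFun φ G)‖ ≤ 0 := by
        refine le_of_forall_pos_le_add fun δ hδ => ?_
        refine (hsm (δ / (A + 1)) (by positivity)).trans ?_
        rw [zero_add, mul_div_assoc', div_le_iff₀ (by positivity)]
        nlinarith
      exact norm_le_zero_iff.1 this
  have h0 := key (d + 1) 0 (by omega) (k - p.M c (Jop k))
  rw [cauchyCoeff_zero hr (hE _) (φ (Jop k)) fun z hz => resFun_boundary φ c (hsph z hz) hk] at h0
  exact (mul_eq_zero.1 h0).resolve_left (by simp [Real.pi_ne_zero])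

end BVP

end

section
open Complex Set Filter Topology MeasureTheory

instance : IsProbabilityMeasure mu01 := by
  refine ⟨?_⟩
  rw [mu01, I01, Measure.restrict_apply_univ, Real.volume_Icc]
  norm_num

theorem ae_mem_mu01 : ∀ᵐ x ∂mu01, x ∈ Icc (0:ℝ) 1 :=
  ae_restrict_mem measurableSet_Icc

/-- The smooth cutoff which equals `1` on `[δ, 1 - δ]` and vanishes outside `(0, 1)`. -/
noncomputable def cutoff (δ x : ℝ) : ℝ :=
  Real.smoothTransition (x / δ) * Real.smoothTransition ((1 - x) / δ)

theorem contDiff_cutoff (δ : ℝ) : ContDiff ℝ 1 (cutoff δ) := by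
  have h : ContDiff ℝ 1 Real.smoothTransition := Real.smoothTransition.contDiff
  exact (h.comp (contDiff_id.div_const δ)).mul
    (h.comp ((contDiff_const.sub contDiff_id).div_const δ))

theorem cutoff_zero (δ : ℝ) : cutoff δ 0 = 0 := by
  simp [cutoff]

theorem cutoff_one (δ : ℝ) : cutoff δ 1 = 0 := by
  simp [cutoff]

theorem cutoff_eq_one {δ x : ℝ} (hδ : 0 < δ) (h : δ ≤ x) (h' : δ ≤ 1 - x) : cutoff δ x = 1 := by
  rw [cutoff, Real.smoothTransition.one_of_one_le ((one_le_div hδ).2 h),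
    Real.smoothTransition.one_of_one_le ((one_le_div hδ).2 h'), one_mul]

theorem cutoff_nonneg (δ x : ℝ) : 0 ≤ cutoff δ x :=
  mul_nonneg (Real.smoothTransition.nonneg _) (Real.smoothTransition.nonneg _)

theorem cutoff_le_one (δ x : ℝ) : cutoff δ x ≤ 1 :=
  mul_le_one₀ (Real.smoothTransition.le_one _) (Real.smoothTransition.nonneg _)
    (Real.smoothTransition.le_one _)

theorem exists_Jop_eq {h : ℝ → ℂ × ℂ} (hh : ContDiff ℝ 1 h) (h0 : h 0 = 0) :
    ∃ k : XC, ∀ x ∈ Icc (0:ℝ) 1, Jop k (pr x) = h x := by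
  have hc : Continuous (deriv h) := hh.continuous_deriv le_rfl
  refine ⟨⟨fun x => deriv h x, hc.comp continuous_subtype_val⟩, fun x hx => ?_⟩
  rw [pr_of_mem hx, Jop_apply, primit]
  have : ∫ t in (0:ℝ)..x, deriv h t = h x - h 0 :=
    intervalIntegral.integral_deriv_eq_sub
      (fun t _ => (hh.differentiable (by simp)).differentiableAt)
      (hc.intervalIntegrable _ _)
  rw [h0, sub_zero] at this
  rw [← this]
  refine intervalIntegral.integral_congr fun t ht => ?_
  rw [uIcc_of_le hx.1] at ht
  rw [pr_of_mem ⟨ht.1, ht.2.trans hx.2⟩]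
  rfl

theorem mu01_ends_le (δ : ℝ) :
    mu01 (Iio δ ∪ Ioi (1 - δ)) ≤ ENNReal.ofReal δ + ENNReal.ofReal δ := by
  refine (measure_union_le _ _).trans (add_le_add ?_ ?_)
  · rw [mu01, Measure.restrict_apply measurableSet_Iio]
    refine (measure_mono (t := Icc 0 δ) fun x hx => ⟨hx.2.1, hx.1.le⟩).trans ?_
    rw [Real.volume_Icc, sub_zero]
  · rw [mu01, Measure.restrict_apply measurableSet_Ioi]
    refine (measure_mono (t := Icc (1 - δ) 1) fun x hx => ⟨hx.1.le, hx.2.2⟩).trans ?_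
    rw [Real.volume_Icc, sub_sub_cancel]

theorem exists_Jop_approx {g : ℝ → ℂ × ℂ} (hg : ContDiff ℝ 1 g) {ε : ℝ} (hε : 0 < ε) :
    ∃ k : XC, Jop k 1 = 0 ∧
      eLpNorm (fun x => g x - Jop k (pr x)) 2 mu01 ≤ ENNReal.ofReal ε := by
  obtain ⟨M, hM⟩ := (isCompact_Icc (a := (0:ℝ)) (b := 1)).exists_bound_of_continuousOn
    hg.continuous.continuousOn
  have hM0 : 0 ≤ M := (norm_nonneg _).trans (hM 0 ⟨le_rfl, zero_le_one⟩)
  set δ : ℝ := (ε / (M + 1)) ^ 2 / 2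
  have hδ : 0 < δ := by positivity
  obtain ⟨k, hk⟩ := exists_Jop_eq (h := fun x => cutoff δ x • g x)
    ((contDiff_cutoff δ).smul hg) (by simp [cutoff_zero])
  refine ⟨k, ?_, ?_⟩
  · have := hk 1 ⟨zero_le_one, le_rfl⟩
    rwa [pr_of_mem ⟨zero_le_one, le_rfl⟩, cutoff_one, zero_smul] at this
  · have hle : eLpNorm (fun x => g x - Jop k (pr x)) 2 mu01 ≤
        eLpNorm ((Iio δ ∪ Ioi (1 - δ)).indicator fun _ => M) 2 mu01 := by
      refine eLpNorm_mono_ae ?_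
      filter_upwards [ae_mem_mu01] with x hx
      rw [hk x hx]
      have he : g x - cutoff δ x • g x = (1 - cutoff δ x) • g x := by
        rw [sub_smul, one_smul]
      by_cases hx' : x ∈ Iio δ ∪ Ioi (1 - δ)
      · rw [indicator_of_mem hx', he, norm_smul, Real.norm_eq_abs, Real.norm_eq_abs,
          abs_of_nonneg (sub_nonneg.2 (cutoff_le_one _ _)), abs_of_nonneg hM0]
        calc _ ≤ 1 * ‖g x‖ := by
              gcongr
              linarith [cutoff_nonneg δ x]
          _ ≤ M := by rw [one_mul]; exact hM x hx
      · rw [indicator_of_notMem hx']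
        simp only [mem_union, mem_Iio, mem_Ioi, not_or, not_lt] at hx'
        rw [he, cutoff_eq_one hδ hx'.1 (by linarith [hx'.2])]
        simp
    refine hle.trans ((eLpNorm_indicator_const_le _ _).trans ?_)
    rw [Real.enorm_of_nonneg hM0]
    calc ENNReal.ofReal M * mu01 (Iio δ ∪ Ioi (1 - δ)) ^ (1 / (2 : ENNReal).toReal)
        ≤ ENNReal.ofReal M * (ENNReal.ofReal ((ε / (M + 1)) ^ 2)) ^ (1 / (2 : ENNReal).toReal) := by
          gcongr
          refine (mu01_ends_le δ).trans ?_
          rw [← ENNReal.ofReal_add hδ.le hδ.le, add_halves]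
      _ = ENNReal.ofReal (M * (ε / (M + 1))) := by
          rw [ENNReal.ofReal_rpow_of_nonneg (by positivity) (by positivity),
            ← ENNReal.ofReal_mul hM0]
          congr 2
          rw [ENNReal.toReal_ofNat, ← Real.sqrt_eq_rpow, Real.sqrt_sq (by positivity)]
      _ ≤ ENNReal.ofReal ε := by
          refine ENNReal.ofReal_le_ofReal ?_
          rw [mul_div_assoc', div_le_iff₀ (by positivity)]
          nlinarith

theorem memLp_comp_pr (y : XC) : MemLp (fun x => y (pr x)) 2 mu01 :=
  MemLp.of_bound (continuous_comp_pr y).aestronglyMeasurable ‖y‖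
    (ae_of_all _ fun _ => y.norm_coe_le_norm _)

/-- Continuous functions as elements of `L²`. -/
noncomputable def toL2 : XC →L[ℂ] Lp (ℂ × ℂ) 2 mu01 :=
  LinearMap.mkContinuous
    { toFun := fun y => (memLp_comp_pr y).toLp
      map_add' := fun y z => (memLp_comp_pr y).toLp_add (memLp_comp_pr z)
      map_smul' := fun c y => (memLp_comp_pr y).toLp_const_smul c } 1 (fun y => by
      rw [one_mul]
      change ‖(memLp_comp_pr y).toLp _‖ ≤ _
      rw [Lp.norm_toLp]
      refine ENNReal.toReal_le_of_le_ofReal (norm_nonneg _) ?_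
      refine (eLpNorm_le_of_ae_bound (C := ‖y‖)
        (ae_of_all _ fun x => y.norm_coe_le_norm (pr x))).trans ?_
      simp)

theorem coeFn_toL2 (y : XC) : toL2 y =ᵐ[mu01] fun x => y (pr x) :=
  (memLp_comp_pr y).coeFn_toLp

theorem norm_toL2 (y : XC) : ‖toL2 y‖ = (eLpNorm (fun x => y (pr x)) 2 mu01).toReal :=
  Lp.norm_toLp _ (memLp_comp_pr y)

theorem norm_Jop_le_norm_toL2 (y : XC) : ‖Jop y‖ ≤ ‖toL2 y‖ := by
  refine (ContinuousMap.norm_le _ (norm_nonneg _)).2 fun x => ?_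
  rw [Jop_apply, primit, norm_toL2]
  have h1 : ‖∫ t in (0:ℝ)..x, y (pr t)‖ ≤ ∫ t, ‖y (pr t)‖ ∂mu01 := by
    refine (intervalIntegral.norm_integral_le_integral_norm x.2.1).trans ?_
    rw [intervalIntegral.integral_of_le x.2.1]
    refine setIntegral_mono_set ?_ (ae_of_all _ fun _ => norm_nonneg _)
      (Eventually.of_forall fun t ht => ⟨ht.1.le, ht.2.trans x.2.2⟩)
    exact (continuous_comp_pr y).norm.continuousOn.integrableOn_compact isCompact_Icc
  refine h1.trans ?_
  rw [integral_norm_eq_lintegral_enorm (continuous_comp_pr y).aestronglyMeasurable,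
    ← eLpNorm_one_eq_lintegral_enorm]
  exact ENNReal.toReal_mono (memLp_comp_pr y).eLpNorm_ne_top
    (eLpNorm_le_eLpNorm_of_exponent_le (by norm_num) (continuous_comp_pr y).aestronglyMeasurable)

theorem dense_Jop : Dense {f : Lp (ℂ × ℂ) 2 mu01 | ∃ k : XC, Jop k 1 = 0 ∧ f = toL2 (Jop k)} := by
  have hd := Lp.dense_hasCompactSupport_contDiff (E := ℝ) (F := ℂ × ℂ) (μ := mu01) (p := 2)
    (by norm_num)
  rw [← dense_closure]
  refine hd.mono ?_
  rintro f ⟨g, hfg, -, hg⟩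
  refine Metric.mem_closure_iff.2 fun ε hε => ?_
  obtain ⟨k, hk, hle⟩ := exists_Jop_approx (hg.of_le (by simp)) (half_pos hε)
  refine ⟨_, ⟨k, hk, rfl⟩, lt_of_le_of_lt ?_ (half_lt_self hε)⟩
  rw [dist_eq_norm, Lp.norm_def]
  refine ENNReal.toReal_le_of_le_ofReal (half_pos hε).le ((eLpNorm_congr_ae ?_).trans_le hle)
  filter_upwards [Lp.coeFn_sub f (toL2 (Jop k)), hfg, coeFn_toL2 (Jop k)] with x h1 h2 h3
  rw [h1, Pi.sub_apply, h2, h3]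

theorem Bop_Jop (A₁ A₂ : ℂ) (k : XC) : Bop A₁ A₂ (Jop k) = Jop (Bop A₁ A₂ k) := by
  ext1 x
  set T : ℂ × ℂ →L[ℂ] ℂ × ℂ := (A₁ • ContinuousLinearMap.fst ℂ ℂ ℂ).prod
    (A₂ • ContinuousLinearMap.snd ℂ ℂ ℂ)
  exact (T.intervalIntegral_comp_comm ((continuous_comp_pr k).intervalIntegrable 0 x)).symm

theorem exists_norm_toL2_sub_lt {A₁ A₂ : ℂ} (h₁ : A₁ ≠ 0) (h₂ : A₂ ≠ 0) (G : XC) {ε : ℝ}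
    (hε : 0 < ε) : ∃ k, Jop k 1 = 0 ∧ ‖toL2 (G - Bop A₁ A₂ (Jop k))‖ < ε := by
  obtain ⟨_, ⟨k, hk, rfl⟩, hlt⟩ := Metric.mem_closure_iff.1 (dense_Jop (toL2 G)) ε hε
  have hB : Bop A₁ A₂ (Bop A₁⁻¹ A₂⁻¹ (Jop k)) = Jop k := by
    ext1 x
    rw [Bop_apply, Bop_apply, mul_inv_cancel_left₀ h₁, mul_inv_cancel_left₀ h₂]
  refine ⟨Bop A₁⁻¹ A₂⁻¹ k, ?_, ?_⟩
  · rw [← Bop_Jop, Bop_apply, hk]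
    simp
  · rwa [← Bop_Jop, hB, map_sub, ← dist_eq_norm]

/-- `y` solves the Dirac-type system when it is the primitive of the right derivative. -/
theorem solvesDirac_of_eq {b₁ b₂ : ℝ} {Q12 Q21 : ℝ → ℂ} {y G : XC} {c : ℂ × ℂ}
    (hy : y = constop c + Jop G) {rhs : ℝ → ℂ × ℂ}
    (h : ∀ x (hx : x ∈ Icc (0:ℝ) 1),
      (-I) * (b₁ : ℂ)⁻¹ * (G ⟨x, hx⟩).1 + Q12 x * (y ⟨x, hx⟩).2 = (rhs x).1 ∧
      (-I) * (b₂ : ℂ)⁻¹ * (G ⟨x, hx⟩).2 + Q21 x * (y ⟨x, hx⟩).1 = (rhs x).2) :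
    SolvesDirac b₁ b₂ Q12 Q21 (fun x => y (pr x)) rhs := by
  refine ⟨fun x => G (pr x), ?_, fun x hx => ?_, ?_⟩
  · exact (continuous_comp_pr G).continuousOn.integrableOn_compact isCompact_Icc
  · have h0 : y (pr 0) = c := by
      rw [pr_of_mem ⟨le_rfl, zero_le_one⟩, hy]
      change c + primit G 0 = c
      rw [primit, intervalIntegral.integral_same, add_zero]
    change y (pr x) = y (pr 0) + _
    rw [h0, pr_of_mem hx, hy]
    rfl
  · filter_upwards [ae_mem_mu01] with x hx
    rw [pr_of_mem hx]
    exact h x hx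

namespace BVP
variable {p : BVP}

theorem IsRootChain.isRootFunction {b₁ b₂ : ℝ} (hb₁ : b₁ ≠ 0) (hb₂ : b₂ ≠ 0) {Q12 Q21 : ℝ → ℂ}
    {a : Fin 2 → Fin 4 → ℂ} (hA₁ : p.A₁ = I * b₁) (hA₂ : p.A₂ = I * b₂)
    (hq₁ : ∀ x, p.q₁ x = -I * b₁ * Q12 x) (hq₂ : ∀ x, p.q₂ x = -I * b₂ * Q21 x)
    (hbc : ∀ f : ℝ → ℂ × ℂ, (f 0).1 + p.β * (f 1).2 = 0 → p.α * (f 0).2 + (f 1).1 = 0 →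
      SatisfiesBC a f) {z : ℂ} {m : ℕ} {v : ℕ → XC} (hv : p.IsRootChain z m v) :
    IsRootFunction b₁ b₂ Q12 Q21 a fun x => v m (pr x) := by
  have hb₁' : (b₁ : ℂ) ≠ 0 := by exact_mod_cast hb₁
  have hb₂' : (b₂ : ℂ) ≠ 0 := by exact_mod_cast hb₂
  refine ⟨z, m, fun j x => v j (pr x), fun j hj => ?_, ?_, ?_, fun j hj hjm => ?_, m, le_rfl, rfl⟩
  · have h := hv.bc j hj
    rw [U_apply, Prod.mk_eq_zero] at h
    refine hbc _ ?_ ?_ <;>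
      simp only [pr_of_mem (show (0:ℝ) ∈ Icc (0:ℝ) 1 from ⟨le_rfl, zero_le_one⟩),
        pr_of_mem (show (1:ℝ) ∈ Icc (0:ℝ) 1 from ⟨zero_le_one, le_rfl⟩)]
    exacts [h.1, h.2]
  · by_contra! h
    refine hv.ne (ContinuousMap.ext fun x => ?_)
    have := h x x.2
    rwa [pr_of_mem x.2] at this
  · obtain ⟨c, hc⟩ := hv.zero
    refine solvesDirac_of_eq hc fun x hx => ?_
    simp only [M_apply, pr_of_mem hx, hA₁, hA₂, hq₁, hq₂, Prod.smul_fst, Prod.smul_snd, smul_eq_mul]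
    constructor <;> field_simp <;> ring_nf <;> simp only [I_sq] <;> ring
  · obtain ⟨i, rfl⟩ : ∃ i, j = i + 1 := ⟨j - 1, by omega⟩
    obtain ⟨c, hc⟩ := hv.succ i hjm
    refine solvesDirac_of_eq hc fun x hx => ?_
    simp only [ContinuousMap.add_apply, M_apply, Bop_apply, pr_of_mem hx, hA₁, hA₂, hq₁, hq₂,
      Prod.fst_add, Prod.snd_add, Prod.smul_fst, Prod.smul_snd, smul_eq_mul, Nat.add_sub_cancel]
    constructor <;> field_simp <;> ring_nf <;> simp only [I_sq] <;> ring

theorem rootSystemComplete {b₁ b₂ : ℝ} (hb₁ : b₁ ≠ 0) (hb₂ : b₂ ≠ 0) {Q12 Q21 : ℝ → ℂ}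
    {a : Fin 2 → Fin 4 → ℂ} (hA₁ : p.A₁ = I * b₁) (hA₂ : p.A₂ = I * b₂)
    (hq₁ : ∀ x, p.q₁ x = -I * b₁ * Q12 x) (hq₂ : ∀ x, p.q₂ x = -I * b₂ * Q21 x)
    (hbc : ∀ f : ℝ → ℂ × ℂ, (f 0).1 + p.β * (f 1).2 = 0 → p.α * (f 0).2 + (f 1).1 = 0 →
      SatisfiesBC a f) {ω : ℂ} (hω : ‖ω‖ = 1) (hray : ∀ k : ℕ, p.PolyBound (ω * I ^ k)) :
    RootSystemComplete b₁ b₂ Q12 Q21 a := by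
  have hA₁' : p.A₁ ≠ 0 := by rw [hA₁]; exact mul_ne_zero I_ne_zero (by exact_mod_cast hb₁)
  have hA₂' : p.A₂ ≠ 0 := by rw [hA₂]; exact mul_ne_zero I_ne_zero (by exact_mod_cast hb₂)
  unfold RootSystemComplete
  set S := {g : Lp (ℂ × ℂ) 2 mu01 |
    ∃ y : ℝ → ℂ × ℂ, IsRootFunction b₁ b₂ Q12 Q21 a y ∧ (g : ℝ → ℂ × ℂ) =ᵐ[mu01] y}
  by_contra hne
  obtain ⟨f, hf⟩ : ∃ f, f ∉ (Submodule.span ℂ S).topologicalClosure := by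
    by_contra! h
    exact hne (Submodule.eq_top_iff'.2 h)
  obtain ⟨φ, u, hφu, hφf⟩ := RCLike.geometric_hahn_banach_closed_point (𝕜 := ℂ)
    ((Submodule.span ℂ S).topologicalClosure.restrictScalars ℝ).convex
    (Submodule.span ℂ S).isClosed_topologicalClosure hf
  have hφ : ∀ g ∈ (Submodule.span ℂ S).topologicalClosure, φ g = 0 := by
    intro g hg
    by_contra h
    have := hφu _ (Submodule.smul_mem _ ((u : ℂ) / φ g) hg)
    rw [map_smul, smul_eq_mul, div_mul_cancel₀ _ h] at this
    exact lt_irrefl u this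
  have hu : 0 < u := by
    have := hφu 0 (zero_mem _)
    rwa [map_zero, map_zero] at this
  have hkill : ∀ g, φ g = 0 := by
    have hcl : IsClosed {g | φ g = 0} := isClosed_eq φ.continuous continuous_const
    refine fun g => hcl.closure_subset_iff.2 ?_ (dense_Jop g)
    rintro _ ⟨k, hk, rfl⟩
    refine p.map_Jop_eq_zero (φ.comp toL2) hω hray (fun z m v hv => ?_) (s := fun G => ‖toL2 G‖)
      norm_Jop_le_norm_toL2 (fun G ε hε => exists_norm_toL2_sub_lt hA₁' hA₂' G hε) hk
    exact hφ _ (Submodule.le_topologicalClosure _ (Submodule.subset_span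
      ⟨_, hv.isRootFunction hb₁ hb₂ hA₁ hA₂ hq₁ hq₂ hbc, coeFn_toL2 _⟩))
  rw [hkill f, map_zero] at hφf
  exact lt_asymm hu hφf

end BVP

theorem leadAt_of_isLittleO {p : ℝ → ℂ} (hc : ContinuousOn p (Icc 0 1)) {k : ℕ} {a : ℂ}
    (h : (fun x : ℝ => p x - a * (x : ℂ) ^ k) =o[𝓝[Icc 0 1] 0] fun x : ℝ => x ^ k) :
    LeadAt p k a := by
  constructor
  · obtain ⟨M, hM⟩ := isCompact_Icc.exists_bound_of_continuousOn hc
    have hM0 : 0 ≤ M := (norm_nonneg _).trans (hM 0 ⟨le_rfl, zero_le_one⟩)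
    obtain ⟨δ, hδ, hδ'⟩ := Metric.mem_nhdsWithin_iff.1 (h.bound one_pos)
    refine ⟨max (‖a‖ + 1) (M / δ ^ k), fun x hx => ?_⟩
    rcases lt_or_ge x δ with hxδ | hxδ
    · have h1 : ‖p x - a * (x : ℂ) ^ k‖ ≤ 1 * ‖x ^ k‖ :=
        hδ' ⟨by rwa [Metric.mem_ball, dist_zero_right, Real.norm_of_nonneg hx.1], hx⟩
      rw [Real.norm_of_nonneg (pow_nonneg hx.1 k)] at h1
      have h2 : ‖a * (x : ℂ) ^ k‖ = ‖a‖ * x ^ k := by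
        rw [norm_mul, norm_pow, Complex.norm_of_nonneg hx.1]
      calc ‖p x‖ = ‖a * (x : ℂ) ^ k + (p x - a * (x : ℂ) ^ k)‖ := by rw [add_sub_cancel]
        _ ≤ ‖a‖ * x ^ k + 1 * x ^ k := (norm_add_le _ _).trans (add_le_add h2.le h1)
        _ = (‖a‖ + 1) * x ^ k := by ring
        _ ≤ _ := mul_le_mul_of_nonneg_right (le_max_left _ _) (pow_nonneg hx.1 k)
    · calc ‖p x‖ ≤ M := hM x hx
        _ = M / δ ^ k * δ ^ k := by field_simp
        _ ≤ M / δ ^ k * x ^ k := by gcongr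
        _ ≤ _ := mul_le_mul_of_nonneg_right (le_max_right _ _) (pow_nonneg hx.1 k)
  · have h' : (fun x : ℝ => p x - a * (x : ℂ) ^ k) =o[𝓝[>] 0] fun x : ℝ => x ^ k := by
      refine h.mono ?_
      rw [← nhdsWithin_Ioc_eq_nhdsGT (zero_lt_one' ℝ)]
      exact nhdsWithin_mono _ Ioc_subset_Icc_self
    have h2 : (fun x : ℝ => p x - a * (x : ℂ) ^ k) =o[𝓝[>] 0] fun x : ℝ => (x : ℂ) ^ k := by
      refine h'.trans_isBigO (Asymptotics.isBigO_of_le _ fun x => ?_)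
      rw [norm_pow, norm_pow, Complex.norm_real]
    have h3 := (h2.tendsto_div_nhds_zero).add_const a
    rw [zero_add] at h3
    refine h3.congr' ?_
    filter_upwards [self_mem_nhdsWithin] with x hx
    have : (x : ℂ) ≠ 0 := by exact_mod_cast (ne_of_gt hx)
    field_simp
    ring

theorem taylorWithinEval_of_vanishing {p : ℝ → ℂ} {s : Set ℝ} {c : ℝ} {k : ℕ}
    (hz : ∀ j < k, iteratedDerivWithin j p s c = 0) (x : ℝ) :
    taylorWithinEval p k s c x =
      ((k.factorial : ℝ)⁻¹ * (x - c) ^ k) • iteratedDerivWithin k p s c := by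
  rw [taylor_within_apply, Finset.sum_range_succ, Finset.sum_eq_zero, zero_add]
  exact fun j hj => by rw [hz j (Finset.mem_range.1 hj), smul_zero]

theorem leadAt_zero {p : ℝ → ℂ} {k : ℕ} (hp : ContDiffOn ℝ k p (Icc 0 1))
    (hz : ∀ j < k, iteratedDerivWithin j p (Icc 0 1) 0 = 0) :
    LeadAt p k ((k.factorial : ℂ)⁻¹ * iteratedDerivWithin k p (Icc 0 1) 0) := by
  refine leadAt_of_isLittleO hp.continuousOn ?_
  have h := taylor_isLittleO (convex_Icc (0:ℝ) 1) ⟨le_rfl, zero_le_one⟩ hp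
  simp only [taylorWithinEval_of_vanishing hz, sub_zero] at h
  refine h.congr_left fun x => ?_
  rw [Complex.real_smul]
  push_cast
  ring

theorem leadAt_one {p : ℝ → ℂ} {k : ℕ} (hp : ContDiffOn ℝ k p (Icc 0 1))
    (hz : ∀ j ≤ k, iteratedDerivWithin j p (Icc 0 1) 1 = 0) :
    LeadAt (fun x => p (1 - x)) k 0 := by
  have hmaps : MapsTo (fun x : ℝ => 1 - x) (Icc 0 1) (Icc 0 1) := fun x hx =>
    ⟨sub_nonneg.2 hx.2, sub_le_self _ hx.1⟩
  have hcont : Continuous fun x : ℝ => 1 - x := by fun_prop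
  refine leadAt_of_isLittleO (hp.continuousOn.comp hcont.continuousOn hmaps) ?_
  have h := taylor_isLittleO (convex_Icc (0:ℝ) 1) ⟨zero_le_one, le_rfl⟩ hp
  simp only [taylorWithinEval_of_vanishing fun j hj => hz j (le_of_lt hj), hz k le_rfl,
    smul_zero, sub_zero] at h
  have ht : Tendsto (fun x : ℝ => 1 - x) (𝓝[Icc 0 1] 0) (𝓝[Icc 0 1] 1) := by
    refine tendsto_nhdsWithin_iff.2 ⟨?_, ?_⟩
    · exact (hcont.tendsto' 0 1 (sub_zero 1)).mono_left nhdsWithin_le_nhds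
    · filter_upwards [self_mem_nhdsWithin] with x hx using hmaps hx
  refine ((h.comp_tendsto ht).congr_left fun x => ?_).trans_isBigO
    (Asymptotics.isBigO_of_le _ fun x => ?_)
  · rw [zero_mul, sub_zero]
  · simp

theorem exists_normalized_bc {a : Fin 2 → Fin 4 → ℂ} (hJ32 : Jdet a 2 1 = 0)
    (hJ14 : Jdet a 0 3 = 0) (hJ13 : Jdet a 0 2 ≠ 0) (hJ42 : Jdet a 3 1 ≠ 0) :
    ∃ α β : ℂ, α ≠ 0 ∧ β ≠ 0 ∧ Jdet a 3 1 = α * β * Jdet a 0 2 ∧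
      ∀ f : ℝ → ℂ × ℂ, (f 0).1 + β * (f 1).2 = 0 → α * (f 0).2 + (f 1).1 = 0 →
        SatisfiesBC a f := by
  obtain ⟨α, hα⟩ : ∃ α, ∀ j, a j 1 = α * a j 2 := by
    refine ⟨Jdet a 0 1 / Jdet a 0 2, fun j => ?_⟩
    rw [div_mul_eq_mul_div, eq_div_iff hJ13]
    simp only [Jdet] at *
    fin_cases j <;> simp <;> grind
  obtain ⟨β, hβ⟩ : ∃ β, ∀ j, a j 3 = β * a j 0 := by
    refine ⟨Jdet a 3 2 / Jdet a 0 2, fun j => ?_⟩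
    rw [div_mul_eq_mul_div, eq_div_iff hJ13]
    simp only [Jdet] at *
    fin_cases j <;> simp <;> grind
  have h42 : Jdet a 3 1 = α * β * Jdet a 0 2 := by
    simp only [Jdet, hα, hβ]
    ring
  rw [h42] at hJ42
  refine ⟨α, β, left_ne_zero_of_mul (left_ne_zero_of_mul hJ42),
    right_ne_zero_of_mul (left_ne_zero_of_mul hJ42), h42, fun f h1 h2 j => ?_⟩
  rw [hα, hβ]
  linear_combination a j 0 * h1 + a j 2 * h2

theorem exists_ray : ∃ ω : ℂ, ‖ω‖ = 1 ∧ ∀ k : ℕ, (ω * I ^ k).im ≠ 0 := by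
  refine ⟨(3 / 5 : ℝ) + (4 / 5 : ℝ) * I, ?_, fun k => ?_⟩
  · rw [Complex.norm_add_mul_I]
    norm_num
  · rw [I_pow_eq_pow_mod]
    have : k % 4 < 4 := Nat.mod_lt _ (by norm_num)
    interval_cases k % 4 <;> simp [pow_succ]

end

/-- Corollary: `P` flat at `1`. -/
theorem statement_15
    (b₁ b₂ : ℝ) (hb₁ : b₁ < 0) (hb₂ : 0 < b₂)
    (Q12 Q21 : ℝ → ℂ) (a : Fin 2 → Fin 4 → ℂ)
    (n : ℕ) (hn : 3 ≤ n)
    (hQ12 : MemW1 n Q12) (hQ21 : MemW1 n Q21)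
    (hJ32 : Jdet a 2 1 = 0) (hJ14 : Jdet a 0 3 = 0)
    (hJ : Jdet a 0 2 * Jdet a 3 1 ≠ 0)
    (P : ℝ → ℂ)
    (hP : ∀ x : ℝ, P x = Jdet a 0 2 * (b₁ : ℂ) * Q12 x + Jdet a 3 1 * (b₂ : ℂ) * Q21 (1 - x))
    (n₀ : ℕ) (hn₀ : n₀ ≤ n - 3)
    (hP0 : iteratedDerivWithin n₀ P I01 0 ≠ 0)
    (hQ121 : Q12 1 ≠ 0)
    (hP1 : ∀ k < n, iteratedDerivWithin k P I01 1 = 0) :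
    RootSystemComplete b₁ b₂ Q12 Q21 a := by
  have hJ13 := left_ne_zero_of_mul hJ
  have hb₁' : (b₁ : ℂ) ≠ 0 := by exact_mod_cast hb₁.ne
  have hb₂' : (b₂ : ℂ) ≠ 0 := by exact_mod_cast hb₂.ne'
  obtain ⟨α, β, hα, hβ, hJ42, hbc⟩ :=
    exists_normalized_bc hJ32 hJ14 hJ13 (right_ne_zero_of_mul hJ)
  have hC12 : ContDiffOn ℝ (n - 1 : ℕ) Q12 (Icc 0 1) := hQ12.1
  have hC21 : ContDiffOn ℝ (n - 1 : ℕ) Q21 (Icc 0 1) := hQ21.1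
  have hCP : ContDiffOn ℝ (n - 1 : ℕ) P (Icc 0 1) := by
    have hr : ContDiffOn ℝ (n - 1 : ℕ) (fun x : ℝ => Q21 (1 - x)) (Icc 0 1) :=
      hC21.comp (by fun_prop) fun x hx => ⟨sub_nonneg.2 hx.2, sub_le_self _ hx.1⟩
    rw [show P = _ from funext hP]
    exact (contDiffOn_const.mul hC12).add (contDiffOn_const.mul hr)
  set p : BVP :=
    { A₁ := Complex.I * b₁
      A₂ := Complex.I * b₂
      α := α
      β := β
      q₁ := ⟨fun x => -Complex.I * b₁ * Q12 x,
        continuous_const.mul (continuousOn_iff_continuous_domRestrict.1 hC12.continuousOn)⟩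
      q₂ := ⟨fun x => -Complex.I * b₂ * Q21 x,
        continuous_const.mul (continuousOn_iff_continuous_domRestrict.1 hC21.continuousOn)⟩ }
    with hp
  have hpP : ∀ x ∈ Icc (0:ℝ) 1, p.P x = Complex.I / Jdet a 0 2 * P x := by
    intro x hx
    rw [BVP.P, hP, hJ42, pr_of_mem hx, pr_of_mem ⟨sub_nonneg.2 hx.2, sub_le_self _ hx.1⟩]
    change -(α * β) * (-Complex.I * b₂ * Q21 (1 - x)) - (-Complex.I * b₁ * Q12 x) = _
    field_simp
    ring
  classical
  have hex : ∃ k, iteratedDerivWithin k P (Icc 0 1) 0 ≠ 0 := ⟨n₀, hP0⟩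
  set k := Nat.find hex
  have hk : k + 2 ≤ n - 1 := by
    have := Nat.find_min' hex hP0
    omega
  have hk0 : iteratedDerivWithin k P (Icc 0 1) 0 ≠ 0 := Nat.find_spec hex
  have hkmin : ∀ j < k, iteratedDerivWithin j P (Icc 0 1) 0 = 0 := fun j hj =>
    not_not.1 (Nat.find_min hex hj)
  have hlead : LeadAt p.P k
      (Complex.I / Jdet a 0 2 * ((k.factorial : ℂ)⁻¹ * iteratedDerivWithin k P (Icc 0 1) 0)) :=
    ((leadAt_zero (hCP.of_le (by exact_mod_cast (by omega : k ≤ n - 1))) hkmin).const_mul _).congr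
      hpP
  have ha : Complex.I / Jdet a 0 2 * ((k.factorial : ℂ)⁻¹ * iteratedDerivWithin k P (Icc 0 1) 0) ≠ 0 :=
    mul_ne_zero (div_ne_zero Complex.I_ne_zero hJ13)
      (mul_ne_zero (inv_ne_zero (by exact_mod_cast k.factorial_ne_zero)) hk0)
  have hflat : ∀ j ≤ n - 1, LeadAt (fun x => p.P (1 - x)) j 0 := by
    intro j hj
    have := (leadAt_one (hCP.of_le (by exact_mod_cast hj)) fun i hi =>
      hP1 i (by omega)).const_mul (Complex.I / Jdet a 0 2)
    rw [mul_zero] at this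
    exact this.congr fun x hx => hpP _ ⟨sub_nonneg.2 hx.2, sub_le_self _ hx.1⟩
  have hq₁ : p.q₁ 1 ≠ 0 :=
    mul_ne_zero (mul_ne_zero (neg_ne_zero.2 Complex.I_ne_zero) hb₁') hQ121
  have hq₂ : p.q₂ 0 ≠ 0 := by
    have h1 : P 1 = 0 := by
      have := hP1 0 (by omega)
      rwa [iteratedDerivWithin_zero] at this
    rw [hP, sub_self] at h1
    refine mul_ne_zero (mul_ne_zero (neg_ne_zero.2 Complex.I_ne_zero) hb₂') fun h0 => ?_
    rw [show Q21 0 = 0 from h0, mul_zero, add_zero] at h1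
    exact mul_ne_zero (mul_ne_zero hJ13 hb₁') hQ121 h1
  obtain ⟨ω, hω, him⟩ := exists_ray
  have hre : ∀ (b : ℝ) (w : ℂ), (Complex.I * b * w).re = -(b * w.im) := fun b w => by simp
  refine p.rootSystemComplete hb₁.ne hb₂.ne' rfl rfl (fun _ => rfl) (fun _ => rfl) hbc hω
    fun j => ?_
  rcases lt_or_gt_of_ne (him j) with h | h
  · refine p.polyBound_second hα hβ ?_ ?_ ha hlead (hflat _ hk) hq₂ hq₁
    · rw [show p.A₁ = Complex.I * b₁ from rfl, hre]
      nlinarith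
    · rw [show p.A₂ = Complex.I * b₂ from rfl, hre]
      nlinarith
  · refine p.polyBound_first hα hβ ?_ ?_ ha hlead (hflat _ (by omega))
    · rw [show p.A₁ = Complex.I * b₁ from rfl, hre]
      nlinarith
    · rw [show p.A₂ = Complex.I * b₂ from rfl, hre]
      nlinarith
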